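/- For every A, B ∈ C_{p,q}, the set Δ(A,B) = {x ∈ C_{p,q} : O_x ⊆ O_A + O_B} is a convex subset of ℝⁿ and is a closed subset of ℝⁿ (in particular its closure is still contained in C_{p,q}). -/

import Mathlib

open Matrix Complex Pointwise

noncomputable def Ipq (p q : ℕ) : Matrix (Fin (p + q)) (Fin (p + q)) ℂ :=
  Matrix.diagonal fun i => if (i : ℕ) < p then 1 else -1

/-- The pseudo-unitary group `U(p,q)` as a set of matrices. -/
def Upq (p q : ℕ) : Set (Matrix (Fin (p + q)) (Fin (p + q)) ℂ) :=
  {g | IsUnit g ∧ g * Ipq p q * g.conjTranspose = Ipq p q}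

/-- The diagonal matrix with entries `i * x_k`. -/
noncomputable def dmat {n : ℕ} (x : Fin n → ℝ) : Matrix (Fin n) (Fin n) ℂ :=
  Matrix.diagonal fun i => Complex.I * (x i : ℂ)

/-- The holomorphic chamber `C_{p,q}`: `x_1 ≥ ⋯ ≥ x_p > x_{p+1} ≥ ⋯ ≥ x_{p+q}`. -/
def Chol (p q : ℕ) : Set (Fin (p + q) → ℝ) :=
  {x | (∀ i j : Fin (p + q), (i : ℕ) ≤ (j : ℕ) → ((j : ℕ) < p ∨ p ≤ (i : ℕ)) → x j ≤ x i) ∧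
       ∀ i j : Fin (p + q), (i : ℕ) < p → p ≤ (j : ℕ) → x j < x i}

/-- The adjoint orbit `O_x = {g d_x g⁻¹ : g ∈ U(p,q)}`. -/
def Orbit (p q : ℕ) (x : Fin (p + q) → ℝ) : Set (Matrix (Fin (p + q)) (Fin (p + q)) ℂ) :=
  {Y | ∃ g ∈ Upq p q, Y = g * dmat x * g⁻¹}

namespace PseudoUnitary

open scoped ComplexOrder

/-! ### Successive differences of a weight -/

/-- The successive differences of a weight, with the convention that the weight ends with `0`. -/
noncomputable def drop {p : ℕ} (w : Fin p → ℝ) (i : Fin p) : ℝ :=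
  w i - if h : (i : ℕ) + 1 < p then w ⟨i + 1, h⟩ else 0

theorem drop_nonneg {p : ℕ} {w : Fin p → ℝ} (hw : Antitone w) (h0 : ∀ i, 0 ≤ w i) (i : Fin p) :
    0 ≤ drop w i := by
  unfold drop
  split_ifs with h
  · have := hw (show i ≤ ⟨i + 1, h⟩ from Fin.le_def.2 (Nat.le_succ _))
    linarith
  · simpa using h0 i

theorem sum_drop_ite {p : ℕ} (w : Fin p → ℝ) (j : Fin p) :
    ∑ i, (if j ≤ i then drop w i else 0) = w j := by
  set W : ℕ → ℝ := fun k => if h : k < p then w ⟨k, h⟩ else 0 with hW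
  have h1 : ∀ i : Fin p, drop w i = W i - W (i + 1) := by
    intro i; simp [drop, hW]
  have h2 : ∀ i : Fin p, (if j ≤ i then drop w i else 0) =
      (fun k : ℕ => if (j : ℕ) ≤ k then W k - W (k + 1) else 0) (i : ℕ) := by
    intro i; rw [h1]; exact if_congr Fin.le_def rfl rfl
  rw [Finset.sum_congr rfl fun i _ => h2 i,
    Fin.sum_univ_eq_sum_range (fun k : ℕ => if (j : ℕ) ≤ k then W k - W (k + 1) else 0)]
  have h3 : ∀ m : ℕ, ∑ k ∈ Finset.range m,
      (if (j : ℕ) ≤ k then W k - W (k + 1) else 0) = if (j : ℕ) ≤ m then W j - W m else 0 := by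
    intro m
    induction m with
    | zero =>
      by_cases hj : (j : ℕ) = 0
      · simp [hj]
      · simp [hj]
    | succ m ih =>
      rw [Finset.sum_range_succ, ih]
      by_cases hjm : (j : ℕ) ≤ m
      · simp [hjm, Nat.le_succ_of_le hjm]
      · by_cases hjm' : (j : ℕ) = m + 1
        · simp [hjm']
        · have : ¬ (j : ℕ) ≤ m + 1 := by omega
          simp [hjm, this]
  rw [h3 p]
  simp [j.2.le, hW]

theorem sum_drop_mul_sum {p : ℕ} (w f : Fin p → ℝ) :
    ∑ i, drop w i * ∑ j : {j // j ≤ i}, f j = ∑ j, w j * f j := by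
  have h1 : ∀ i : Fin p, ∑ j : {j // j ≤ i}, f j = ∑ j, if j ≤ i then f j else 0 := by
    intro i
    rw [← Finset.sum_filter]
    exact (Finset.sum_subtype (Finset.univ.filter (· ≤ i)) (by simp) f).symm
  simp_rw [h1, Finset.mul_sum]
  rw [Finset.sum_comm]
  refine Finset.sum_congr rfl fun j _ => ?_
  rw [← sum_drop_ite w j, Finset.sum_mul]
  refine Finset.sum_congr rfl fun i _ => ?_
  split_ifs <;> simp

theorem sum_drop_mul_card {p : ℕ} (w : Fin p → ℝ) :
    ∑ i, drop w i * (Fintype.card {j // j ≤ i} : ℝ) = ∑ j, w j := by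
  simpa using sum_drop_mul_sum w 1

theorem drop_add_smul {p : ℕ} (x y : Fin p → ℝ) (s t : ℝ) (i : Fin p) :
    drop (s • x + t • y) i = s * drop x i + t * drop y i := by
  unfold drop
  split_ifs
  · simp only [Pi.add_apply, Pi.smul_apply, smul_eq_mul]; ring
  · simp

theorem drop_last {p : ℕ} (w : Fin p → ℝ) (i : Fin p) (hi : (i : ℕ) + 1 = p) :
    drop w i = w i := by
  simp [drop, hi]

/-! ### Leading columns of a frame -/

/-- The columns of `G` with index at most `i`. -/
def pre {p : ℕ} {m : Type*} {R : Type*} (G : Matrix m (Fin p) R) (i : Fin p) :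
    Matrix m {j // j ≤ i} R :=
  G.submatrix id Subtype.val

@[simp] theorem mul_pre {p : ℕ} {l m : Type*} [Fintype m] (M : Matrix l m ℂ)
    (G : Matrix m (Fin p) ℂ) (i : Fin p) : M * pre G i = pre (M * G) i := by
  ext a b; simp [pre, Matrix.mul_apply]

/-- The weighted defect of the ranks of the leading columns. -/
noncomputable def defect {p : ℕ} {m : Type*} (M : Matrix m (Fin p) ℂ)
    (w : Fin p → ℝ) : ℝ :=
  ∑ i, drop w i * ((Fintype.card {j // j ≤ i} : ℝ) - ((pre M i).rank : ℝ))

/-- Weighted logarithm of the leading minors. -/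
noncomputable def lw {p : ℕ} (w : Fin p → ℝ) (S : Matrix (Fin p) (Fin p) ℂ) : ℝ :=
  ∑ i, drop w i * Real.log (S.submatrix (Subtype.val : {j // j ≤ i} → Fin p) Subtype.val).det.re

theorem defect_add_smul {p : ℕ} {m : Type*} (M : Matrix m (Fin p) ℂ)
    (x y : Fin p → ℝ) (s t : ℝ) :
    defect M (s • x + t • y) = s * defect M x + t * defect M y := by
  simp only [defect, drop_add_smul, Finset.mul_sum, ← Finset.sum_add_distrib]
  exact Finset.sum_congr rfl fun i _ => by ring

theorem conjTranspose_pre_mul {p : ℕ} {m : Type*} [Fintype m] (G : Matrix m (Fin p) ℂ)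
    (S : Matrix m m ℂ) (i : Fin p) :
    (pre G i)ᴴ * S * pre G i = (Gᴴ * S * G).submatrix Subtype.val Subtype.val := by
  ext a b; simp [pre, Matrix.mul_apply]

/-- Semistability of a triple of flags in two spaces together with a bilinear form. -/
def Semi {p q : ℕ} (ζ : Matrix (Fin p) (Fin q) ℂ) (G : Fin 3 → Matrix (Fin p) (Fin p) ℂ)
    (F : Fin 3 → Matrix (Fin q) (Fin q) ℂ) (w₁ : Fin 3 → Fin p → ℝ) (w₂ : Fin 3 → Fin q → ℝ)
    (Γ κ : ℝ) : Prop :=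
  ∀ (R₁ : Matrix (Fin p) (Fin p) ℂ) (R₂ : Matrix (Fin q) (Fin q) ℂ), R₁ * ζ * R₂ᵀ = 0 →
    ∑ k, defect (R₁ * G k) (w₁ k) + ∑ k, defect (R₂ * F k) (w₂ k)
      - Γ * ((p : ℝ) - R₁.rank) - Γ * ((q : ℝ) - R₂.rank) ≤ κ

theorem Semi.add_smul {p q : ℕ} {ζ : Matrix (Fin p) (Fin q) ℂ}
    {G : Fin 3 → Matrix (Fin p) (Fin p) ℂ} {F : Fin 3 → Matrix (Fin q) (Fin q) ℂ}
    {w₁ w₁' : Fin 3 → Fin p → ℝ} {w₂ w₂' : Fin 3 → Fin q → ℝ} {Γ κ κ' : ℝ}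
    (h : Semi ζ G F w₁ w₂ Γ κ) (h' : Semi ζ G F w₁' w₂' Γ κ') {s t : ℝ} (hs : 0 ≤ s) (ht : 0 ≤ t)
    (hst : s + t = 1) :
    Semi ζ G F (s • w₁ + t • w₁') (s • w₂ + t • w₂') Γ (s * κ + t * κ') := by
  intro R₁ R₂ hR
  have e := mul_le_mul_of_nonneg_left (h R₁ R₂ hR) hs
  have e' := mul_le_mul_of_nonneg_left (h' R₁ R₂ hR) ht
  simp only [Pi.add_apply, Pi.smul_apply, defect_add_smul, Finset.sum_add_distrib,
    ← Finset.mul_sum]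
  have hs' : s = 1 - t := by linarith
  subst hs'
  linarith

/-! ### Spectral decomposition and row projections -/

theorem exists_spectral {m : Type*} [Fintype m] [DecidableEq m] {M : Matrix m m ℂ}
    (hM : M.IsHermitian) :
    ∃ (u : Matrix m m ℂ) (l : m → ℝ), u ∈ unitaryGroup m ℂ ∧
      M = u * diagonal (fun i => (l i : ℂ)) * uᴴ ∧ M.rank = Fintype.card {i // l i ≠ 0} ∧
      (M.PosDef → ∀ i, 0 < l i) := by
  refine ⟨hM.eigenvectorUnitary, hM.eigenvalues, hM.eigenvectorUnitary.2, ?_,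
    hM.rank_eq_card_non_zero_eigs, fun h i => h.eigenvalues_pos i⟩
  conv_lhs => rw [hM.spectral_theorem]
  rw [Unitary.conjStarAlgAut_apply]
  rfl

theorem unitary_mul_conjTranspose {m : Type*} [Fintype m] [DecidableEq m] {u : Matrix m m ℂ}
    (hu : u ∈ unitaryGroup m ℂ) : u * uᴴ = 1 := by
  simpa [star_eq_conjTranspose] using (mem_unitaryGroup_iff.1 hu)

theorem unitary_conjTranspose_mul {m : Type*} [Fintype m] [DecidableEq m] {u : Matrix m m ℂ}
    (hu : u ∈ unitaryGroup m ℂ) : uᴴ * u = 1 := by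
  simpa [star_eq_conjTranspose] using (mem_unitaryGroup_iff'.1 hu)

/-- The diagonal projection onto the coordinates in `S`. -/
def coordProj {m : Type*} [DecidableEq m] (S : Finset m) : Matrix m m ℂ :=
  diagonal fun i => if i ∈ S then 1 else 0

theorem coordProj_mul_self {m : Type*} [Fintype m] [DecidableEq m] (S : Finset m) :
    coordProj S * coordProj S = coordProj S := by
  simp [coordProj]

theorem coordProj_conjTranspose {m : Type*} [DecidableEq m] (S : Finset m) :
    (coordProj S)ᴴ = coordProj S := by
  rw [coordProj, diagonal_conjTranspose]
  congr 1; ext i; by_cases h : i ∈ S <;> simp [h]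

theorem coordProj_transpose {m : Type*} [DecidableEq m] (S : Finset m) :
    (coordProj S)ᵀ = coordProj S := by
  rw [coordProj, diagonal_transpose]

theorem rank_coordProj {m : Type*} [Fintype m] [DecidableEq m] (S : Finset m) :
    (coordProj S).rank = S.card := by
  rw [coordProj, rank_diagonal]
  simp [Fintype.card_subtype]

theorem trace_coordProj {m : Type*} [Fintype m] [DecidableEq m] (S : Finset m) :
    (coordProj S).trace = S.card := by
  rw [coordProj, trace_diagonal]
  simp

/-- Every matrix has the same row space as a coordinate projection in a unitary basis. -/
theorem exists_coordProj_rowEquiv {m : Type*} [Fintype m] [DecidableEq m] (R : Matrix m m ℂ) :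
    ∃ u ∈ unitaryGroup m ℂ, ∃ (S : Finset m) (X Y : Matrix m m ℂ),
      R = X * (coordProj S * uᴴ) ∧ coordProj S * uᴴ = Y * R ∧ R.rank = S.card := by
  obtain ⟨u, l, hu, h, hr, -⟩ := exists_spectral (isHermitian_conjTranspose_mul_self R)
  have hu1 := unitary_conjTranspose_mul hu
  have hu2 := unitary_mul_conjTranspose hu
  classical
  set S : Finset m := Finset.univ.filter fun i => l i ≠ 0 with hS
  have hlS : diagonal (fun i => (l i : ℂ)) * (1 - coordProj S) = 0 := by
    rw [mul_sub, mul_one, coordProj, diagonal_mul_diagonal, sub_eq_zero]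
    congr 1; ext i; by_cases hi : l i = 0 <;> simp [hS, hi]
  have hY : diagonal (fun i => ((l i : ℂ))⁻¹) * diagonal (fun i => (l i : ℂ)) = coordProj S := by
    rw [coordProj, diagonal_mul_diagonal]
    congr 1; ext i; by_cases hi : l i = 0 <;> simp [hS, hi]
  refine ⟨u, hu, S, R * u, diagonal (fun i => ((l i : ℂ))⁻¹) * uᴴ * Rᴴ, ?_, ?_, ?_⟩
  · have h0 : R * u * (1 - coordProj S) = 0 := by
      rw [← conjTranspose_mul_self_eq_zero]
      have : (R * u * (1 - coordProj S))ᴴ * (R * u * (1 - coordProj S)) =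
          (1 - coordProj S)ᴴ * (uᴴ * (Rᴴ * R) * u) * (1 - coordProj S) := by
        simp only [conjTranspose_mul, Matrix.mul_assoc]
      rw [this, h]
      have : uᴴ * (u * diagonal (fun i => (l i : ℂ)) * uᴴ) * u = diagonal (fun i => (l i : ℂ)) := by
        calc _ = (uᴴ * u) * diagonal (fun i => (l i : ℂ)) * (uᴴ * u) := by
              simp only [Matrix.mul_assoc]
          _ = _ := by rw [hu1]; simp
      rw [this, Matrix.mul_assoc, hlS, Matrix.mul_zero]
    rw [mul_sub, mul_one, sub_eq_zero] at h0
    rw [← Matrix.mul_assoc, ← h0, Matrix.mul_assoc, hu2, mul_one]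
  · rw [Matrix.mul_assoc _ Rᴴ R, h, ← hY]
    calc _ = diagonal (fun i => ((l i : ℂ))⁻¹) * (1 * diagonal (fun i => (l i : ℂ)) * uᴴ) := by
          simp only [Matrix.mul_assoc, Matrix.one_mul]
      _ = _ := by rw [← hu1]; simp only [Matrix.mul_assoc]
  · rw [← rank_conjTranspose_mul_self, hr, Fintype.card_subtype]

theorem rank_mul_congr {m n : Type*} [Fintype m] [Fintype n] {R P X Y : Matrix m m ℂ}
    (h : R = X * P) (h' : P = Y * R) (B : Matrix m n ℂ) : (R * B).rank = (P * B).rank := by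
  apply le_antisymm
  · rw [h, Matrix.mul_assoc]; exact rank_mul_le_right _ _
  · rw [h', Matrix.mul_assoc]; exact rank_mul_le_right _ _

theorem defect_congr {p : ℕ} {m : Type*} [Fintype m] {R P X Y : Matrix m m ℂ}
    (h : R = X * P) (h' : P = Y * R) (B : Matrix m (Fin p) ℂ) (w : Fin p → ℝ) :
    defect (R * B) w = defect (P * B) w := by
  simp only [defect, ← mul_pre, rank_mul_congr h h']

/-! ### A trace estimate -/

theorem card_sub_rank_le_trace {k l : Type*} [Fintype k] [DecidableEq k] [Fintype l]
    {Θ : Matrix k k ℂ} (hΘ : Θ.PosSemidef) (C : Matrix l k ℂ)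
    (h : ∀ v : k → ℂ, C *ᵥ v = 0 → (star v ⬝ᵥ v).re ≤ (star v ⬝ᵥ (Θ *ᵥ v)).re) :
    (Fintype.card k : ℝ) - C.rank ≤ Θ.trace.re := by
  obtain ⟨u, l, hu, hs, hr, -⟩ := exists_spectral (isHermitian_conjTranspose_mul_self C)
  have hu1 := unitary_conjTranspose_mul hu
  have hu2 := unitary_mul_conjTranspose hu
  rw [rank_conjTranspose_mul_self] at hr
  have htr : Θ.trace = ∑ i, star (u.col i) ⬝ᵥ (Θ *ᵥ u.col i) := by
    have : Θ.trace = (uᴴ * Θ * u).trace := by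
      rw [trace_mul_comm, ← Matrix.mul_assoc, hu2, Matrix.one_mul]
    rw [this, trace]
    refine Finset.sum_congr rfl fun i _ => ?_
    rw [diag_apply, Matrix.mul_assoc, mul_apply_eq_vecMul]
    simp [dotProduct, Matrix.mulVec, Matrix.vecMul, Matrix.mul_apply, conjTranspose_apply]
  have hcol : ∀ i, star (u.col i) ⬝ᵥ u.col i = 1 := by
    intro i
    have := congrFun (congrFun hu1 i) i
    simpa [Matrix.mul_apply, dotProduct] using this
  have hker : ∀ i, l i = 0 → C *ᵥ u.col i = 0 := by
    intro i hi
    rw [← conjTranspose_mul_self_mulVec_eq_zero, hs]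
    ext a
    have : (u * diagonal (fun i => (l i : ℂ)) * uᴴ * u) a i = 0 := by
      rw [Matrix.mul_assoc, hu1, Matrix.mul_one, mul_diagonal, hi]; simp
    simpa [Matrix.mulVec, Matrix.mul_apply, dotProduct] using this
  rw [htr, Complex.re_sum]
  have hcard : (Fintype.card k : ℝ) - C.rank = ∑ i, if l i = 0 then (1 : ℝ) else 0 := by
    have : ∑ i, (if l i = 0 then (1 : ℝ) else 0) =
        ∑ i, ((1 : ℝ) - if l i ≠ 0 then (1 : ℝ) else 0) :=
      Finset.sum_congr rfl fun i _ => by by_cases hi : l i = 0 <;> simp [hi]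
    rw [this, Finset.sum_sub_distrib, hr, Fintype.card_subtype, Finset.card_filter]
    simp
  rw [hcard]
  refine Finset.sum_le_sum fun i _ => ?_
  split_ifs with hi
  · have := h _ (hker i hi)
    rwa [hcol, Complex.one_re] at this
  · exact hΘ.re_dotProduct_nonneg _

/-- The compression of a two-block test matrix to a graph subspace. -/
def compr {m n : Type*} [Fintype m] [Fintype n] [DecidableEq m] (z : Matrix m n ℂ)
    (e : Matrix m m ℂ) (f : Matrix n n ℂ) : Matrix m m ℂ :=
  (1 - e) + e * (z * f * zᴴ) + z * f * zᴴ * e - z * f * zᴴ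

theorem posSemidef_of_proj {m : Type*} [Fintype m] {e : Matrix m m ℂ} (he : eᴴ = e)
    (hee : e * e = e) : e.PosSemidef := by
  have := posSemidef_conjTranspose_mul_self e
  rwa [he, hee] at this

theorem proj_one_sub {m : Type*} [Fintype m] [DecidableEq m] {e : Matrix m m ℂ} (he : eᴴ = e)
    (hee : e * e = e) : (1 - e)ᴴ = 1 - e ∧ (1 - e) * (1 - e) = 1 - e := by
  refine ⟨by simp [he], ?_⟩
  simp [mul_sub, sub_mul, hee]

theorem compr_posSemidef {m n : Type*} [Fintype m] [Fintype n] [DecidableEq m] [DecidableEq n]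
    {z : Matrix m n ℂ} {e : Matrix m m ℂ} {f : Matrix n n ℂ} (hK : (1 - z * zᴴ).PosSemidef)
    (he : eᴴ = e) (hee : e * e = e) (hf : fᴴ = f) (hff : f * f = f) :
    (compr z e f).PosSemidef := by
  obtain ⟨he', hee'⟩ := proj_one_sub he hee
  obtain ⟨hf', hff'⟩ := proj_one_sub hf hff
  have h1 : (z * f * zᴴ).PosSemidef := (posSemidef_of_proj hf hff).mul_mul_conjTranspose_same z
  have h2 : (z * (1 - f) * zᴴ).PosSemidef :=
    (posSemidef_of_proj hf' hff').mul_mul_conjTranspose_same z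
  have h3 := (hK.add h2).conjTranspose_mul_mul_same (1 - e)
  have h4 := h1.conjTranspose_mul_mul_same e
  have h5 := h3.add h4
  rw [he, he'] at h5
  convert h5 using 1
  have : (1 - e) * (1 - z * zᴴ + z * (1 - f) * zᴴ) * (1 - e) =
      (1 - e) * (1 - e) - (1 - e) * (z * f * zᴴ) * (1 - e) := by
    simp only [Matrix.mul_add, Matrix.mul_sub, Matrix.add_mul, Matrix.sub_mul,
      Matrix.mul_one, Matrix.one_mul, Matrix.mul_assoc]
    abel
  rw [this, hee', compr]
  noncomm_ring

theorem compr_eq {m n : Type*} [Fintype m] [Fintype n] [DecidableEq m] [DecidableEq n]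
    {z : Matrix m n ℂ} {e : Matrix m m ℂ} {f : Matrix n n ℂ} (hee : e * e = e) :
    compr z e f = (1 - z * zᴴ) + ((1 - e) * (z * (1 - f) * zᴴ) * (1 - e) +
      e * ((1 - z * zᴴ) + z * f * zᴴ) * e) - e * (1 - z * zᴴ) - (1 - z * zᴴ) * e := by
  have : (1 - z * zᴴ) + ((1 - e) * (z * (1 - f) * zᴴ) * (1 - e) +
      e * ((1 - z * zᴴ) + z * f * zᴴ) * e) - e * (1 - z * zᴴ) - (1 - z * zᴴ) * e =
      compr z e f + (e * e - e) := by
    rw [compr]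
    simp only [Matrix.mul_add, Matrix.mul_sub, Matrix.add_mul, Matrix.sub_mul,
      Matrix.mul_one, Matrix.one_mul, Matrix.mul_assoc]
    abel
  rw [this, hee, sub_self, add_zero]

theorem star_dotProduct_mulVec_mulVec {m k : Type*} [Fintype m] [Fintype k]
    (M : Matrix m m ℂ) (Y : Matrix m k ℂ) (v : k → ℂ) :
    star v ⬝ᵥ ((Yᴴ * M * Y) *ᵥ v) = star (Y *ᵥ v) ⬝ᵥ (M *ᵥ (Y *ᵥ v)) := by
  rw [star_mulVec, ← dotProduct_mulVec]
  simp only [mulVec_mulVec, Matrix.mul_assoc]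

theorem card_sub_rank_le_trace_compr {m n k : Type*} [Fintype m] [Fintype n] [Fintype k]
    [DecidableEq m] [DecidableEq n] [DecidableEq k]
    {z : Matrix m n ℂ} {e : Matrix m m ℂ} {f : Matrix n n ℂ} (hK : (1 - z * zᴴ).PosSemidef)
    (he : eᴴ = e) (hee : e * e = e) (hf : fᴴ = f) (hff : f * f = f) (Y : Matrix m k ℂ)
    (hY : Yᴴ * (1 - z * zᴴ) * Y = 1) :
    (Fintype.card k : ℝ) - (e * ((1 - z * zᴴ) * Y)).rank ≤ (Yᴴ * compr z e f * Y).trace.re := by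
  refine card_sub_rank_le_trace
    ((compr_posSemidef hK he hee hf hff).conjTranspose_mul_mul_same Y) _ fun v hv => ?_
  obtain ⟨he', hee'⟩ := proj_one_sub he hee
  obtain ⟨hf', hff'⟩ := proj_one_sub hf hff
  have h1 : (z * f * zᴴ).PosSemidef := (posSemidef_of_proj hf hff).mul_mul_conjTranspose_same z
  have h2 : (z * (1 - f) * zᴴ).PosSemidef :=
    (posSemidef_of_proj hf' hff').mul_mul_conjTranspose_same z
  have h3 := h2.conjTranspose_mul_mul_same (1 - e)
  have h4 := (hK.add h1).conjTranspose_mul_mul_same e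
  have h5 := h3.add h4
  rw [he, he'] at h5
  rw [star_dotProduct_mulVec_mulVec, compr_eq hee]
  have hvv : star v ⬝ᵥ v = star (Y *ᵥ v) ⬝ᵥ ((1 - z * zᴴ) *ᵥ (Y *ᵥ v)) := by
    rw [← star_dotProduct_mulVec_mulVec, hY, one_mulVec]
  have hv0 : (e * (1 - z * zᴴ)) *ᵥ (Y *ᵥ v) = 0 := by
    rw [mulVec_mulVec, Matrix.mul_assoc]; exact hv
  have hv1 : star (Y *ᵥ v) ⬝ᵥ (((1 - z * zᴴ) * e) *ᵥ (Y *ᵥ v)) = 0 := by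
    have : star ((e * (1 - z * zᴴ)) *ᵥ (Y *ᵥ v)) ⬝ᵥ (Y *ᵥ v) = 0 := by rw [hv0]; simp
    rw [star_mulVec, ← dotProduct_mulVec, conjTranspose_mul, he, hK.1.eq] at this
    exact this
  rw [sub_mulVec, sub_mulVec, add_mulVec, dotProduct_sub, dotProduct_sub, dotProduct_add, hv0, hv1,
    hvv]
  have := h5.re_dotProduct_nonneg (Y *ᵥ v)
  simp only [dotProduct_zero, sub_zero, Complex.add_re]
  have h6 : 0 ≤ (star (Y *ᵥ v) ⬝ᵥ (((1 - e) * (z * (1 - f) * zᴴ) * (1 - e) +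
      e * ((1 - z * zᴴ) + z * f * zᴴ) * e) *ᵥ (Y *ᵥ v))).re := this
  linarith

/-- The signature matrix on two blocks. -/
abbrev sig (m n : Type*) [DecidableEq m] [DecidableEq n] : Matrix (m ⊕ n) (m ⊕ n) ℂ :=
  fromBlocks 1 0 0 (-1)

theorem trace_diag_weight {p : ℕ} {m : Type*} [Fintype m] (X : Matrix m (Fin p) ℂ)
    (M : Matrix m m ℂ) (w : Fin p → ℝ) :
    (Xᴴ * M * X * diagonal (fun i => (w i : ℂ))).trace.re =
      ∑ i, drop w i * ((pre X i)ᴴ * M * pre X i).trace.re := by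
  have h1 : (Xᴴ * M * X * diagonal (fun i => (w i : ℂ))).trace.re =
      ∑ j, w j * ((Xᴴ * M * X) j j).re := by
    rw [trace, Complex.re_sum]
    refine Finset.sum_congr rfl fun j _ => ?_
    rw [diag_apply, mul_diagonal, mul_comm, Complex.re_ofReal_mul]
  rw [h1, ← sum_drop_mul_sum]
  refine Finset.sum_congr rfl fun i _ => ?_
  rw [conjTranspose_pre_mul, trace, Complex.re_sum]
  rfl

theorem defect_le_trace_compr {p : ℕ} {m n : Type*} [Fintype m] [Fintype n]
    [DecidableEq m] [DecidableEq n]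
    {z : Matrix m n ℂ} {e : Matrix m m ℂ} {f : Matrix n n ℂ} (hK : (1 - z * zᴴ).PosSemidef)
    (he : eᴴ = e) (hee : e * e = e) (hf : fᴴ = f) (hff : f * f = f) (Y : Matrix m (Fin p) ℂ)
    (hY : Yᴴ * (1 - z * zᴴ) * Y = 1) {w : Fin p → ℝ} (hw : Antitone w) (hw0 : ∀ i, 0 ≤ w i) :
    defect (e * ((1 - z * zᴴ) * Y)) w ≤
      (Yᴴ * compr z e f * Y * diagonal (fun i => (w i : ℂ))).trace.re := by
  rw [trace_diag_weight, defect]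
  refine Finset.sum_le_sum fun i _ => mul_le_mul_of_nonneg_left ?_ (drop_nonneg hw hw0 i)
  rw [← mul_pre, ← mul_pre]
  refine card_sub_rank_le_trace_compr hK he hee hf hff _ ?_
  rw [conjTranspose_pre_mul, hY]
  exact submatrix_one _ Subtype.val_injective

theorem trace_blocks {m n : Type*} [Fintype m] [Fintype n] (A : Matrix m m ℂ) (B : Matrix m n ℂ)
    (C : Matrix n m ℂ) (D : Matrix n n ℂ) : (fromBlocks A B C D).trace = A.trace + D.trace := by
  simp [trace]

theorem trace_test_graph {m n k l : Type*} [Fintype m] [Fintype n] [DecidableEq m] [DecidableEq n]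
    [Fintype k] [Fintype l] [DecidableEq k] [DecidableEq l]
    (z : Matrix m n ℂ) (e : Matrix m m ℂ) (f : Matrix n n ℂ) (he : eᴴ = e) (hf : fᴴ = f)
    (X : Matrix m k ℂ) (W : Matrix n l ℂ)
    (a₁ : k → ℂ) (a₂ : l → ℂ) :
    (fromBlocks (1 - e) (-(e * z * f)) (-(e * z * f)ᴴ) (-f) *
      (fromBlocks X (-(z * W)) (-(zᴴ * X)) W * fromBlocks (diagonal a₁) 0 0 (diagonal a₂) *
        (fromBlocks X (-(z * W)) (-(zᴴ * X)) W)ᴴ)).trace =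
      (Xᴴ * compr z e f * X * diagonal a₁).trace +
        (Wᴴ * compr zᴴ f e * W * diagonal a₂).trace -
          (Wᴴ * (1 - zᴴ * z) * W * diagonal a₂).trace := by
  set g : Matrix (m ⊕ n) (k ⊕ l) ℂ := fromBlocks X (-(z * W)) (-(zᴴ * X)) W with hg
  rw [← Matrix.mul_assoc, trace_mul_comm, ← Matrix.mul_assoc, ← Matrix.mul_assoc, hg]
  rw [fromBlocks_conjTranspose, fromBlocks_multiply, fromBlocks_multiply, fromBlocks_multiply,
    trace_blocks, add_sub_assoc, ← trace_sub]
  congr 2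
  · rw [Matrix.mul_zero, add_zero]
    congr 1
    simp only [conjTranspose_neg, conjTranspose_mul, conjTranspose_conjTranspose, he, hf, compr,
      Matrix.mul_add, Matrix.mul_sub, Matrix.add_mul, Matrix.sub_mul, Matrix.neg_mul,
      Matrix.mul_neg, Matrix.mul_one, Matrix.mul_assoc]
    abel
  · rw [Matrix.mul_zero, zero_add, ← Matrix.sub_mul]
    congr 1
    simp only [conjTranspose_neg, conjTranspose_mul, conjTranspose_conjTranspose, he, hf, compr,
      Matrix.mul_add, Matrix.mul_sub, Matrix.add_mul, Matrix.sub_mul, Matrix.neg_mul,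
      Matrix.mul_neg, Matrix.mul_one, Matrix.mul_assoc]
    abel

/-- The real diagonal matrix on two blocks. -/
abbrev dg {m n : Type*} [DecidableEq m] [DecidableEq n] (a₁ : m → ℝ) (a₂ : n → ℝ) :
    Matrix (m ⊕ n) (m ⊕ n) ℂ :=
  fromBlocks (diagonal fun i => (a₁ i : ℂ)) 0 0 (diagonal fun i => (a₂ i : ℂ))

/-- The block form of the sum problem for pseudo-unitary congruence orbits. -/
def Sol {m n : Type*} [Fintype m] [Fintype n] [DecidableEq m] [DecidableEq n]
    (a₁ b₁ x₁ : m → ℝ) (a₂ b₂ x₂ : n → ℝ) : Prop :=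
  ∃ g h : Matrix (m ⊕ n) (m ⊕ n) ℂ, gᴴ * sig m n * g = sig m n ∧ hᴴ * sig m n * h = sig m n ∧
    g * dg a₁ a₂ * gᴴ + h * dg b₁ b₂ * hᴴ = dg x₁ x₂

theorem posDef_of_conj_eq_one {m : Type*} [Fintype m] [DecidableEq m] {K X : Matrix m m ℂ}
    (h : Xᴴ * K * X = 1) : K.PosDef := by
  have hX : IsUnit X := by
    rw [isUnit_iff_isUnit_det]
    exact isUnit_det_of_left_inverse h
  rw [← hX.posDef_star_left_conjugate_iff, star_eq_conjTranspose, h]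
  exact PosDef.one

theorem exists_graph_form {m n : Type*} [Fintype m] [Fintype n] [DecidableEq m] [DecidableEq n]
    {g : Matrix (m ⊕ n) (m ⊕ n) ℂ} (hg : gᴴ * sig m n * g = sig m n) :
    ∃ (z : Matrix m n ℂ) (X : Matrix m m ℂ) (W : Matrix n n ℂ),
      g = fromBlocks X (-(z * W)) (-(zᴴ * X)) W ∧ Xᴴ * (1 - z * zᴴ) * X = 1 ∧
      Wᴴ * (1 - zᴴ * z) * W = 1 := by
  obtain ⟨a, b, c, d, rfl⟩ : ∃ a b c d, g = fromBlocks a b c d :=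
    ⟨_, _, _, _, (fromBlocks_toBlocks g).symm⟩
  rw [fromBlocks_conjTranspose, fromBlocks_multiply, fromBlocks_multiply, fromBlocks_inj] at hg
  simp only [Matrix.mul_one, Matrix.mul_zero, add_zero, zero_add, Matrix.mul_neg,
    Matrix.neg_mul] at hg
  obtain ⟨h11, -, h21, h22⟩ := hg
  have hdd : dᴴ * d = 1 + bᴴ * b := by
    have : dᴴ * d = bᴴ * b - (bᴴ * b + -(dᴴ * d)) := by abel
    rw [this, h22]; abel
  have hd : IsUnit d.det := by
    have : (dᴴ * d).PosDef := by
      rw [hdd]; exact PosDef.one.add_posSemidef (posSemidef_conjTranspose_mul_self b)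
    have h := this.isUnit
    rw [isUnit_iff_isUnit_det, det_mul] at h
    exact isUnit_of_mul_isUnit_right h
  have hdH : IsUnit dᴴ.det := by rw [det_conjTranspose]; exact hd.star
  have hb : b = b * d⁻¹ * d := by rw [Matrix.mul_assoc, nonsing_inv_mul _ hd, Matrix.mul_one]
  have hc : c = (b * d⁻¹)ᴴ * a := by
    have h : dᴴ * c = bᴴ * a := by
      rw [← sub_eq_zero, ← neg_eq_zero, ← h21]; abel
    rw [conjTranspose_mul, conjTranspose_nonsing_inv, Matrix.mul_assoc, ← h, ← Matrix.mul_assoc,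
      nonsing_inv_mul _ hdH, Matrix.one_mul]
  have hz : ∀ z : Matrix m n ℂ, b = -(z * d) → c = -(zᴴ * a) →
      ∃ (z : Matrix m n ℂ) (X : Matrix m m ℂ) (W : Matrix n n ℂ),
      fromBlocks a b c d = fromBlocks X (-(z * W)) (-(zᴴ * X)) W ∧ Xᴴ * (1 - z * zᴴ) * X = 1 ∧
      Wᴴ * (1 - zᴴ * z) * W = 1 := by
    intro z hb hc
    refine ⟨z, a, d, by rw [← hb, ← hc], ?_, ?_⟩
    · refine Eq.trans ?_ h11
      rw [hc]
      simp only [conjTranspose_neg, conjTranspose_mul, conjTranspose_conjTranspose, Matrix.mul_sub,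
        Matrix.sub_mul, Matrix.mul_one, Matrix.mul_neg, Matrix.neg_mul, Matrix.mul_assoc]
      abel
    · rw [← neg_inj, ← h22, hb]
      simp only [conjTranspose_neg, conjTranspose_mul, Matrix.mul_sub,
        Matrix.sub_mul, Matrix.mul_one, Matrix.mul_neg, Matrix.neg_mul, Matrix.mul_assoc]
      abel
  refine hz (-(b * d⁻¹)) ?_ ?_
  · rw [Matrix.neg_mul, neg_neg, ← hb]
  · rw [conjTranspose_neg, Matrix.neg_mul, neg_neg, ← hc]

/-- The test matrix built from two projections and an off-diagonal block. -/
abbrev testMat {m n : Type*} [DecidableEq m] (e : Matrix m m ℂ) (c : Matrix m n ℂ)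
    (f : Matrix n n ℂ) : Matrix (m ⊕ n) (m ⊕ n) ℂ :=
  fromBlocks (1 - e) (-c) (-cᴴ) (-f)

theorem defect_le_trace_test {p q : ℕ} {z : Matrix (Fin p) (Fin q) ℂ}
    {X : Matrix (Fin p) (Fin p) ℂ} {W : Matrix (Fin q) (Fin q) ℂ}
    (hX : Xᴴ * (1 - z * zᴴ) * X = 1) (hW : Wᴴ * (1 - zᴴ * z) * W = 1)
    {e : Matrix (Fin p) (Fin p) ℂ} {f : Matrix (Fin q) (Fin q) ℂ}
    (he : eᴴ = e) (hee : e * e = e) (hf : fᴴ = f) (hff : f * f = f)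
    {a₁ : Fin p → ℝ} {a₂ : Fin q → ℝ} (h₁ : Antitone a₁) (h₁' : ∀ i, 0 ≤ a₁ i)
    (h₂ : Antitone a₂) (h₂' : ∀ i, 0 ≤ a₂ i) :
    defect (e * ((1 - z * zᴴ) * X)) a₁ + defect (f * ((1 - zᴴ * z) * W)) a₂ - ∑ i, a₂ i ≤
      (testMat e (e * z * f) f * (fromBlocks X (-(z * W)) (-(zᴴ * X)) W * dg a₁ a₂ *
        (fromBlocks X (-(z * W)) (-(zᴴ * X)) W)ᴴ)).trace.re := by
  have hK := (posDef_of_conj_eq_one hX).posSemidef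
  have hN := (posDef_of_conj_eq_one hW).posSemidef
  rw [trace_test_graph z e f he hf X W, hW]
  have e1 := defect_le_trace_compr hK he hee hf hff X hX h₁ h₁'
  have e2 := defect_le_trace_compr (z := zᴴ) (e := f) (f := e) (Y := W) (w := a₂)
    (by rwa [conjTranspose_conjTranspose]) hf hff he hee
    (by rwa [conjTranspose_conjTranspose]) h₂ h₂'
  rw [conjTranspose_conjTranspose] at e2
  have e3 : ((1 : Matrix (Fin q) (Fin q) ℂ) * diagonal (fun i => (a₂ i : ℂ))).trace.re =
      ∑ i, a₂ i := by
    rw [Matrix.one_mul, trace_diagonal, Complex.re_sum]; simp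
  rw [Complex.sub_re, Complex.add_re, e3]
  linarith

theorem trace_test_of_blockDiag {m n : Type*} [Fintype m] [Fintype n] [DecidableEq m]
    (e : Matrix m m ℂ) (c c' : Matrix m n ℂ) (f : Matrix n n ℂ) (A : Matrix m m ℂ)
    (B : Matrix n n ℂ) :
    (testMat e c f * fromBlocks A 0 0 B).trace = (testMat e c' f * fromBlocks A 0 0 B).trace := by
  simp only [fromBlocks_multiply, trace_blocks, Matrix.mul_zero, add_zero, zero_add]

/-- The matrix of the order reversing permutation. -/
def revMat (p : ℕ) : Matrix (Fin p) (Fin p) ℂ := (1 : Matrix (Fin p) (Fin p) ℂ).submatrix Fin.rev id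

theorem revMat_conjTranspose (p : ℕ) : (revMat p)ᴴ = revMat p := by
  rw [revMat, conjTranspose_submatrix, conjTranspose_one]
  ext i j
  simp only [submatrix_apply, id, Matrix.one_apply]
  exact if_congr ⟨fun h => by rw [h, Fin.rev_rev], fun h => by rw [← h, Fin.rev_rev]⟩ rfl rfl

theorem revMat_mul (p : ℕ) {n : Type*} (M : Matrix (Fin p) n ℂ) :
    revMat p * M = M.submatrix Fin.rev id := by
  ext i j
  simp [revMat, Matrix.mul_apply, Matrix.one_apply]

theorem revMat_conjTranspose_mul (p : ℕ) : (revMat p)ᴴ * revMat p = 1 := by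
  rw [revMat_conjTranspose, revMat_mul, revMat]
  ext i j
  rw [submatrix_apply, submatrix_apply, Fin.rev_rev, id, id]

theorem revMat_mul_diagonal (p : ℕ) (w : Fin p → ℂ) :
    revMat p * diagonal w * (revMat p)ᴴ = diagonal fun i => w i.rev := by
  rw [Matrix.mul_assoc, revMat_mul]
  ext i j
  simp [revMat, Matrix.mul_apply, Matrix.one_apply, diagonal_apply]

theorem exists_proj_of_rank {m : Type*} [Fintype m] [DecidableEq m] (R : Matrix m m ℂ) :
    ∃ e X Y : Matrix m m ℂ, eᴴ = e ∧ e * e = e ∧ R = X * e ∧ e = Y * R ∧ e.trace = R.rank := by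
  obtain ⟨u, hu, S, X, Y, h1, h2, h3⟩ := exists_coordProj_rowEquiv R
  have hu1 := unitary_conjTranspose_mul hu
  have hu' : ∀ M : Matrix m m ℂ, uᴴ * (u * M) = M := fun M => by
    rw [← Matrix.mul_assoc, hu1, Matrix.one_mul]
  have hS : ∀ M : Matrix m m ℂ, coordProj S * (coordProj S * M) = coordProj S * M := fun M => by
    rw [← Matrix.mul_assoc, coordProj_mul_self]
  refine ⟨u * (coordProj S * uᴴ), X * uᴴ, u * Y, ?_, ?_, ?_, ?_, ?_⟩
  · simp only [conjTranspose_mul, conjTranspose_conjTranspose, coordProj_conjTranspose,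
      Matrix.mul_assoc]
  · simp only [Matrix.mul_assoc, hu', hS]
  · rw [h1]; simp only [Matrix.mul_assoc, hu']
  · rw [h2, Matrix.mul_assoc]
  · rw [trace_mul_comm, Matrix.mul_assoc, hu1, Matrix.mul_one, trace_coordProj, h3]

theorem rank_map_star {m n : Type*} [Fintype m] [Fintype n] (M : Matrix m n ℂ) :
    (M.map star).rank = M.rank := by
  have : M.map star = (Mᴴ)ᵀ := by ext; simp
  rw [this, rank_transpose, rank_conjTranspose]

theorem defect_map_star {p : ℕ} {m : Type*} [Fintype m] (M : Matrix m (Fin p) ℂ) (w : Fin p → ℝ) :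
    defect (M.map star) w = defect M w := by
  have : ∀ i, pre (M.map star) i = (pre M i).map star := fun i => rfl
  simp only [defect, this, rank_map_star]

theorem map_star_mul {l m n : Type*} [Fintype m] (M : Matrix l m ℂ) (N : Matrix m n ℂ) :
    (M * N).map star = M.map star * N.map star := by
  ext i j; simp [Matrix.mul_apply]

theorem map_star_map_star {m n : Type*} (M : Matrix m n ℂ) : (M.map star).map star = M := by
  ext i j; simp

/-- The weight attached to the right-hand side of the sum problem. -/
def coweight {p : ℕ} (Γ : ℝ) (x : Fin p → ℝ) : Fin p → ℝ := fun j => Γ - x j.rev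

theorem coweight_antitone {p : ℕ} {Γ : ℝ} {x : Fin p → ℝ} (hx : Antitone x) :
    Antitone (coweight Γ x) := by
  intro i j hij
  have := hx (Fin.rev_le_rev.2 hij)
  simp only [coweight]; linarith

theorem sum_coweight {p : ℕ} (Γ : ℝ) (x : Fin p → ℝ) :
    ∑ i, coweight Γ x i = p * Γ - ∑ i, x i := by
  simp only [coweight, Finset.sum_sub_distrib, Finset.sum_const, Finset.card_univ, Fintype.card_fin,
    nsmul_eq_mul]
  rw [← Equiv.sum_comp Fin.revPerm x]
  rfl

theorem exists_semi_of_sol {p q : ℕ} {a₁ b₁ x₁ : Fin p → ℝ} {a₂ b₂ x₂ : Fin q → ℝ} {Γ : ℝ}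
    (ha₁ : Antitone a₁) (ha₁' : ∀ i, 0 ≤ a₁ i) (ha₂ : Antitone a₂) (ha₂' : ∀ i, 0 ≤ a₂ i)
    (hb₁ : Antitone b₁) (hb₁' : ∀ i, 0 ≤ b₁ i) (hb₂ : Antitone b₂) (hb₂' : ∀ i, 0 ≤ b₂ i)
    (hx₁ : Antitone x₁) (hx₁' : ∀ i, x₁ i ≤ Γ) (hx₂ : Antitone x₂) (hx₂' : ∀ i, x₂ i ≤ Γ)
    (hs : Sol a₁ b₁ x₁ a₂ b₂ x₂) :
    ∃ (ζ : Matrix (Fin p) (Fin q) ℂ) (G : Fin 3 → Matrix (Fin p) (Fin p) ℂ)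
      (F : Fin 3 → Matrix (Fin q) (Fin q) ℂ), (∀ k, (G k).det ≠ 0 ∧ (F k).det ≠ 0) ∧
      Semi ζ G F ![a₁, b₁, coweight Γ x₁] ![a₂, b₂, coweight Γ x₂] Γ
        (∑ i, a₂ i + ∑ i, b₂ i - ∑ i, x₂ i) := by
  obtain ⟨g, h, hg, hh, hgh⟩ := hs
  obtain ⟨zg, Xg, Wg, rfl, hXg, hWg⟩ := exists_graph_form hg
  obtain ⟨zh, Xh, Wh, rfl, hXh, hWh⟩ := exists_graph_form hh
  have hdet : ∀ {m : Type} [Fintype m] [DecidableEq m] {K X : Matrix m m ℂ},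
      Xᴴ * K * X = 1 → (K * X).det ≠ 0 := fun {m} _ _ {K X} h0 => by
    rw [Matrix.mul_assoc] at h0
    exact (isUnit_det_of_left_inverse h0).ne_zero
  have hdets : ∀ {m : Type} [Fintype m] [DecidableEq m] {K : Matrix m m ℂ},
      K.det ≠ 0 → (K.map star).det ≠ 0 := fun {m} _ _ {K} h0 => by
    have : K.map star = (Kᴴ)ᵀ := by ext; simp
    rw [this, det_transpose, det_conjTranspose]
    simpa using h0
  have hrev : ∀ r, (revMat r).det ≠ 0 := fun r =>
    (isUnit_det_of_left_inverse (revMat_conjTranspose_mul r)).ne_zero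
  refine ⟨zg - zh, ![(1 - zg * zgᴴ) * Xg, (1 - zh * zhᴴ) * Xh, revMat p],
    ![((1 - zgᴴ * zg) * Wg).map star, ((1 - zhᴴ * zh) * Wh).map star, (revMat q).map star],
    ?_, ?_⟩
  · intro k
    fin_cases k
    · exact ⟨hdet hXg, hdets (hdet hWg)⟩
    · exact ⟨hdet hXh, hdets (hdet hWh)⟩
    · exact ⟨hrev p, hdets (hrev q)⟩
  intro R₁ R₂ hR
  obtain ⟨e, X₁, Y₁, he, hee, hRe, heR, hetr⟩ := exists_proj_of_rank R₁
  obtain ⟨f, X₂, Y₂, hf, hff, hRf, hfR, hftr⟩ := exists_proj_of_rank (R₂.map star)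
  have hζ : e * (zg - zh) * f = 0 := by
    have h2 : R₂ᵀ * Y₂ᴴ = f := by
      have h3 : (R₂.map star)ᴴ = R₂ᵀ := by ext; simp
      rw [← h3, ← conjTranspose_mul, ← hfR, hf]
    calc e * (zg - zh) * f = Y₁ * (R₁ * (zg - zh) * R₂ᵀ) * Y₂ᴴ := by
          rw [← h2]; conv_lhs => rw [heR]
          simp only [Matrix.mul_assoc]
      _ = 0 := by rw [hR]; simp
  have hc : e * zh * f = e * zg * f := by
    rw [Matrix.mul_sub, Matrix.sub_mul, sub_eq_zero] at hζ
    exact hζ.symm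
  have E1 := defect_le_trace_test hXg hWg he hee hf hff ha₁ ha₁' ha₂ ha₂'
  have E2 := defect_le_trace_test hXh hWh he hee hf hff hb₁ hb₁' hb₂ hb₂'
  have E3 := defect_le_trace_test (z := 0) (X := revMat p) (W := revMat q)
    (by simpa using revMat_conjTranspose_mul p) (by simpa using revMat_conjTranspose_mul q)
    he hee hf hff (coweight_antitone (Γ := Γ) hx₁) (fun i => by simp [coweight, hx₁'])
    (coweight_antitone (Γ := Γ) hx₂) (fun i => by simp [coweight, hx₂'])
  rw [hc] at E2
  have h4 : (fromBlocks (revMat p) (-((0 : Matrix (Fin p) (Fin q) ℂ) * revMat q))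
      (-((0 : Matrix (Fin p) (Fin q) ℂ)ᴴ * revMat p)) (revMat q) *
      dg (coweight Γ x₁) (coweight Γ x₂) *
        (fromBlocks (revMat p) (-((0 : Matrix (Fin p) (Fin q) ℂ) * revMat q))
      (-((0 : Matrix (Fin p) (Fin q) ℂ)ᴴ * revMat p)) (revMat q))ᴴ) =
      fromBlocks (diagonal fun i => ((Γ - x₁ i : ℝ) : ℂ)) 0 0
        (diagonal fun i => ((Γ - x₂ i : ℝ) : ℂ)) := by
    simp only [fromBlocks_conjTranspose, fromBlocks_multiply, Matrix.zero_mul, neg_zero,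
      conjTranspose_zero, Matrix.mul_zero, add_zero, zero_add, revMat_mul_diagonal, coweight,
      Fin.rev_rev]
  rw [h4, trace_test_of_blockDiag e _ (e * zg * f)] at E3
  have hsum : (testMat e (e * zg * f) f * (fromBlocks Xg (-(zg * Wg)) (-(zgᴴ * Xg)) Wg * dg a₁ a₂ *
        (fromBlocks Xg (-(zg * Wg)) (-(zgᴴ * Xg)) Wg)ᴴ)).trace.re +
      (testMat e (e * zg * f) f * (fromBlocks Xh (-(zh * Wh)) (-(zhᴴ * Xh)) Wh * dg b₁ b₂ *
        (fromBlocks Xh (-(zh * Wh)) (-(zhᴴ * Xh)) Wh)ᴴ)).trace.re +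
      (testMat e (e * zg * f) f * fromBlocks (diagonal fun i => ((Γ - x₁ i : ℝ) : ℂ)) 0 0
        (diagonal fun i => ((Γ - x₂ i : ℝ) : ℂ))).trace.re =
      Γ * (p - R₁.rank) - Γ * R₂.rank := by
    rw [← Complex.add_re, ← Complex.add_re, ← trace_add, ← trace_add, ← Matrix.mul_add,
      ← Matrix.mul_add, hgh, dg, fromBlocks_add, diagonal_add, diagonal_add, fromBlocks_multiply,
      trace_blocks]
    have d1 : (diagonal fun i => ((x₁ i : ℝ) : ℂ) + ((Γ - x₁ i : ℝ) : ℂ)) =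
        (Γ : ℂ) • (1 : Matrix (Fin p) (Fin p) ℂ) := by
      ext i j; by_cases hij : i = j <;> simp [hij]
    have d2 : (diagonal fun i => ((x₂ i : ℝ) : ℂ) + ((Γ - x₂ i : ℝ) : ℂ)) =
        (Γ : ℂ) • (1 : Matrix (Fin q) (Fin q) ℂ) := by
      ext i j; by_cases hij : i = j <;> simp [hij]
    rw [d1, d2]
    simp only [add_zero, Matrix.mul_zero, zero_add, Matrix.mul_smul, Matrix.mul_one, trace_smul,
      trace_sub, trace_one, trace_neg, hetr, hftr, rank_map_star, smul_eq_mul, Complex.add_re,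
      Complex.re_ofReal_mul, Complex.sub_re, Complex.neg_re, Complex.natCast_re, Fintype.card_fin]
    ring
  have hw2 := sum_coweight Γ x₂
  have hd2 : ∀ (M : Matrix (Fin q) (Fin q) ℂ) (w : Fin q → ℝ),
      defect (R₂ * M.map star) w = defect (f * M) w := fun M w => by
    rw [← defect_congr hRf hfR, ← defect_map_star, map_star_mul, map_star_map_star]
  have hd1 : ∀ (M : Matrix (Fin p) (Fin p) ℂ) (w : Fin p → ℝ),
      defect (R₁ * M) w = defect (e * M) w := fun M w => defect_congr hRe heR M w
  have hz1 : (1 - (0 : Matrix (Fin p) (Fin q) ℂ) * (0 : Matrix (Fin p) (Fin q) ℂ)ᴴ) * revMat p =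
    revMat p := by simp
  have hz2 : (1 - (0 : Matrix (Fin p) (Fin q) ℂ)ᴴ * (0 : Matrix (Fin p) (Fin q) ℂ)) * revMat q =
    revMat q := by simp
  rw [hz1, hz2] at E3
  simp only [Fin.sum_univ_three, hd1, cons_val, hd2]
  linarith

/-! ### Conjugation by field automorphisms and common generic points -/

theorem exists_ringEquiv_of_transcendenceBasis {K ι κ : Type*} [Field K] [Algebra K ℂ]
    {v : ι → ℂ} {w : κ → ℂ} (e : ι ≃ κ) (hv : IsTranscendenceBasis K v)
    (hw : IsTranscendenceBasis K w) :
    ∃ σ : ℂ ≃+* ℂ, (∀ a : K, σ (algebraMap K ℂ a) = algebraMap K ℂ a) ∧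
      ∀ i, σ (v i) = w (e i) := by
  let := IsAlgClosed.isAlgClosure_of_transcendence_basis v hv
  let := IsAlgClosed.isAlgClosure_of_transcendence_basis w hw
  let f : Algebra.adjoin K (Set.range v) ≃ₐ[K] Algebra.adjoin K (Set.range w) :=
    (hv.1.aevalEquiv.symm.trans (MvPolynomial.renameEquiv K e)).trans hw.1.aevalEquiv
  have key := IsAlgClosure.equivOfEquiv_algebraMap ℂ ℂ f.toRingEquiv
  refine ⟨IsAlgClosure.equivOfEquiv ℂ ℂ f.toRingEquiv, fun a => ?_, fun i => ?_⟩
  · have h := key (algebraMap K _ a)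
    have h2 : f.toRingEquiv (algebraMap K _ a) = algebraMap K _ a := f.commutes a
    rw [h2] at h
    exact h
  · have h := key (hv.1.aevalEquiv (MvPolynomial.X i))
    have h2 : f.toRingEquiv (hv.1.aevalEquiv (MvPolynomial.X i)) =
        hw.1.aevalEquiv (MvPolynomial.X (e i)) := by
      change hw.1.aevalEquiv (MvPolynomial.renameEquiv K e
        (hv.1.aevalEquiv.symm (hv.1.aevalEquiv (MvPolynomial.X i)))) = _
      rw [AlgEquiv.symm_apply_apply, MvPolynomial.renameEquiv_apply, MvPolynomial.rename_X]
    rw [h2, AlgebraicIndependent.algebraMap_aevalEquiv,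
      AlgebraicIndependent.algebraMap_aevalEquiv, MvPolynomial.aeval_X, MvPolynomial.aeval_X] at h
    exact h

theorem exists_ringEquiv_of_transcendental (K : Subfield ℂ) [Countable K] {s t : ℂ}
    (hs : Transcendental K s) (ht : Transcendental K t) :
    ∃ σ : ℂ ≃+* ℂ, (∀ a ∈ K, σ a = a) ∧ σ s = t := by
  have hb : ∀ r : ℂ, Transcendental K r → ∃ B : Set ℂ, r ∈ B ∧
      IsTranscendenceBasis K ((↑) : B → ℂ) := by
    intro r hr
    have h1 : AlgebraicIndepOn K id ({r} : Set ℂ) :=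
      (algebraicIndependent_unique_type_iff (R := K)
        (x := fun i : ({r} : Set ℂ) => id (i : ℂ))).2 hr
    obtain ⟨B, hB, hB'⟩ := exists_isTranscendenceBasis_superset h1
    exact ⟨B, hB rfl, hB'⟩
  obtain ⟨B, hsB, hB⟩ := hb s hs
  obtain ⟨B', htB', hB'⟩ := hb t ht
  have hK : Cardinal.mk K ≤ Cardinal.aleph0 := Cardinal.mk_le_aleph0
  have hC : Cardinal.aleph0 < Cardinal.mk ℂ := by
    rw [Cardinal.mk_complex]; exact Cardinal.aleph0_lt_continuum
  have hcard : Cardinal.mk B = Cardinal.mk B' := by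
    rw [← IsAlgClosed.cardinal_eq_cardinal_transcendence_basis_of_aleph0_lt' _ hB hK hC,
      ← IsAlgClosed.cardinal_eq_cardinal_transcendence_basis_of_aleph0_lt' _ hB' hK hC]
  obtain ⟨e⟩ := Cardinal.eq.1 hcard
  classical
  obtain ⟨σ, h1, h2⟩ := exists_ringEquiv_of_transcendenceBasis
    (e.trans (Equiv.swap (e ⟨s, hsB⟩) ⟨t, htB'⟩)) hB hB'
  refine ⟨σ, fun a ha => h1 ⟨a, ha⟩, ?_⟩
  have := h2 ⟨s, hsB⟩
  simpa using this

theorem exists_transcendental_of_eventually (K : Subfield ℂ) [Countable K] {p : ℂ → Prop} {a : ℂ}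
    (h : ∀ᶠ s in nhds a, p s) : ∃ s, Transcendental K s ∧ p s := by
  have hc : Set.Countable {x : ℂ | IsAlgebraic K x} := Algebraic.countable K ℂ
  have hd : Dense {x : ℂ | IsAlgebraic K x}ᶜ := hc.dense_compl ℂ
  obtain ⟨s, hs, hs'⟩ := hd.exists_mem_open (isOpen_interior (s := {s | p s}))
    ⟨a, mem_interior_iff_mem_nhds.2 h⟩
  exact ⟨s, hs, interior_subset hs'⟩

/-- Two open conditions that are invariant under field automorphisms and are both satisfiable can
be satisfied simultaneously. -/
theorem exists_common_of_invariant {Ω : Type} [Finite Ω] {P Q : (Ω → ℂ) → Prop}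
    (hP : ∀ x, P x → ∀ᶠ y in nhds x, P y) (hQ : ∀ x, Q x → ∀ᶠ y in nhds x, Q y)
    (hσ : ∀ (σ : ℂ ≃+* ℂ) x, Q (σ ∘ x) → Q x) {x₀ x₁ : Ω → ℂ} (h₀ : P x₀) (h₁ : Q x₁) :
    ∃ x, P x ∧ Q x := by
  set K : Subfield ℂ := Subfield.closure (Set.range x₀ ∪ Set.range x₁) with hK
  have hcount : Countable K := by
    rw [← Cardinal.mk_le_aleph0_iff]
    refine (Subfield.cardinalMk_closure_le_max _).trans (max_le ?_ le_rfl)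
    rw [Cardinal.mk_le_aleph0_iff]
    exact ((Set.finite_range x₀).union (Set.finite_range x₁)).countable
  have hx₀ : ∀ i, x₀ i ∈ K := fun i => Subfield.subset_closure (Or.inl ⟨i, rfl⟩)
  have hx₁ : ∀ i, x₁ i ∈ K := fun i => Subfield.subset_closure (Or.inr ⟨i, rfl⟩)
  set l : ℂ → Ω → ℂ := fun s i => x₀ i + s * (x₁ i - x₀ i) with hl
  have hlc : Continuous l := by
    refine continuous_pi fun i => ?_
    fun_prop
  have hl0 : l 0 = x₀ := by ext i; simp [hl]
  have hl1 : l 1 = x₁ := by ext i; simp [hl]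
  obtain ⟨s, hs, hPs⟩ := exists_transcendental_of_eventually K
    (hlc.continuousAt.eventually (hP (l 0) (by rwa [hl0])))
  obtain ⟨t, ht, hQt⟩ := exists_transcendental_of_eventually K
    (hlc.continuousAt.eventually (hQ (l 1) (by rwa [hl1])))
  obtain ⟨σ, h1, h2⟩ := exists_ringEquiv_of_transcendental K hs ht
  refine ⟨l s, hPs, hσ σ _ ?_⟩
  have : σ ∘ l s = l t := by
    ext i
    simp [hl, h1 _ (hx₀ i), h1 _ (hx₁ i), h2]
  rwa [this]

/-! ### Semicontinuity and invariance of the rank -/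

theorem exists_mul_mul_eq_one {m n : Type*} [Fintype m] [Fintype n] [DecidableEq n]
    (M : Matrix m n ℂ) :
    ∃ (S : Finset n) (L : Matrix S m ℂ) (N : Matrix n S ℂ), L * M * N = 1 ∧ S.card = M.rank := by
  obtain ⟨u, l, hu, hs, hr, -⟩ := exists_spectral (isHermitian_conjTranspose_mul_self M)
  have hu1 := unitary_conjTranspose_mul hu
  rw [rank_conjTranspose_mul_self] at hr
  have hd : uᴴ * Mᴴ * M * u = diagonal fun i => (l i : ℂ) := by
    rw [Matrix.mul_assoc uᴴ, hs]
    calc _ = (uᴴ * u) * diagonal (fun i => (l i : ℂ)) * (uᴴ * u) := by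
          simp only [Matrix.mul_assoc]
      _ = _ := by rw [hu1]; simp
  refine ⟨Finset.univ.filter fun i => l i ≠ 0,
    (diagonal (fun i => (l i : ℂ)⁻¹) * uᴴ * Mᴴ).submatrix Subtype.val id,
    u.submatrix id Subtype.val, ?_, ?_⟩
  · have : (diagonal (fun i => (l i : ℂ)⁻¹) * uᴴ * Mᴴ) * M * u =
        diagonal (fun i => (l i : ℂ)⁻¹) * (uᴴ * Mᴴ * M * u) := by
      simp only [Matrix.mul_assoc]
    rw [hd, diagonal_mul_diagonal] at this
    ext a b
    have h2 := congrFun (congrFun this a) b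
    have h3 : l a ≠ 0 := (Finset.mem_filter.1 a.2).2
    rw [Matrix.mul_apply] at h2 ⊢
    simp only [Matrix.mul_apply, submatrix_apply, id] at h2 ⊢
    rw [h2, diagonal_apply, Matrix.one_apply]
    by_cases hab : a = b
    · subst hab; simp [h3]
    · have : (a : n) ≠ b := fun h => hab (Subtype.ext h)
      simp [hab, this]
  · rw [hr, Fintype.card_subtype]

theorem card_le_rank_of_det_ne_zero {k m n : Type*} [Fintype k] [DecidableEq k] [Fintype m]
    [Fintype n] {L : Matrix k m ℂ} {M : Matrix m n ℂ} {N : Matrix n k ℂ}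
    (h : (L * M * N).det ≠ 0) : Fintype.card k ≤ M.rank := by
  have h1 : (L * M * N).rank = Fintype.card k :=
    rank_of_isUnit _ ((isUnit_iff_isUnit_det _).2 (isUnit_iff_ne_zero.2 h))
  rw [← h1]
  exact (rank_mul_le_left _ _).trans (rank_mul_le_right _ _)

theorem rank_map_ringEquiv {m n : Type*} [Fintype m] [Fintype n] (σ : ℂ ≃+* ℂ)
    (M : Matrix m n ℂ) : (M.map σ).rank = M.rank := by
  classical
  have hle : ∀ (σ : ℂ ≃+* ℂ) (M : Matrix m n ℂ), M.rank ≤ (M.map σ).rank := by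
    intro σ M
    obtain ⟨S, L, N, h, hS⟩ := exists_mul_mul_eq_one M
    rw [← hS, ← Fintype.card_coe]
    apply card_le_rank_of_det_ne_zero (L := L.map σ) (N := N.map σ)
    have : L.map σ * M.map σ * N.map σ = 1 := by
      rw [← Matrix.map_mul, ← Matrix.map_mul, h]
      exact Matrix.map_one _ (map_zero σ) (map_one σ)
    rw [this, det_one]
    exact one_ne_zero
  refine le_antisymm ?_ (hle σ M)
  refine (hle σ.symm (M.map σ)).trans_eq ?_
  congr 1
  ext i j; simp

theorem eventually_rank_le {m n : Type*} [Fintype m] [Fintype n] (M : Matrix m n ℂ) :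
    ∀ᶠ M' in nhds M, M.rank ≤ M'.rank := by
  classical
  obtain ⟨S, L, N, h, hS⟩ := exists_mul_mul_eq_one M
  have hc : Continuous fun M' : Matrix m n ℂ => (L * M' * N).det := by fun_prop
  have h1 : (L * M * N).det ≠ 0 := by rw [h, det_one]; exact one_ne_zero
  filter_upwards [hc.continuousAt.eventually_ne h1] with M' hM'
  rw [← hS, ← Fintype.card_coe]
  exact card_le_rank_of_det_ne_zero hM'

theorem defect_map_ringEquiv {p : ℕ} {m : Type*} [Fintype m] (σ : ℂ ≃+* ℂ)
    (M : Matrix m (Fin p) ℂ) (w : Fin p → ℝ) : defect (M.map σ) w = defect M w := by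
  have : ∀ i, pre (M.map σ) i = (pre M i).map σ := fun i => rfl
  simp only [defect, this, rank_map_ringEquiv]

theorem eventually_defect_le {p : ℕ} {m : Type*} [Fintype m] (M : Matrix m (Fin p) ℂ)
    {w : Fin p → ℝ} (hw : ∀ i, 0 ≤ drop w i) : ∀ᶠ M' in nhds M, defect M' w ≤ defect M w := by
  have h : ∀ i, ∀ᶠ M' in nhds M, (pre M i).rank ≤ (pre M' i).rank := fun i => by
    have hc : Continuous fun M' : Matrix m (Fin p) ℂ => pre M' i := by
      unfold pre; fun_prop
    exact hc.continuousAt.eventually (eventually_rank_le (pre M i))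
  filter_upwards [Filter.eventually_all.2 h] with M' hM'
  refine Finset.sum_le_sum fun i _ => mul_le_mul_of_nonneg_left ?_ (hw i)
  have : ((pre M i).rank : ℝ) ≤ (pre M' i).rank := by exact_mod_cast hM' i
  linarith

theorem isCompact_of_entry_bound {m n : Type*} [Finite m] [Finite n] {s : Set (Matrix m n ℂ)}
    (hs : IsClosed s) {C : ℝ} (h : ∀ M ∈ s, ∀ i j, ‖M i j‖ ≤ C) : IsCompact s := by
  have hK : IsCompact (Set.univ.pi fun _ : m => Set.univ.pi fun _ : n =>
      Metric.closedBall (0 : ℂ) C) :=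
    isCompact_univ_pi fun _ => isCompact_univ_pi fun _ => isCompact_closedBall _ _
  refine hK.of_isClosed_subset hs fun M hM => ?_
  intro i _ j _
  simpa using h M hM i j

theorem isCompact_unitary {m : Type*} [Fintype m] [DecidableEq m] :
    IsCompact (unitaryGroup m ℂ : Set (Matrix m m ℂ)) :=
  isCompact_of_entry_bound (C := 1) isClosed_unitary
    fun _ hU i j => entry_norm_bound_of_unitary hU i j

/-! ### Openness and invariance of semistability -/

theorem semi_iff_coordProj {p q : ℕ} {ζ : Matrix (Fin p) (Fin q) ℂ}
    {G : Fin 3 → Matrix (Fin p) (Fin p) ℂ} {F : Fin 3 → Matrix (Fin q) (Fin q) ℂ}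
    {w₁ : Fin 3 → Fin p → ℝ} {w₂ : Fin 3 → Fin q → ℝ} {Γ κ : ℝ} :
    Semi ζ G F w₁ w₂ Γ κ ↔ ∀ (S : Finset (Fin p)) (T : Finset (Fin q)),
      ∀ u ∈ (unitaryGroup (Fin p) ℂ : Set (Matrix (Fin p) (Fin p) ℂ)) ×ˢ
        (unitaryGroup (Fin q) ℂ : Set (Matrix (Fin q) (Fin q) ℂ)),
      (coordProj S * u.1ᴴ) * ζ * (coordProj T * u.2ᴴ)ᵀ = 0 →
      ∑ k, defect ((coordProj S * u.1ᴴ) * G k) (w₁ k) +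
        ∑ k, defect ((coordProj T * u.2ᴴ) * F k) (w₂ k)
        - Γ * ((p : ℝ) - S.card) - Γ * ((q : ℝ) - T.card) ≤ κ := by
  have hrank : ∀ {r : ℕ} (u : Matrix (Fin r) (Fin r) ℂ) (hu : u ∈ unitaryGroup (Fin r) ℂ)
      (S : Finset (Fin r)), (coordProj S * uᴴ).rank = S.card := by
    intro r u hu S
    have h := rank_mul_eq_left_of_isUnit_det uᴴ (coordProj S)
      (isUnit_det_of_left_inverse (unitary_mul_conjTranspose hu))
    rw [h, rank_coordProj]
  constructor
  · intro h S T u hu h0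
    have := h _ _ h0
    rwa [hrank _ hu.1, hrank _ hu.2] at this
  · intro h R₁ R₂ h0
    obtain ⟨u, hu, S, X, Y, h1, h2, h3⟩ := exists_coordProj_rowEquiv R₁
    obtain ⟨v, hv, T, X', Y', h1', h2', h3'⟩ := exists_coordProj_rowEquiv R₂
    have h4 : (coordProj S * uᴴ) * ζ * (coordProj T * vᴴ)ᵀ = 0 := by
      calc _ = Y * (R₁ * ζ * R₂ᵀ) * Y'ᵀ := by
            rw [h2, h2', transpose_mul]; simp only [Matrix.mul_assoc]
        _ = 0 := by rw [h0]; simp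
    have := h S T (u, v) ⟨hu, hv⟩ h4
    simpa only [h3, h3', defect_congr h1 h2, defect_congr h1' h2'] using this

theorem Semi.of_map {p q : ℕ} {ζ : Matrix (Fin p) (Fin q) ℂ}
    {G : Fin 3 → Matrix (Fin p) (Fin p) ℂ} {F : Fin 3 → Matrix (Fin q) (Fin q) ℂ}
    {w₁ : Fin 3 → Fin p → ℝ} {w₂ : Fin 3 → Fin q → ℝ} {Γ κ : ℝ} (σ : ℂ ≃+* ℂ)
    (h : Semi (ζ.map σ) (fun k => (G k).map σ) (fun k => (F k).map σ) w₁ w₂ Γ κ) :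
    Semi ζ G F w₁ w₂ Γ κ := by
  intro R₁ R₂ h0
  have := h (R₁.map σ) (R₂.map σ) (by
    rw [← Matrix.map_mul, ← transpose_map, ← Matrix.map_mul, h0]
    ext; simp)
  simpa only [← Matrix.map_mul, defect_map_ringEquiv, rank_map_ringEquiv] using this

theorem Semi.eventually {p q : ℕ} {X : Type*} [TopologicalSpace X]
    {ζ : X → Matrix (Fin p) (Fin q) ℂ}
    {G : X → Fin 3 → Matrix (Fin p) (Fin p) ℂ} {F : X → Fin 3 → Matrix (Fin q) (Fin q) ℂ}
    (hζ : Continuous ζ) (hG : Continuous G) (hF : Continuous F)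
    {w₁ : Fin 3 → Fin p → ℝ} {w₂ : Fin 3 → Fin q → ℝ} {Γ κ : ℝ}
    (hw₁ : ∀ k i, 0 ≤ drop (w₁ k) i) (hw₂ : ∀ k i, 0 ≤ drop (w₂ k) i) {x : X}
    (h : Semi (ζ x) (G x) (F x) w₁ w₂ Γ κ) :
    ∀ᶠ y in nhds x, Semi (ζ y) (G y) (F y) w₁ w₂ Γ κ := by
  simp only [semi_iff_coordProj] at h ⊢
  refine Filter.eventually_all.2 fun S => Filter.eventually_all.2 fun T => ?_
  refine (isCompact_unitary.prod isCompact_unitary).eventually_forall_of_forall_eventually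
    fun u hu => ?_
  by_cases h0 : (coordProj S * u.1ᴴ) * ζ x * (coordProj T * u.2ᴴ)ᵀ = 0
  · have hc₁ : ∀ k, Continuous fun z : X × (Matrix (Fin p) (Fin p) ℂ × Matrix (Fin q) (Fin q) ℂ) =>
        (coordProj S * z.2.1ᴴ) * G z.1 k := fun k => by fun_prop
    have hc₂ : ∀ k, Continuous fun z : X × (Matrix (Fin p) (Fin p) ℂ × Matrix (Fin q) (Fin q) ℂ) =>
        (coordProj T * z.2.2ᴴ) * F z.1 k := fun k => by fun_prop
    have e₁ : ∀ k, ∀ᶠ z in nhds (x, u), defect ((coordProj S * z.2.1ᴴ) * G z.1 k) (w₁ k) ≤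
        defect ((coordProj S * u.1ᴴ) * G x k) (w₁ k) := fun k =>
      ((hc₁ k).tendsto (x, u)).eventually (eventually_defect_le _ (hw₁ k))
    have e₂ : ∀ k, ∀ᶠ z in nhds (x, u), defect ((coordProj T * z.2.2ᴴ) * F z.1 k) (w₂ k) ≤
        defect ((coordProj T * u.2ᴴ) * F x k) (w₂ k) := fun k =>
      ((hc₂ k).tendsto (x, u)).eventually (eventually_defect_le _ (hw₂ k))
    filter_upwards [Filter.eventually_all.2 e₁, Filter.eventually_all.2 e₂] with z hz₁ hz₂ _
    have := h S T u hu h0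
    have s₁ := Finset.sum_le_sum fun k (_ : k ∈ Finset.univ) => hz₁ k
    have s₂ := Finset.sum_le_sum fun k (_ : k ∈ Finset.univ) => hz₂ k
    linarith
  · have hc : Continuous fun z : X × (Matrix (Fin p) (Fin p) ℂ × Matrix (Fin q) (Fin q) ℂ) =>
        (coordProj S * z.2.1ᴴ) * ζ z.1 * (coordProj T * z.2.2ᴴ)ᵀ := by fun_prop
    have := (hc.continuousAt (x := (x, u))).eventually_ne h0
    filter_upwards [this] with z hz hz0
    exact absurd hz0 hz

/-- Two semistable configurations can be replaced by a common one. -/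
theorem exists_common_semi {p q : ℕ} {w₁ w₁' : Fin 3 → Fin p → ℝ} {w₂ w₂' : Fin 3 → Fin q → ℝ}
    {Γ κ κ' : ℝ} (hw₁ : ∀ k i, 0 ≤ drop (w₁ k) i) (hw₂ : ∀ k i, 0 ≤ drop (w₂ k) i)
    (hw₁' : ∀ k i, 0 ≤ drop (w₁' k) i) (hw₂' : ∀ k i, 0 ≤ drop (w₂' k) i)
    (h : ∃ (ζ : Matrix (Fin p) (Fin q) ℂ) (G : Fin 3 → Matrix (Fin p) (Fin p) ℂ)
      (F : Fin 3 → Matrix (Fin q) (Fin q) ℂ), (∀ k, (G k).det ≠ 0 ∧ (F k).det ≠ 0) ∧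
      Semi ζ G F w₁ w₂ Γ κ)
    (h' : ∃ (ζ : Matrix (Fin p) (Fin q) ℂ) (G : Fin 3 → Matrix (Fin p) (Fin p) ℂ)
      (F : Fin 3 → Matrix (Fin q) (Fin q) ℂ), (∀ k, (G k).det ≠ 0 ∧ (F k).det ≠ 0) ∧
      Semi ζ G F w₁' w₂' Γ κ') :
    ∃ (ζ : Matrix (Fin p) (Fin q) ℂ) (G : Fin 3 → Matrix (Fin p) (Fin p) ℂ)
      (F : Fin 3 → Matrix (Fin q) (Fin q) ℂ), (∀ k, (G k).det ≠ 0 ∧ (F k).det ≠ 0) ∧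
      Semi ζ G F w₁ w₂ Γ κ ∧ Semi ζ G F w₁' w₂' Γ κ' := by
  let Ω := (Fin p × Fin q) ⊕ (Fin 3 × Fin p × Fin p) ⊕ (Fin 3 × Fin q × Fin q)
  let ζ : (Ω → ℂ) → Matrix (Fin p) (Fin q) ℂ := fun x => of fun i j => x (Sum.inl (i, j))
  let G : (Ω → ℂ) → Fin 3 → Matrix (Fin p) (Fin p) ℂ :=
    fun x k => of fun i j => x (Sum.inr (Sum.inl (k, i, j)))
  let F : (Ω → ℂ) → Fin 3 → Matrix (Fin q) (Fin q) ℂ :=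
    fun x k => of fun i j => x (Sum.inr (Sum.inr (k, i, j)))
  have hζ : Continuous ζ :=
    continuous_matrix fun i j => continuous_apply _
  have hG : Continuous G :=
    continuous_pi fun k => continuous_matrix fun i j => continuous_apply _
  have hF : Continuous F :=
    continuous_pi fun k => continuous_matrix fun i j => continuous_apply _
  have hopen : ∀ {w₁ : Fin 3 → Fin p → ℝ} {w₂ : Fin 3 → Fin q → ℝ} {κ : ℝ},
      (∀ k i, 0 ≤ drop (w₁ k) i) → (∀ k i, 0 ≤ drop (w₂ k) i) → ∀ x,
      ((∀ k, (G x k).det ≠ 0 ∧ (F x k).det ≠ 0) ∧ Semi (ζ x) (G x) (F x) w₁ w₂ Γ κ) →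
      ∀ᶠ y in nhds x, ((∀ k, (G y k).det ≠ 0 ∧ (F y k).det ≠ 0) ∧
        Semi (ζ y) (G y) (F y) w₁ w₂ Γ κ) := by
    intro w₁ w₂ κ hw₁ hw₂ x hx
    refine Filter.Eventually.and (Filter.eventually_all.2 fun k => ?_)
      (hx.2.eventually hζ hG hF hw₁ hw₂)
    have c1 : Continuous fun y => (G y k).det := by fun_prop
    have c2 : Continuous fun y => (F y k).det := by fun_prop
    exact (c1.continuousAt.eventually_ne (hx.1 k).1).and
      (c2.continuousAt.eventually_ne (hx.1 k).2)
  have hinv : ∀ {w₁ : Fin 3 → Fin p → ℝ} {w₂ : Fin 3 → Fin q → ℝ} {κ : ℝ} (σ : ℂ ≃+* ℂ) x,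
      ((∀ k, (G (σ ∘ x) k).det ≠ 0 ∧ (F (σ ∘ x) k).det ≠ 0) ∧
        Semi (ζ (σ ∘ x)) (G (σ ∘ x)) (F (σ ∘ x)) w₁ w₂ Γ κ) →
      ((∀ k, (G x k).det ≠ 0 ∧ (F x k).det ≠ 0) ∧ Semi (ζ x) (G x) (F x) w₁ w₂ Γ κ) := by
    intro w₁ w₂ κ σ x hx
    have hdet : ∀ {r : ℕ} (M : Matrix (Fin r) (Fin r) ℂ), (M.map σ).det = σ M.det := fun M => by
      have := (RingHom.map_det (σ : ℂ →+* ℂ) M).symm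
      simpa using this
    refine ⟨fun k => ⟨fun h0 => (hx.1 k).1 ?_, fun h0 => (hx.1 k).2 ?_⟩, Semi.of_map σ hx.2⟩
    · have := hdet (G x k)
      rw [h0, map_zero] at this
      exact this
    · have := hdet (F x k)
      rw [h0, map_zero] at this
      exact this
  have henc : ∀ (ζ₀ : Matrix (Fin p) (Fin q) ℂ) (G₀ : Fin 3 → Matrix (Fin p) (Fin p) ℂ)
      (F₀ : Fin 3 → Matrix (Fin q) (Fin q) ℂ), ∃ x, ζ x = ζ₀ ∧ G x = G₀ ∧ F x = F₀ :=
    fun ζ₀ G₀ F₀ => ⟨Sum.elim (fun t => ζ₀ t.1 t.2)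
      (Sum.elim (fun t => G₀ t.1 t.2.1 t.2.2) fun t => F₀ t.1 t.2.1 t.2.2), rfl, rfl, rfl⟩
  obtain ⟨ζ₀, G₀, F₀, hd, hs⟩ := h
  obtain ⟨x₀, rfl, rfl, rfl⟩ := henc ζ₀ G₀ F₀
  obtain ⟨ζ₁, G₁, F₁, hd', hs'⟩ := h'
  obtain ⟨x₁, rfl, rfl, rfl⟩ := henc ζ₁ G₁ F₁
  obtain ⟨x, h1, h2⟩ := exists_common_of_invariant (hopen hw₁ hw₂) (hopen hw₁' hw₂')
    (fun σ x => hinv σ x) ⟨hd, hs⟩ ⟨hd', hs'⟩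
  exact ⟨ζ x, G x, F x, h1.1, h1.2, h2.2⟩

/-! ### Monotonicity of the determinant -/

theorem one_le_det_one_add {m : Type*} [Fintype m] [DecidableEq m] {N : Matrix m m ℂ}
    (hN : N.PosSemidef) : 1 ≤ (1 + N).det.re := by
  obtain ⟨u, l, hu, hNu, -, -⟩ := exists_spectral hN.1
  have hu1 := unitary_mul_conjTranspose hu
  have hu2 := unitary_conjTranspose_mul hu
  have hl : ∀ i, 0 ≤ l i := by
    intro i
    have h1 : uᴴ * N * u = diagonal (fun i => (l i : ℂ)) := by
      rw [hNu]
      calc _ = (uᴴ * u) * diagonal (fun i => (l i : ℂ)) * (uᴴ * u) := by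
            simp only [Matrix.mul_assoc]
        _ = _ := by rw [hu2]; simp
    have h2 := (hN.conjTranspose_mul_mul_same u).diag_nonneg (i := i)
    rw [h1] at h2
    simpa using h2
  have h3 : 1 + N = u * diagonal (fun i => ((1 + l i : ℝ) : ℂ)) * uᴴ := by
    have : diagonal (fun i => ((1 + l i : ℝ) : ℂ)) = 1 + diagonal (fun i => (l i : ℂ)) := by
      ext i j
      by_cases h : i = j
      · subst h; simp
      · simp [h]
    rw [this, Matrix.mul_add, Matrix.add_mul, Matrix.mul_one, hu1, ← hNu]
  have h4 : (1 + N).det = ((∏ i, (1 + l i) : ℝ) : ℂ) := by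
    rw [h3, det_mul, mul_comm, ← det_mul, ← Matrix.mul_assoc, hu2, Matrix.one_mul, det_diagonal]
    push_cast; rfl
  rw [h4, Complex.ofReal_re]
  calc (1 : ℝ) = ∏ i : m, (1 : ℝ) := by simp
    _ ≤ ∏ i, (1 + l i) := Finset.prod_le_prod (fun _ _ => zero_le_one) fun i _ => by linarith [hl i]

theorem posDef_det_re_pos {m : Type*} [Fintype m] [DecidableEq m] {S : Matrix m m ℂ}
    (hS : S.PosDef) : 0 < S.det.re := (Complex.pos_iff.1 hS.det_pos).1

theorem posDef_det_eq {m : Type*} [Fintype m] [DecidableEq m] {S : Matrix m m ℂ}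
    (hS : S.PosDef) : S.det = (S.det.re : ℂ) :=
  Complex.ext rfl (by simpa using (Complex.pos_iff.1 hS.det_pos).2.symm)

theorem exists_conjTranspose_mul_self {m : Type*} [Fintype m] [DecidableEq m] {S : Matrix m m ℂ}
    (hS : S.PosDef) : ∃ L : Matrix m m ℂ, IsUnit L.det ∧ S = Lᴴ * L := by
  obtain ⟨u, l, hu, hSu, -, hl⟩ := exists_spectral hS.1
  have hl := hl hS
  have h : S = (diagonal (fun i => (Real.sqrt (l i) : ℂ)) * uᴴ)ᴴ *
      (diagonal (fun i => (Real.sqrt (l i) : ℂ)) * uᴴ) := by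
    rw [conjTranspose_mul, conjTranspose_conjTranspose, diagonal_conjTranspose]
    calc S = u * diagonal (fun i => (l i : ℂ)) * uᴴ := hSu
      _ = u * (diagonal (star fun i => (Real.sqrt (l i) : ℂ)) *
          diagonal (fun i => (Real.sqrt (l i) : ℂ))) * uᴴ := by
          rw [diagonal_mul_diagonal]
          congr 3
          ext i
          simp only [Pi.star_apply, RCLike.star_def, Complex.conj_ofReal]
          rw [← Complex.ofReal_mul, Real.mul_self_sqrt (hl i).le]
      _ = _ := by simp only [Matrix.mul_assoc]
  refine ⟨_, ?_, h⟩
  have h2 := hS.det_pos.ne'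
  rw [h, det_mul] at h2
  exact isUnit_iff_ne_zero.2 (right_ne_zero_of_mul h2)

theorem det_re_le_of_sub_posSemidef {m : Type*} [Fintype m] [DecidableEq m] {S T : Matrix m m ℂ}
    (hS : S.PosDef) (hT : (T - S).PosSemidef) : S.det.re ≤ T.det.re := by
  obtain ⟨L, hL, hSL⟩ := exists_conjTranspose_mul_self hS
  have h1 : L⁻¹ * L = 1 := nonsing_inv_mul _ hL
  have h1' : Lᴴ * (L⁻¹)ᴴ = 1 := by rw [← conjTranspose_mul, h1, conjTranspose_one]
  have hN : ((L⁻¹)ᴴ * (T - S) * L⁻¹).PosSemidef := hT.conjTranspose_mul_mul_same _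
  have h2 : T = Lᴴ * (1 + (L⁻¹)ᴴ * (T - S) * L⁻¹) * L := by
    have : Lᴴ * ((L⁻¹)ᴴ * (T - S) * L⁻¹) * L = T - S := by
      calc _ = (Lᴴ * (L⁻¹)ᴴ) * (T - S) * (L⁻¹ * L) := by simp only [Matrix.mul_assoc]
        _ = _ := by rw [h1, h1']; simp
    rw [Matrix.mul_add, Matrix.add_mul, Matrix.mul_one, this, ← hSL]; abel
  have h3 : T.det = S.det * (1 + (L⁻¹)ᴴ * (T - S) * L⁻¹).det := by
    conv_lhs => rw [h2, det_mul, det_mul]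
    rw [hSL, det_mul]; ring
  rw [h3, posDef_det_eq hS, Complex.re_ofReal_mul, Complex.ofReal_re]
  exact le_mul_of_one_le_right (posDef_det_re_pos hS).le (one_le_det_one_add hN)

/-! ### Asymptotics of determinants in diagonal directions -/

theorem le_det_conj_diagonal {m k : Type*} [Fintype m] [DecidableEq m] [Fintype k] [DecidableEq k]
    (C : Matrix m k ℂ) (l : m → ℝ) (hl : ∀ t, 0 < l t) (f : k → m)
    (hf : (C.submatrix f id).det ≠ 0) :
    (∏ j, l (f j)) * ‖(C.submatrix f id).det‖ ^ 2 ≤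
      (Cᴴ * diagonal (fun t => (l t : ℂ)) * C).det.re := by
  have hinj : Function.Injective f := by
    intro a b hab
    by_contra hne
    exact hf (det_zero_of_row_eq hne (by ext; simp [hab]))
  set D := C.submatrix f id with hD
  have hDu : IsUnit D := (isUnit_iff_isUnit_det _).2 (isUnit_iff_ne_zero.2 hf)
  have h1 : (Dᴴ * diagonal (fun j => (l (f j) : ℂ)) * D).PosDef := by
    have := (PosDef.diagonal (n := k) (d := fun j => (l (f j) : ℂ)) fun j => by
      exact_mod_cast hl (f j))
    exact (IsUnit.posDef_star_left_conjugate_iff hDu).2 this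
  classical
  have h2 : (Cᴴ * diagonal (fun t => (l t : ℂ)) * C -
      Dᴴ * diagonal (fun j => (l (f j) : ℂ)) * D) =
      Cᴴ * diagonal (fun t => if t ∈ Set.range f then 0 else (l t : ℂ)) * C := by
    ext a b
    rw [Matrix.sub_apply, Matrix.mul_apply, Matrix.mul_apply, Matrix.mul_apply]
    simp only [mul_diagonal, conjTranspose_apply, hD, submatrix_apply, id]
    have : ∑ j, star (C (f j) a) * (l (f j) : ℂ) * C (f j) b =
        ∑ t, if t ∈ Set.range f then star (C t a) * (l t : ℂ) * C t b else 0 := by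
      rw [← Finset.sum_filter]
      rw [← Finset.sum_image (f := fun t => star (C t a) * (l t : ℂ) * C t b)
        (g := f) (s := Finset.univ) (hinj.injOn)]
      refine Finset.sum_congr ?_ fun _ _ => rfl
      ext t; simp
    rw [this, ← Finset.sum_sub_distrib]
    refine Finset.sum_congr rfl fun t _ => ?_
    split_ifs <;> simp
  have h3 : (Cᴴ * diagonal (fun t => (l t : ℂ)) * C -
      Dᴴ * diagonal (fun j => (l (f j) : ℂ)) * D).PosSemidef := by
    rw [h2]
    refine PosSemidef.conjTranspose_mul_mul_same (PosSemidef.diagonal ?_) _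
    intro t
    show (0 : ℂ) ≤ if t ∈ Set.range f then 0 else (l t : ℂ)
    split_ifs
    · exact le_rfl
    · exact_mod_cast (hl t).le
  refine le_trans (le_of_eq ?_) (det_re_le_of_sub_posSemidef h1 h3)
  rw [det_mul, det_mul, det_conjTranspose, det_diagonal]
  have : star D.det * (∏ j, (l (f j) : ℂ)) * D.det =
      (((∏ j, l (f j)) * ‖D.det‖ ^ 2 : ℝ) : ℂ) := by
    rw [mul_right_comm, RCLike.star_def, ← Complex.normSq_eq_conj_mul_self,
      Complex.normSq_eq_norm_sq]
    push_cast; ring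
  rw [this, Complex.ofReal_re]

theorem rank_le_of_max_weight {m k : Type*} [Fintype m] [DecidableEq m] [Fintype k] [DecidableEq k]
    (C : Matrix m k ℂ) (l : m → ℝ) (f : k → m) (hf : (C.submatrix f id).det ≠ 0)
    (hmax : ∀ f' : k → m, (C.submatrix f' id).det ≠ 0 → ∑ j, l (f' j) ≤ ∑ j, l (f j))
    (P : ℝ → Prop) [DecidablePred P] (hP : ∀ x y, x ≤ y → P x → P y) :
    (coordProj (Finset.univ.filter fun t => P (l t)) * C).rank ≤
      Fintype.card {j // P (l (f j))} := by
  set D := C * (C.submatrix f id)⁻¹ with hD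
  have hDC : D * C.submatrix f id = C := by
    rw [hD, Matrix.mul_assoc, nonsing_inv_mul _ (isUnit_iff_ne_zero.2 hf), Matrix.mul_one]
  have hDf : D.submatrix f id = 1 := by
    have : D.submatrix f id = C.submatrix f id * (C.submatrix f id)⁻¹ := by
      rw [hD]; ext a b; simp [Matrix.mul_apply]
    rw [this, mul_nonsing_inv _ (isUnit_iff_ne_zero.2 hf)]
  have hmono : ∀ t j, D t j ≠ 0 → l t ≤ l (f j) := by
    intro t j htj
    have h1 : D.submatrix (Function.update f j t) id = updateRow 1 j (D t) := by
      ext a b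
      by_cases ha : a = j
      · subst ha; simp
      · rw [updateRow_ne ha, ← hDf]; simp [ha]
    have h2 : (D.submatrix (Function.update f j t) id).det = D t j := by
      rw [h1, ← cramer_transpose_apply, transpose_one, cramer_one]; rfl
    have h3 : C.submatrix (Function.update f j t) id =
        D.submatrix (Function.update f j t) id * C.submatrix f id := by
      conv_lhs => rw [← hDC]
      ext a b; simp [Matrix.mul_apply]
    have h4 := hmax (Function.update f j t) (by rw [h3, det_mul, h2]; exact mul_ne_zero htj hf)
    have h5 : ∀ i, l (Function.update f j t i) = Function.update (l ∘ f) j (l t) i := by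
      intro i; by_cases hi : i = j
      · subst hi; simp
      · simp [hi]
    simp_rw [h5] at h4
    rw [Finset.sum_update_of_mem (Finset.mem_univ j),
      ← Finset.add_sum_erase _ (fun i => l (f i)) (Finset.mem_univ j)] at h4
    simp only [Finset.sdiff_singleton_eq_erase, Function.comp_apply] at h4
    linarith
  have key : coordProj (Finset.univ.filter fun t => P (l t)) * C =
      coordProj (Finset.univ.filter fun t => P (l t)) * D *
        (coordProj (Finset.univ.filter fun j => P (l (f j))) * C.submatrix f id) := by
    rw [← Matrix.mul_assoc, Matrix.mul_assoc _ D]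
    have : coordProj (Finset.univ.filter fun t => P (l t)) *
        (D * coordProj (Finset.univ.filter fun j => P (l (f j)))) =
        coordProj (Finset.univ.filter fun t => P (l t)) * D := by
      ext t j
      simp only [coordProj, diagonal_mul, mul_diagonal, Finset.mem_filter, Finset.mem_univ,
        true_and]
      by_cases h1 : P (l t)
      · by_cases h2 : P (l (f j))
        · simp [h1, h2]
        · have : D t j = 0 := by
            by_contra h; exact h2 (hP _ _ (hmono t j h) h1)
          simp [this]
      · simp [h1]
    rw [this, Matrix.mul_assoc, hDC]
  rw [key]
  refine (rank_mul_le_right _ _).trans ((rank_mul_le_left _ _).trans ?_)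
  rw [rank_coordProj, Fintype.card_subtype]

/-! ### A uniform lower bound from semistability -/

theorem exists_uniform_lower_bound {X τ : Type*} [TopologicalSpace X] [Finite τ] {K : Set X}
    (hK : IsCompact K) (φ : τ → X → ℂ) (hφ : ∀ i, Continuous (φ i)) :
    ∃ c : ℝ, 0 < c ∧ ∀ x ∈ K, ∃ y ∈ K, ∀ i, φ i y ≠ 0 → c ≤ ‖φ i x‖ := by
  refine hK.induction_on (p := fun s => ∃ c : ℝ, 0 < c ∧ ∀ x ∈ s, ∃ y ∈ K, ∀ i, φ i y ≠ 0 →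
    c ≤ ‖φ i x‖) ?_ ?_ ?_ ?_
  · exact ⟨1, one_pos, fun x hx => hx.elim⟩
  · rintro s t hst ⟨c, hc, h⟩
    exact ⟨c, hc, fun x hx => h x (hst hx)⟩
  · rintro s t ⟨c, hc, h⟩ ⟨d, hd, h'⟩
    refine ⟨min c d, lt_min hc hd, fun x hx => ?_⟩
    rcases hx with hx | hx
    · obtain ⟨y, hy, H⟩ := h x hx
      exact ⟨y, hy, fun i hi => (min_le_left _ _).trans (H i hi)⟩
    · obtain ⟨y, hy, H⟩ := h' x hx
      exact ⟨y, hy, fun i hi => (min_le_right _ _).trans (H i hi)⟩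
  · intro y hy
    obtain ⟨c, hc, h⟩ : ∃ c : ℝ, 0 < c ∧ ∀ i, φ i y ≠ 0 → c < ‖φ i y‖ := by
      have h1 : ∀ i, ∀ᶠ c : ℝ in nhdsWithin 0 (Set.Ioi 0), φ i y ≠ 0 → c < ‖φ i y‖ := by
        intro i
        by_cases hi : φ i y = 0
        · simp [hi]
        · filter_upwards [Ioo_mem_nhdsGT (norm_pos_iff.2 hi)] with c hc _ using hc.2
      obtain ⟨c, h2, h3⟩ := ((Filter.eventually_all.2 h1).and self_mem_nhdsWithin).exists
      exact ⟨c, h3, h2⟩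
    have h2 : ∀ᶠ x in nhds y, ∀ i, φ i y ≠ 0 → c ≤ ‖φ i x‖ := by
      refine Filter.eventually_all.2 fun i => ?_
      by_cases hi : φ i y = 0
      · simp [hi]
      · filter_upwards [((hφ i).norm.continuousAt (x := y)).eventually_const_lt (h i hi)]
          with x hx _ using hx.le
    exact ⟨_, nhdsWithin_le_nhds h2, c, hc, fun x hx => ⟨y, hy, hx⟩⟩

theorem integral_ite_lt {R a : ℝ} (h1 : -R ≤ a) (h2 : a ≤ R) (A : ℝ) :
    IntervalIntegrable (fun s : ℝ => if s < a then A else 0) MeasureTheory.volume (-R) R ∧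
      ∫ s in (-R)..R, (if s < a then A else 0) = A * (a + R) := by
  have e1 : Set.EqOn (fun s : ℝ => if s < a then A else 0) (fun _ => A) (Set.Ioo (-R) a) :=
    fun s hs => if_pos hs.2
  have e2 : Set.EqOn (fun s : ℝ => if s < a then A else 0) (fun _ => 0) (Set.Ioo a R) :=
    fun s hs => if_neg (not_lt.2 hs.1.le)
  have hi : ∀ x y, IntervalIntegrable (fun s : ℝ => if s < a then A else 0)
      MeasureTheory.volume x y := by
    intro x y
    have : (fun s : ℝ => if s < a then A else 0) = fun s => A * (if s < a then 1 else 0) := by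
      ext; split_ifs <;> simp
    rw [this]
    refine IntervalIntegrable.const_mul (Antitone.intervalIntegrable ?_) _
    intro s t hst
    dsimp only
    split_ifs with h3 h4 h4
    · exact le_rfl
    · exact absurd (hst.trans_lt h3) h4
    · exact zero_le_one
    · exact le_rfl
  refine ⟨hi _ _, ?_⟩
  rw [← intervalIntegral.integral_add_adjacent_intervals (hi (-R) a) (hi a R),
    intervalIntegral.integral_congr_Ioo_of_le h1 e1,
    intervalIntegral.integral_congr_Ioo_of_le h2 e2]
  simp; ring

theorem sum_mul_le_of_layers {m n : Type*} [Fintype m] [Fintype n] {A l : m → ℝ} {B b : n → ℝ}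
    {κ : ℝ} (hA : ∑ i, A i = κ) (hB : ∑ j, B j = κ)
    (h : ∀ s : ℝ, ∑ i, (if l i ≤ s then A i else 0) + ∑ j, (if s < b j then B j else 0) ≤ κ) :
    ∑ j, B j * b j ≤ ∑ i, A i * l i := by
  set R : ℝ := ∑ i, |l i| + ∑ j, |b j| with hR
  have hl : ∀ i, |l i| ≤ R := fun i => by
    have h1 := Finset.single_le_sum (fun i _ => abs_nonneg (l i)) (Finset.mem_univ i)
    have h2 : 0 ≤ ∑ j, |b j| := Finset.sum_nonneg fun j _ => abs_nonneg _
    linarith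
  have hb : ∀ j, |b j| ≤ R := fun j => by
    have h1 := Finset.single_le_sum (fun j _ => abs_nonneg (b j)) (Finset.mem_univ j)
    have h2 : 0 ≤ ∑ i, |l i| := Finset.sum_nonneg fun j _ => abs_nonneg _
    linarith
  have hR0 : 0 ≤ R := by positivity
  have h' : ∀ s : ℝ, ∑ j, (if s < b j then B j else 0) ≤ ∑ i, (if s < l i then A i else 0) := by
    intro s
    have h1 := h s
    have h2 : ∑ i, (if l i ≤ s then A i else 0) + ∑ i, (if s < l i then A i else 0) = κ := by
      rw [← Finset.sum_add_distrib, ← hA]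
      refine Finset.sum_congr rfl fun i _ => ?_
      by_cases hi : l i ≤ s
      · simp [hi, not_lt.2 hi]
      · simp [hi, not_le.1 hi]
    linarith
  have iA := fun i => integral_ite_lt (abs_le.1 (hl i)).1 (abs_le.1 (hl i)).2 (A i)
  have iB := fun j => integral_ite_lt (abs_le.1 (hb j)).1 (abs_le.1 (hb j)).2 (B j)
  have := intervalIntegral.integral_mono (by linarith)
    (IntervalIntegrable.sum Finset.univ fun j _ => (iB j).1)
    (IntervalIntegrable.sum Finset.univ fun i _ => (iA i).1)
    (fun s => by simpa only [Finset.sum_apply] using h' s)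
  simp only [Finset.sum_apply] at this
  rw [intervalIntegral.integral_finsetSum fun j _ => (iB j).1,
    intervalIntegral.integral_finsetSum fun i _ => (iA i).1] at this
  simp only [fun i => (iA i).2, fun j => (iB j).2, mul_add, Finset.sum_add_distrib,
    ← Finset.sum_mul, hA, hB] at this
  linarith

theorem exists_minor_ne_zero {m k : Type*} [Fintype m] [DecidableEq m] [Fintype k] [DecidableEq k]
    {L : Matrix k m ℂ} {C : Matrix m k ℂ} (h : (L * C).det ≠ 0) :
    ∃ f : k → m, (C.submatrix f id).det ≠ 0 := by
  by_contra! hf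
  apply h
  have h1 : L * C = fun a => ∑ t, L a t • C t := by
    ext a b; simp [Matrix.mul_apply, Finset.sum_apply]
  have h2 := (detRowAlternating (n := k) (R := ℂ)).toMultilinearMap.map_sum
    (fun (a : k) (t : m) => L a t • C t)
  have h3 : (L * C).det = ∑ r : k → m, detRowAlternating fun i => L i (r i) • C (r i) := by
    rw [h1]; exact h2
  rw [h3]
  refine Finset.sum_eq_zero fun r _ => ?_
  have h4 := (detRowAlternating (n := k) (R := ℂ)).toMultilinearMap.map_smul_univ
    (fun i => L i (r i)) (fun i => C (r i))
  refine Eq.trans h4 ?_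
  have h5 : detRowAlternating (fun i => C (r i)) = 0 := hf r
  exact (congrArg _ h5).trans (smul_zero _)

theorem exists_minor_pre {p : ℕ} {M : Matrix (Fin p) (Fin p) ℂ} (hM : M.det ≠ 0) (i : Fin p) :
    ∃ f : {j // j ≤ i} → Fin p, ((pre M i).submatrix f id).det ≠ 0 := by
  apply exists_minor_ne_zero (L := M⁻¹.submatrix Subtype.val id)
  have : M⁻¹.submatrix (Subtype.val : {j // j ≤ i} → _) id * pre M i = 1 := by
    have h := nonsing_inv_mul M (isUnit_iff_ne_zero.2 hM)
    ext a b
    have h2 := congrFun (congrFun h a) b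
    simp only [Matrix.mul_apply] at h2
    simp only [Matrix.mul_apply, submatrix_apply, id, pre, h2, Matrix.one_apply, Subtype.ext_iff]
  rw [this, det_one]; exact one_ne_zero

theorem lw_conj_diagonal_ge {r : ℕ} {G u : Matrix (Fin r) (Fin r) ℂ} {w : Fin r → ℝ}
    (hw : ∀ i, 0 ≤ drop w i) {c : ℝ} (hc : 0 < c) (l : Fin r → ℝ)
    (f : (i : Fin r) → {j // j ≤ i} → Fin r)
    (hf : ∀ i, c ≤ ‖((pre (uᴴ * G) i).submatrix (f i) id).det‖) :
    ∑ i, drop w i * ∑ j, l (f i j) + 2 * Real.log c * ∑ i, drop w i ≤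
      lw w (Gᴴ * (u * diagonal (fun t => (Real.exp (l t) : ℂ)) * uᴴ) * G) := by
  rw [Finset.mul_sum, ← Finset.sum_add_distrib, lw]
  refine Finset.sum_le_sum fun i _ => ?_
  rw [mul_comm (2 * Real.log c), ← mul_add]
  refine mul_le_mul_of_nonneg_left ?_ (hw i)
  have h0 : 0 < ‖((pre (uᴴ * G) i).submatrix (f i) id).det‖ := hc.trans_le (hf i)
  have h1 := le_det_conj_diagonal (pre (uᴴ * G) i) (fun t => Real.exp (l t))
    (fun t => Real.exp_pos _) (f i) (norm_pos_iff.1 h0)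
  have h2 : (pre (uᴴ * G) i)ᴴ * diagonal (fun t => (Real.exp (l t) : ℂ)) * pre (uᴴ * G) i =
      (Gᴴ * (u * diagonal (fun t => (Real.exp (l t) : ℂ)) * uᴴ) * G).submatrix
        Subtype.val Subtype.val := by
    rw [conjTranspose_pre_mul]
    congr 1
    rw [conjTranspose_mul, conjTranspose_conjTranspose]
    simp only [Matrix.mul_assoc]
  rw [h2] at h1
  refine le_trans ?_ (Real.log_le_log ?_ h1)
  · rw [Real.log_mul (Finset.prod_pos fun j _ => Real.exp_pos _).ne' (pow_pos h0 2).ne',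
      ← Real.exp_sum, Real.log_exp, Real.log_pow]
    have := Real.log_le_log hc (hf i)
    push_cast; linarith
  · exact mul_pos (Finset.prod_pos fun j _ => Real.exp_pos _) (pow_pos h0 2)

theorem exists_weight_bound {r : ℕ} {G : Fin 3 → Matrix (Fin r) (Fin r) ℂ}
    {u u₀ : Matrix (Fin r) (Fin r) ℂ} (hu₀ : u₀ ∈ unitaryGroup (Fin r) ℂ) {w : Fin 3 → Fin r → ℝ}
    (hw : ∀ k i, 0 ≤ drop (w k) i) (hG : ∀ k, (G k).det ≠ 0) {c : ℝ} (hc : 0 < c)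
    (hcu : ∀ k i (f : {j // j ≤ i} → Fin r), ((pre (u₀ᴴ * G k) i).submatrix f id).det ≠ 0 →
      c ≤ ‖((pre (uᴴ * G k) i).submatrix f id).det‖) (l : Fin r → ℝ) :
    ∃ N : Fin r → ℝ, ∑ t, N t = ∑ k, ∑ j, w k j ∧
      ∑ t, N t * l t + 2 * Real.log c * ∑ k, ∑ i, drop (w k) i ≤
        ∑ k, lw (w k) ((G k)ᴴ * (u * diagonal (fun t => (Real.exp (l t) : ℂ)) * uᴴ) * G k) ∧
      ∀ (P : ℝ → Prop) [DecidablePred P], (∀ x y, x ≤ y → P x → P y) →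
        ∑ t, (if P (l t) then 0 else N t) ≤
          ∑ k, defect (coordProj (Finset.univ.filter fun t => P (l t)) * u₀ᴴ * G k) (w k) := by
  have hdet : ∀ k, (u₀ᴴ * G k).det ≠ 0 := fun k => by
    rw [det_mul]
    exact mul_ne_zero
      (isUnit_det_of_left_inverse (unitary_mul_conjTranspose hu₀)).ne_zero (hG k)
  have hex : ∀ k i, ∃ f : {j // j ≤ i} → Fin r,
      ((pre (u₀ᴴ * G k) i).submatrix f id).det ≠ 0 ∧
      ∀ f' : {j // j ≤ i} → Fin r, ((pre (u₀ᴴ * G k) i).submatrix f' id).det ≠ 0 →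
        ∑ j, l (f' j) ≤ ∑ j, l (f j) := by
    intro k i
    obtain ⟨f₀, hf₀⟩ := exists_minor_pre (hdet k) i
    obtain ⟨f, hf, hmax⟩ := (Set.toFinite {f : {j // j ≤ i} → Fin r |
      ((pre (u₀ᴴ * G k) i).submatrix f id).det ≠ 0}).exists_maximalFor
        (fun f => ∑ j, l (f j)) _ ⟨f₀, hf₀⟩
    refine ⟨f, hf, fun f' hf' => ?_⟩
    rcases le_total (∑ j, l (f' j)) (∑ j, l (f j)) with h | h
    · exact h
    · exact hmax hf' h
  choose f hf hmax using hex
  set N : Fin r → ℝ := fun t => ∑ k, ∑ i, drop (w k) i * ∑ j, if f k i j = t then 1 else 0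
    with hN
  have hNg : ∀ g : Fin r → ℝ, ∑ t, N t * g t = ∑ k, ∑ i, drop (w k) i * ∑ j, g (f k i j) := by
    intro g
    simp only [hN, Finset.sum_mul]
    rw [Finset.sum_comm]
    refine Finset.sum_congr rfl fun k _ => ?_
    rw [Finset.sum_comm]
    refine Finset.sum_congr rfl fun i _ => ?_
    simp only [mul_assoc, ← Finset.mul_sum, Finset.sum_mul]
    rw [Finset.sum_comm]
    congr 1
    refine Finset.sum_congr rfl fun j _ => ?_
    simp
  refine ⟨N, ?_, ?_, ?_⟩
  · have := hNg 1
    simp only [Pi.one_apply, mul_one] at this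
    rw [this]
    refine Finset.sum_congr rfl fun k _ => ?_
    rw [← sum_drop_mul_card (w k)]
    simp
  · rw [hNg, Finset.mul_sum, ← Finset.sum_add_distrib]
    exact Finset.sum_le_sum fun k _ =>
      lw_conj_diagonal_ge (hw k) hc l (f k) fun i => hcu k i _ (hf k i)
  · intro P _ hP
    have h1 : ∑ t, (if P (l t) then 0 else N t) = ∑ t, N t * (if P (l t) then 0 else 1) :=
      Finset.sum_congr rfl fun t _ => by split_ifs <;> simp
    rw [h1, hNg fun t => if P (l t) then 0 else 1]
    refine Finset.sum_le_sum fun k _ => ?_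
    rw [defect]
    refine Finset.sum_le_sum fun i _ => mul_le_mul_of_nonneg_left ?_ (hw k i)
    have h2 := rank_le_of_max_weight (pre (u₀ᴴ * G k) i) l (f k i) (hf k i) (hmax k i) P hP
    rw [mul_pre, ← Matrix.mul_assoc] at h2
    have h3 : (∑ j, if P (l (f k i j)) then (0 : ℝ) else 1) =
        (Fintype.card {j // j ≤ i} : ℝ) - Fintype.card {j // P (l (f k i j))} := by
      have : ∀ j, (if P (l (f k i j)) then (0 : ℝ) else 1) =
          1 - if P (l (f k i j)) then 1 else 0 := fun j => by split_ifs <;> simp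
      simp_rw [this]
      rw [Finset.sum_sub_distrib, Finset.sum_boole, Fintype.card_subtype fun j => P (l (f k i j))]
      simp
    rw [h3]
    have : ((pre (coordProj (Finset.univ.filter fun t => P (l t)) * u₀ᴴ * G k) i).rank : ℝ) ≤
      Fintype.card {j // P (l (f k i j))} := by exact_mod_cast h2
    linarith

/-- Semistability bounds the logarithmic functional from below. -/
theorem Semi.exists_lower_bound {p q : ℕ} {ζ : Matrix (Fin p) (Fin q) ℂ}
    {G : Fin 3 → Matrix (Fin p) (Fin p) ℂ} {F : Fin 3 → Matrix (Fin q) (Fin q) ℂ}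
    {w₁ : Fin 3 → Fin p → ℝ} {w₂ : Fin 3 → Fin q → ℝ} {Γ κ : ℝ}
    (h : Semi ζ G F w₁ w₂ Γ κ) (hw₁ : ∀ k i, 0 ≤ drop (w₁ k) i)
    (hw₂ : ∀ k i, 0 ≤ drop (w₂ k) i) (hG : ∀ k, (G k).det ≠ 0) (hF : ∀ k, (F k).det ≠ 0)
    (hκ₁ : ∑ k, ∑ j, w₁ k j - Γ * p = κ) (hκ₂ : ∑ k, ∑ j, w₂ k j - Γ * q = κ) :
    ∃ C : ℝ, ∀ u ∈ unitaryGroup (Fin p) ℂ, ∀ v ∈ unitaryGroup (Fin q) ℂ,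
      ∀ (l : Fin p → ℝ) (m : Fin q → ℝ),
      (∀ i j, ‖(uᴴ * ζ * (vᴴ)ᵀ) i j‖ * Real.exp ((l i + m j) / 2) ≤ 2) →
      C ≤ ∑ k, lw (w₁ k) ((G k)ᴴ * (u * diagonal (fun t => (Real.exp (l t) : ℂ)) * uᴴ) * G k) +
        ∑ k, lw (w₂ k) ((F k)ᴴ * (v * diagonal (fun t => (Real.exp (m t) : ℂ)) * vᴴ) * F k) -
        Γ * ∑ i, l i - Γ * ∑ j, m j := by
  let τ := (Fin p × Fin q) ⊕ (Σ _ : Fin 3, Σ i : Fin p, ({j // j ≤ i} → Fin p)) ⊕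
    (Σ _ : Fin 3, Σ i : Fin q, ({j // j ≤ i} → Fin q))
  let X := Matrix (Fin p) (Fin p) ℂ × Matrix (Fin q) (Fin q) ℂ
  let φ : τ → X → ℂ := Sum.elim (fun ij x => (x.1ᴴ * ζ * (x.2ᴴ)ᵀ) ij.1 ij.2)
    (Sum.elim (fun s x => ((pre (x.1ᴴ * G s.1) s.2.1).submatrix s.2.2 id).det)
      (fun s x => ((pre (x.2ᴴ * F s.1) s.2.1).submatrix s.2.2 id).det))
  have hφ : ∀ i, Continuous (φ i) := by
    rintro (⟨i, j⟩ | ⟨k, i, f⟩ | ⟨k, i, f⟩)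
    · have : Continuous fun x : X => x.1ᴴ * ζ * (x.2ᴴ)ᵀ := by fun_prop
      exact this.matrix_elem i j
    · have : Continuous fun x : X => x.1ᴴ * G k := by fun_prop
      exact (((this.matrix_submatrix id Subtype.val)).matrix_submatrix f id).matrix_det
    · have : Continuous fun x : X => x.2ᴴ * F k := by fun_prop
      exact (((this.matrix_submatrix id Subtype.val)).matrix_submatrix f id).matrix_det
  obtain ⟨c, hc, hb⟩ := exists_uniform_lower_bound
    ((isCompact_unitary (m := Fin p)).prod (isCompact_unitary (m := Fin q))) φ hφ
  set C₀ : ℝ := 2 * Real.log (2 / c) with hC₀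
  refine ⟨C₀ * κ + (2 * Real.log c * ∑ k, ∑ i, drop (w₁ k) i +
    2 * Real.log c * ∑ k, ∑ i, drop (w₂ k) i), fun u hu v hv l m hlm => ?_⟩
  obtain ⟨⟨u₀, v₀⟩, ⟨hu₀, hv₀⟩, hc'⟩ := hb (u, v) ⟨hu, hv⟩
  have hζ : ∀ i j, (u₀ᴴ * ζ * (v₀ᴴ)ᵀ) i j ≠ 0 → l i + m j ≤ C₀ := by
    intro i j hij
    have h1 : c ≤ ‖(uᴴ * ζ * (vᴴ)ᵀ) i j‖ := hc' (Sum.inl (i, j)) hij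
    have h2 : Real.exp ((l i + m j) / 2) ≤ 2 / c := by
      rw [le_div_iff₀ hc, mul_comm]
      exact (mul_le_mul_of_nonneg_right h1 (Real.exp_pos _).le).trans (hlm i j)
    have h3 := (Real.le_log_iff_exp_le (by positivity)).2 h2
    rw [hC₀]; linarith
  obtain ⟨N, hN1, hN2, hN3⟩ := exists_weight_bound (u := u) hu₀ hw₁ hG hc
    (fun k i f hf => hc' (Sum.inr (Sum.inl ⟨k, i, f⟩)) hf) l
  obtain ⟨M, hM1, hM2, hM3⟩ := exists_weight_bound (u := v) hv₀ hw₂ hF hc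
    (fun k i f hf => hc' (Sum.inr (Sum.inr ⟨k, i, f⟩)) hf) m
  have hrank : ∀ {r : ℕ} (u : Matrix (Fin r) (Fin r) ℂ) (hu : u ∈ unitaryGroup (Fin r) ℂ)
      (S : Finset (Fin r)), (coordProj S * uᴴ).rank = S.card := by
    intro r u hu S
    rw [rank_mul_eq_left_of_isUnit_det uᴴ (coordProj S)
      (isUnit_det_of_left_inverse (unitary_mul_conjTranspose hu)), rank_coordProj]
  have hcount : ∀ {r : ℕ} (P : Fin r → Prop) [DecidablePred P],
      ∑ t, (if P t then (0 : ℝ) else Γ) =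
        Γ * ((r : ℝ) - (Finset.univ.filter fun t => P t).card) := by
    intro r P _
    have : ∀ t, (if P t then (0 : ℝ) else Γ) = Γ * (1 - if P t then 1 else 0) :=
      fun t => by split_ifs <;> simp
    simp_rw [this]
    rw [← Finset.mul_sum, Finset.sum_sub_distrib, Finset.sum_boole]
    simp
  have key := sum_mul_le_of_layers (A := fun t => N t - Γ) (l := l) (B := fun t => M t - Γ)
    (b := fun t => C₀ - m t) (κ := κ)
    (by rw [Finset.sum_sub_distrib, hN1, ← hκ₁]; simp [mul_comm])
    (by rw [Finset.sum_sub_distrib, hM1, ← hκ₂]; simp [mul_comm])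
    (by
      intro s
      have h1 := hN3 (fun x => s < x) (fun x y hxy hx => hx.trans_le hxy)
      have h2 := hM3 (fun x => C₀ - s ≤ x) (fun x y hxy hx => hx.trans hxy)
      have h3 := h (coordProj (Finset.univ.filter fun t => s < l t) * u₀ᴴ)
        (coordProj (Finset.univ.filter fun t => C₀ - s ≤ m t) * v₀ᴴ) (by
          rw [transpose_mul, coordProj_transpose]
          have : coordProj (Finset.univ.filter fun t => s < l t) * u₀ᴴ * ζ *
              ((v₀ᴴ)ᵀ * coordProj (Finset.univ.filter fun t => C₀ - s ≤ m t)) =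
              coordProj (Finset.univ.filter fun t => s < l t) * (u₀ᴴ * ζ * (v₀ᴴ)ᵀ) *
              coordProj (Finset.univ.filter fun t => C₀ - s ≤ m t) := by
            simp only [Matrix.mul_assoc]
          rw [this]
          ext i j
          simp only [coordProj, diagonal_mul, mul_diagonal, Finset.mem_filter, Finset.mem_univ,
            true_and, Matrix.zero_apply]
          by_cases hi : s < l i
          · by_cases hj : C₀ - s ≤ m j
            · have : (u₀ᴴ * ζ * (v₀ᴴ)ᵀ) i j = 0 := by
                by_contra h0
                linarith [hζ i j h0]
              simp [this]
            · simp [hj]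
          · simp [hi])
      rw [hrank _ hu₀, hrank _ hv₀] at h3
      have e1 : ∑ t, (if l t ≤ s then N t - Γ else 0) =
          ∑ t, (if s < l t then 0 else N t) - ∑ t, (if s < l t then (0 : ℝ) else Γ) := by
        rw [← Finset.sum_sub_distrib]
        refine Finset.sum_congr rfl fun t _ => ?_
        by_cases ht : s < l t
        · simp [ht, not_le.2 ht]
        · simp [ht, not_lt.1 ht]
      have e2 : ∑ t, (if s < C₀ - m t then M t - Γ else 0) =
          ∑ t, (if C₀ - s ≤ m t then 0 else M t) - ∑ t, (if C₀ - s ≤ m t then (0 : ℝ) else Γ) := by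
        rw [← Finset.sum_sub_distrib]
        refine Finset.sum_congr rfl fun t _ => ?_
        by_cases ht : C₀ - s ≤ m t
        · have : ¬ s < C₀ - m t := by linarith
          simp [ht, this]
        · have : s < C₀ - m t := by linarith
          simp [ht, this]
      rw [e1, e2, hcount, hcount]
      linarith)
  have k1 : ∑ t, (M t - Γ) * (C₀ - m t) =
      C₀ * κ - ∑ t, M t * m t + Γ * ∑ t, m t := by
    have : ∑ t, (M t - Γ) = κ := by
      rw [Finset.sum_sub_distrib, hM1, ← hκ₂]; simp [mul_comm]
    simp only [sub_mul, mul_sub, Finset.sum_sub_distrib, ← Finset.sum_mul, ← Finset.mul_sum]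
    rw [← this, Finset.sum_sub_distrib]
    simp; ring
  have k2 : ∑ t, (N t - Γ) * l t = ∑ t, N t * l t - Γ * ∑ t, l t := by
    simp only [sub_mul, Finset.sum_sub_distrib, ← Finset.mul_sum]
  rw [k1, k2] at key
  linarith

/-! ### Positive definite matrices: blocks, triangular changes of frame, openness -/

theorem posDef_conj {m : Type*} [Fintype m] [DecidableEq m] {S T : Matrix m m ℂ}
    (hS : S.PosDef) (hT : T.det ≠ 0) : (Tᴴ * S * T).PosDef :=
  (IsUnit.posDef_star_left_conjugate_iff
    ((isUnit_iff_isUnit_det _).2 (isUnit_iff_ne_zero.2 hT))).2 hS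

/-- The leading principal block with indices at most `i`. -/
abbrev lead {p : ℕ} (M : Matrix (Fin p) (Fin p) ℂ) (i : Fin p) :
    Matrix {j // j ≤ i} {j // j ≤ i} ℂ :=
  M.submatrix Subtype.val Subtype.val

theorem posDef_lead {p : ℕ} {S : Matrix (Fin p) (Fin p) ℂ} (hS : S.PosDef) (i : Fin p) :
    (lead S i).PosDef :=
  hS.submatrix Subtype.val_injective

theorem inv_submatrix_sub_posSemidef {m n : Type*} [Fintype m] [DecidableEq m] [Fintype n]
    [DecidableEq n] {M : Matrix m m ℂ} (hM : M.PosDef) {e : n → m} (he : Function.Injective e) :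
    (M⁻¹.submatrix e e - (M.submatrix e e)⁻¹).PosSemidef := by
  set I : Matrix m n ℂ := (1 : Matrix m m ℂ).submatrix id e with hI
  set D := M.submatrix e e with hD
  have hDp : D.PosDef := hM.submatrix he
  have hMD : Iᴴ * M * I = D := by
    ext a b; simp [hI, hD, Matrix.mul_apply, Matrix.one_apply]
  have hMM : M⁻¹ * M = 1 := nonsing_inv_mul _ ((isUnit_iff_isUnit_det _).1 hM.isUnit)
  have hMM' : M * M⁻¹ = 1 := mul_nonsing_inv _ ((isUnit_iff_isUnit_det _).1 hM.isUnit)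
  have hDD : D⁻¹ * D = 1 := nonsing_inv_mul _ ((isUnit_iff_isUnit_det _).1 hDp.isUnit)
  set R := M⁻¹ - I * D⁻¹ * Iᴴ with hR
  have hRH : Rᴴ = R := by
    rw [hR, conjTranspose_sub, conjTranspose_nonsing_inv, hM.1, conjTranspose_mul,
      conjTranspose_mul, conjTranspose_conjTranspose, conjTranspose_nonsing_inv, hDp.1,
      Matrix.mul_assoc]
  have hRM : Rᴴ * M * R = R := by
    have h1 : (I * D⁻¹ * Iᴴ) * M * (I * D⁻¹ * Iᴴ) = I * D⁻¹ * Iᴴ := by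
      calc _ = I * (D⁻¹ * (Iᴴ * M * I)) * D⁻¹ * Iᴴ := by simp only [Matrix.mul_assoc]
        _ = _ := by rw [hMD, hDD, Matrix.mul_one]
    rw [hRH, hR, Matrix.sub_mul, hMM, Matrix.sub_mul, Matrix.mul_sub (I * D⁻¹ * Iᴴ * M), h1,
      Matrix.mul_assoc _ M, hMM', Matrix.one_mul, Matrix.mul_one]
    abel
  have hRp : R.PosSemidef := by
    rw [← hRM]; exact hM.posSemidef.conjTranspose_mul_mul_same R
  have := hRp.submatrix e
  have h2 : R.submatrix e e = M⁻¹.submatrix e e - D⁻¹ := by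
    ext a b
    simp [hR, hI, Matrix.mul_apply, Matrix.one_apply, he.eq_iff]
  rwa [h2] at this

theorem det_mul_det_inv_submatrix_inr {m n : Type*} [Fintype m] [DecidableEq m] [Fintype n]
    [DecidableEq n] {M : Matrix (m ⊕ n) (m ⊕ n) ℂ} (hM : M.PosDef) :
    M.det * (M⁻¹.submatrix Sum.inr Sum.inr).det = (M.submatrix Sum.inl Sum.inl).det := by
  have hMM' : M * M⁻¹ = 1 := mul_nonsing_inv _ ((isUnit_iff_isUnit_det _).1 hM.isUnit)
  have h : M * fromBlocks 1 (M⁻¹.submatrix Sum.inl Sum.inr) 0 (M⁻¹.submatrix Sum.inr Sum.inr) =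
      fromBlocks (M.submatrix Sum.inl Sum.inl) 0 (M.submatrix Sum.inr Sum.inl) 1 := by
    ext a b
    rcases b with b | b
    · rcases a with a | a <;>
        simp [Matrix.mul_apply, Fintype.sum_sum_type, Matrix.one_apply]
    · have := congrFun (congrFun hMM' a) (Sum.inr b)
      rw [Matrix.mul_apply, Fintype.sum_sum_type] at this
      rcases a with a | a <;>
        simp [Matrix.mul_apply, Fintype.sum_sum_type, this, Matrix.one_apply]
  have h2 := congrArg det h
  rw [det_mul, det_fromBlocks_zero₂₁, det_fromBlocks_zero₁₂] at h2
  simpa using h2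

theorem lw_mono {p : ℕ} {w : Fin p → ℝ} (hw : ∀ i, 0 ≤ drop w i) {S T : Matrix (Fin p) (Fin p) ℂ}
    (hS : S.PosDef) (hT : (T - S).PosSemidef) : lw w S ≤ lw w T :=
  Finset.sum_le_sum fun i _ => mul_le_mul_of_nonneg_left
    (Real.log_le_log (posDef_det_re_pos (posDef_lead hS i))
      (det_re_le_of_sub_posSemidef (posDef_lead hS i) (hT.submatrix Subtype.val))) (hw i)

theorem lw_add_log_det_le {p : ℕ} {w : Fin p → ℝ} (hw : ∀ i, 0 ≤ drop w i) (i : Fin p)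
    (hi : (i : ℕ) + 1 = p) {S T : Matrix (Fin p) (Fin p) ℂ}
    (hS : S.PosDef) (hT : (T - S).PosSemidef) :
    lw w S + w i * (Real.log T.det.re - Real.log S.det.re) ≤ lw w T := by
  have hlast : ∀ j, j ≤ i := fun j => Fin.le_def.2 (by omega)
  have hdet : ∀ M : Matrix (Fin p) (Fin p) ℂ,
      (M.submatrix (Subtype.val : {j // j ≤ i} → Fin p) Subtype.val).det = M.det := by
    intro M
    exact det_submatrix_equiv_self (Equiv.subtypeUnivEquiv hlast) M
  rw [lw, lw, ← Finset.add_sum_erase _ _ (Finset.mem_univ i),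
    ← Finset.add_sum_erase (a := i) _ _ (Finset.mem_univ i), hdet, hdet, drop_last w i hi]
  have : ∑ j ∈ Finset.univ.erase i, drop w j * Real.log (lead S j).det.re ≤
      ∑ j ∈ Finset.univ.erase i, drop w j * Real.log (lead T j).det.re :=
    Finset.sum_le_sum fun j (_ : j ∈ Finset.univ.erase i) => mul_le_mul_of_nonneg_left
    (Real.log_le_log (posDef_det_re_pos (posDef_lead hS j))
      (det_re_le_of_sub_posSemidef (posDef_lead hS j) (hT.submatrix Subtype.val))) (hw j)
  linarith

theorem lead_conj_of_triangular {p : ℕ} {T : Matrix (Fin p) (Fin p) ℂ}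
    (hT : ∀ i j, j < i → T i j = 0) (S : Matrix (Fin p) (Fin p) ℂ) (i : Fin p) :
    lead (Tᴴ * S * T) i = (lead T i)ᴴ * lead S i * lead T i := by
  have h1 : pre T i = pre (1 : Matrix (Fin p) (Fin p) ℂ) i * lead T i := by
    ext a b
    rw [Matrix.mul_apply]
    change T a b.1 = ∑ c : {j // j ≤ i}, (1 : Matrix (Fin p) (Fin p) ℂ) a c.1 * T c.1 b.1
    by_cases ha : a ≤ i
    · rw [Finset.sum_eq_single ⟨a, ha⟩]
      · simp
      · rintro c - hc
        have : a ≠ c := fun h => hc (Subtype.ext h.symm)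
        simp [this]
      · simp
    · rw [hT a b (lt_of_le_of_lt b.2 (not_le.1 ha))]
      refine (Finset.sum_eq_zero fun c _ => ?_).symm
      have : a ≠ c := fun h => ha (h ▸ c.2)
      simp [this]
  have h2 := conjTranspose_pre_mul (1 : Matrix (Fin p) (Fin p) ℂ) S i
  rw [conjTranspose_one, Matrix.one_mul, Matrix.mul_one] at h2
  have h3 := conjTranspose_pre_mul T S i
  rw [h1, conjTranspose_mul] at h3
  refine h3.symm.trans ?_
  rw [show lead S i = _ from h2.symm]
  simp only [Matrix.mul_assoc]

theorem lw_conj_of_triangular {p : ℕ} (w : Fin p → ℝ) {S T : Matrix (Fin p) (Fin p) ℂ}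
    (hT : ∀ i j, j < i → T i j = 0) (hT0 : T.det ≠ 0) (hS : S.PosDef) :
    lw w (Tᴴ * S * T) = lw w S + lw w (Tᴴ * T) := by
  rw [lw, lw, lw, ← Finset.sum_add_distrib]
  refine Finset.sum_congr rfl fun i _ => ?_
  rw [← mul_add]
  congr 1
  have h1 : (Tᴴ * T).PosDef := by
    have := posDef_conj (PosDef.one (R := ℂ)) hT0
    rwa [Matrix.mul_one] at this
  have h3 : lead (Tᴴ * T) i = (lead T i)ᴴ * lead T i := by
    have h2 := lead_conj_of_triangular hT 1 i
    rwa [Matrix.mul_one, show lead (1 : Matrix (Fin p) (Fin p) ℂ) i = 1 from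
      submatrix_one _ Subtype.val_injective, Matrix.mul_one] at h2
  have p1 := posDef_lead h1 i
  have p2 := posDef_lead hS i
  have h4 : (lead (Tᴴ * S * T) i).det = (lead S i).det * (lead (Tᴴ * T) i).det := by
    rw [lead_conj_of_triangular hT, h3, det_mul, det_mul, det_mul]; ring
  refine Eq.trans ?_ (Real.log_mul (posDef_det_re_pos p2).ne' (posDef_det_re_pos p1).ne')
  change Real.log (lead (Tᴴ * S * T) i).det.re = _
  rw [h4, posDef_det_eq p1, posDef_det_eq p2, ← Complex.ofReal_mul, Complex.ofReal_re,
    Complex.ofReal_re, Complex.ofReal_re]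

theorem exists_triangular {p : ℕ} {S : Matrix (Fin p) (Fin p) ℂ} (hS : S.PosDef) :
    ∃ T : Matrix (Fin p) (Fin p) ℂ, (∀ i j, j < i → T i j = 0) ∧ T.det ≠ 0 ∧
      Tᴴ * S * T = 1 := by
  set L := LDL.lowerInv hS with hL
  have hLdet : L.det ≠ 0 := (isUnit_det_of_invertible L).ne_zero
  have hD := LDL.diag_eq_lowerInv_conj hS
  have hDp : (LDL.diag hS).PosDef := by
    rw [hD]
    have := posDef_conj hS (T := (LDL.lowerInv hS)ᴴ) (by
      rw [det_conjTranspose]; exact star_ne_zero.2 hLdet)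
    rwa [conjTranspose_conjTranspose] at this
  have hd : ∀ i, 0 < LDL.diagEntries hS i := by
    have := (posDef_diagonal_iff (d := LDL.diagEntries hS)).1 hDp
    exact this
  have hdr : ∀ i, LDL.diagEntries hS i = ((LDL.diagEntries hS i).re : ℂ) := fun i =>
    Complex.ext rfl (by simpa using (Complex.pos_iff.1 (hd i)).2.symm)
  have hdp : ∀ i, 0 < (LDL.diagEntries hS i).re := fun i => (Complex.pos_iff.1 (hd i)).1
  set s : Fin p → ℂ := fun i => ((Real.sqrt (LDL.diagEntries hS i).re)⁻¹ : ℝ) with hs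
  have hsn : ∀ i, s i ≠ 0 := fun i => by
    simp only [hs]; exact_mod_cast (inv_pos.2 (Real.sqrt_pos.2 (hdp i))).ne'
  refine ⟨Lᴴ * diagonal s, ?_, ?_, ?_⟩
  · intro i j hij
    rw [mul_diagonal, conjTranspose_apply, hL, LDL.lowerInv_triangular hS hij]
    simp
  · rw [det_mul, det_diagonal, det_conjTranspose]
    exact mul_ne_zero (star_ne_zero.2 hLdet) (Finset.prod_ne_zero_iff.2 fun i _ => hsn i)
  · rw [conjTranspose_mul, conjTranspose_conjTranspose, diagonal_conjTranspose]
    calc _ = diagonal (star s) * (L * S * Lᴴ) * diagonal s := by simp only [Matrix.mul_assoc]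
      _ = 1 := by
        rw [← hD, LDL.diag, diagonal_mul_diagonal, diagonal_mul_diagonal, ← diagonal_one]
        congr 1
        ext i
        rw [hdr i]
        simp only [hs, Pi.star_apply, RCLike.star_def, Complex.conj_ofReal]
        norm_cast
        have := Real.mul_self_sqrt (hdp i).le
        have h0 := (Real.sqrt_pos.2 (hdp i)).ne'
        field_simp
        linarith

theorem eventually_posDef {X m : Type*} [Fintype m] [DecidableEq m] {𝓕 : Filter X}
    {f : X → Matrix m m ℂ} {M : Matrix m m ℂ} (hf : Filter.Tendsto f 𝓕 (nhds M))
    (hH : ∀ x, (f x).IsHermitian) (hM : M.PosDef) : ∀ᶠ x in 𝓕, (f x).PosDef := by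
  have h1 : ∀ᶠ N in nhds M, ∀ x ∈ Metric.sphere (0 : m → ℂ) 1,
      0 < (star x ⬝ᵥ (N *ᵥ x)).re := by
    refine (isCompact_sphere (0 : m → ℂ) 1).eventually_forall_of_forall_eventually fun x hx => ?_
    have hc : Continuous fun z : Matrix m m ℂ × (m → ℂ) => (star z.2 ⬝ᵥ (z.1 *ᵥ z.2)).re :=
      Complex.continuous_re.comp ((continuous_snd.star).dotProduct
        (continuous_fst.matrix_mulVec continuous_snd))
    refine hc.continuousAt.eventually_const_lt ?_
    have hx0 : x ≠ 0 := by rintro rfl; simp at hx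
    exact (Complex.pos_iff.1 (hM.dotProduct_mulVec_pos hx0)).1
  filter_upwards [hf.eventually h1] with y hy
  refine PosDef.of_dotProduct_mulVec_pos (hH y) fun x hx => ?_
  have hn : 0 < ‖x‖ := norm_pos_iff.2 hx
  have h2 := hy (((‖x‖⁻¹ : ℝ) : ℂ) • x) (by
    rw [mem_sphere_zero_iff_norm, norm_smul, Complex.norm_real, norm_inv, norm_norm,
      inv_mul_cancel₀ hn.ne'])
  have h3 : (star (((‖x‖⁻¹ : ℝ) : ℂ) • x) ⬝ᵥ (f y *ᵥ (((‖x‖⁻¹ : ℝ) : ℂ) • x))) =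
      ((‖x‖⁻¹ * ‖x‖⁻¹ : ℝ) : ℂ) * (star x ⬝ᵥ (f y *ᵥ x)) := by
    rw [mulVec_smul, star_smul, smul_dotProduct, dotProduct_smul, smul_eq_mul, smul_eq_mul,
      RCLike.star_def, Complex.conj_ofReal]
    push_cast; ring
  rw [h3, Complex.re_ofReal_mul] at h2
  have h4 : (star x ⬝ᵥ (f y *ᵥ x)).im = 0 := by
    have : star (star x ⬝ᵥ (f y *ᵥ x)) = star x ⬝ᵥ (f y *ᵥ x) := by
      conv_rhs => rw [star_dotProduct, star_mulVec, (hH y).eq, ← dotProduct_mulVec]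
    exact Complex.conj_eq_iff_im.1 this
  exact Complex.pos_iff.2 ⟨(pos_iff_pos_of_mul_pos h2).1 (by positivity), h4.symm⟩

/-! ### The Kempf-Ness type functional -/

variable {p q : ℕ}

/-- The first diagonal block. -/
abbrev blk₁ (M : Matrix (Fin p ⊕ Fin q) (Fin p ⊕ Fin q) ℂ) : Matrix (Fin p) (Fin p) ℂ :=
  M.submatrix Sum.inl Sum.inl

/-- The second diagonal block. -/
abbrev blk₂ (M : Matrix (Fin p ⊕ Fin q) (Fin p ⊕ Fin q) ℂ) : Matrix (Fin q) (Fin q) ℂ :=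
  M.submatrix Sum.inr Sum.inr

/-- The Hermitian off-diagonal matrix with upper right block `ζ`. -/
def offd (ζ : Matrix (Fin p) (Fin q) ℂ) : Matrix (Fin p ⊕ Fin q) (Fin p ⊕ Fin q) ℂ :=
  fromBlocks 0 ζ ζᴴ 0

/-- The linear part of `shift`. -/
def part (k : Fin 3) (Q : Matrix (Fin p ⊕ Fin q) (Fin p ⊕ Fin q) ℂ) :
    Matrix (Fin p ⊕ Fin q) (Fin p ⊕ Fin q) ℂ :=
  if k = 2 then fromBlocks (blk₁ Q) 0 0 (blk₂ Q) else Q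

/-- The three matrices `Q + offd ζ`, `Q` and the block diagonal part of `Q`. -/
def shift (k : Fin 3) (ζ : Matrix (Fin p) (Fin q) ℂ)
    (Q : Matrix (Fin p ⊕ Fin q) (Fin p ⊕ Fin q) ℂ) : Matrix (Fin p ⊕ Fin q) (Fin p ⊕ Fin q) ℂ :=
  part k Q + if k = 0 then offd ζ else 0

/-- The domain of the functional `psi`. -/
def Dom (ζ : Matrix (Fin p) (Fin q) ℂ) (Q : Matrix (Fin p ⊕ Fin q) (Fin p ⊕ Fin q) ℂ) : Prop :=
  Q.PosDef ∧ (Q + offd ζ).PosDef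

/-- The functional whose minimizers solve the sum problem. -/
noncomputable def psi (w₁ : Fin 3 → Fin p → ℝ) (w₂ : Fin 3 → Fin q → ℝ) (Γ : ℝ)
    (ζ : Matrix (Fin p) (Fin q) ℂ) (U : Fin 3 → Matrix (Fin p) (Fin p) ℂ)
    (V : Fin 3 → Matrix (Fin q) (Fin q) ℂ) (Q : Matrix (Fin p ⊕ Fin q) (Fin p ⊕ Fin q) ℂ) : ℝ :=
  ∑ k, lw (w₁ k) ((U k)ᴴ * blk₁ (shift k ζ Q)⁻¹ * U k) +
    ∑ k, lw (w₂ k) ((V k)ᴴ * blk₂ (shift k ζ Q)⁻¹ * V k) +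
    Γ * Real.log (blk₁ Q).det.re + Γ * Real.log (blk₂ Q).det.re

theorem offd_conjTranspose (ζ : Matrix (Fin p) (Fin q) ℂ) : (offd ζ)ᴴ = offd ζ := by
  simp [offd, fromBlocks_conjTranspose]

theorem blk₁_shift (k : Fin 3) (ζ : Matrix (Fin p) (Fin q) ℂ)
    (Q : Matrix (Fin p ⊕ Fin q) (Fin p ⊕ Fin q) ℂ) : blk₁ (shift k ζ Q) = blk₁ Q := by
  ext i j
  fin_cases k <;> simp [shift, part, offd]

theorem blk₂_shift (k : Fin 3) (ζ : Matrix (Fin p) (Fin q) ℂ)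
    (Q : Matrix (Fin p ⊕ Fin q) (Fin p ⊕ Fin q) ℂ) : blk₂ (shift k ζ Q) = blk₂ Q := by
  ext i j
  fin_cases k <;> simp [shift, part, offd]

theorem sig_conj (Q : Matrix (Fin p ⊕ Fin q) (Fin p ⊕ Fin q) ℂ) :
    sig (Fin p) (Fin q) * Q * sig (Fin p) (Fin q) =
      fromBlocks (blk₁ Q) (-Q.toBlocks₁₂) (-Q.toBlocks₂₁) (blk₂ Q) := by
  conv_lhs => rw [← fromBlocks_toBlocks Q, sig, fromBlocks_multiply, fromBlocks_multiply]
  simp only [Matrix.one_mul, Matrix.zero_mul, add_zero, zero_add, Matrix.mul_one, Matrix.mul_zero,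
    Matrix.neg_mul, Matrix.mul_neg, neg_neg]
  rfl

theorem two_smul_part_two (Q : Matrix (Fin p ⊕ Fin q) (Fin p ⊕ Fin q) ℂ) :
    (2 : ℝ) • part 2 Q = Q + sig (Fin p) (Fin q) * Q * sig (Fin p) (Fin q) := by
  rw [sig_conj, part, if_pos rfl]
  ext i j
  rcases i with i | i <;> rcases j with j | j <;> simp [two_mul, toBlocks₁₂, toBlocks₂₁]

theorem sig_det_ne_zero : (sig (Fin p) (Fin q)).det ≠ 0 := by
  rw [sig, det_fromBlocks_zero₂₁, det_neg]; simp

theorem sig_conjTranspose : (sig (Fin p) (Fin q))ᴴ = sig (Fin p) (Fin q) := by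
  simp [sig, fromBlocks_conjTranspose]

theorem posDef_part_two {Q : Matrix (Fin p ⊕ Fin q) (Fin p ⊕ Fin q) ℂ} (hQ : Q.PosDef) :
    (part 2 Q).PosDef := by
  have h : part 2 Q = (2⁻¹ : ℝ) • (Q + sig (Fin p) (Fin q) * Q * sig (Fin p) (Fin q)) := by
    rw [← two_smul_part_two, smul_smul]; norm_num
  rw [h]
  have h2 := posDef_conj hQ (sig_det_ne_zero (p := p) (q := q))
  rw [sig_conjTranspose] at h2
  exact (hQ.add h2).smul (by norm_num)

theorem Dom.posDef {ζ : Matrix (Fin p) (Fin q) ℂ} {Q : Matrix (Fin p ⊕ Fin q) (Fin p ⊕ Fin q) ℂ}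
    (h : Dom ζ Q) (k : Fin 3) : (shift k ζ Q).PosDef := by
  fin_cases k
  · simpa [shift, part] using h.2
  · simpa [shift, part] using h.1
  · simpa [shift] using posDef_part_two h.1

theorem norm_sq_le_of_posSemidef {m : Type*} {M : Matrix m m ℂ}
    (hM : M.PosSemidef) (a b : m) : ‖M a b‖ ^ 2 ≤ (M a a).re * (M b b).re := by
  have h := (hM.submatrix ![a, b]).det_nonneg
  rw [det_fin_two] at h
  simp only [submatrix_apply, cons_val_zero, cons_val_one] at h
  have h1 : M b a = star (M a b) := (hM.1.apply b a).symm
  have h2 : M a a = ((M a a).re : ℂ) := by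
    have := hM.1.apply a a
    exact (Complex.conj_eq_iff_re.1 this).symm
  have h3 : M b b = ((M b b).re : ℂ) := by
    have := hM.1.apply b b
    exact (Complex.conj_eq_iff_re.1 this).symm
  rw [h1, h2, h3] at h
  have h4 := (Complex.le_def.1 h).1
  rw [RCLike.star_def, Complex.mul_conj, Complex.normSq_eq_norm_sq] at h4
  rw [← Complex.ofReal_mul, ← Complex.ofReal_sub, Complex.ofReal_re] at h4
  simpa using h4

theorem lw_map_star (w : Fin p → ℝ) (S : Matrix (Fin p) (Fin p) ℂ) :
    lw w (S.map star) = lw w S := by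
  refine Finset.sum_congr rfl fun i _ => ?_
  have : (lead (S.map star) i).det = star (lead S i).det := by
    rw [← det_conjTranspose, ← det_transpose]; rfl
  change drop w i * Real.log (lead (S.map star) i).det.re = drop w i * Real.log (lead S i).det.re
  rw [this]; simp

/-- Simultaneous block diagonal change of coordinates. -/
abbrev bdiag (m₁ : Matrix (Fin p) (Fin p) ℂ) (m₂ : Matrix (Fin q) (Fin q) ℂ) :
    Matrix (Fin p ⊕ Fin q) (Fin p ⊕ Fin q) ℂ := fromBlocks m₁ 0 0 m₂

theorem bdiag_conj₁ (m₁ : Matrix (Fin p) (Fin p) ℂ) (m₂ : Matrix (Fin q) (Fin q) ℂ)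
    (Q : Matrix (Fin p ⊕ Fin q) (Fin p ⊕ Fin q) ℂ) :
    blk₁ (bdiag m₁ m₂ * Q * (bdiag m₁ m₂)ᴴ) = m₁ * blk₁ Q * m₁ᴴ := by
  conv_lhs => rw [← fromBlocks_toBlocks Q, fromBlocks_conjTranspose, fromBlocks_multiply,
    fromBlocks_multiply]
  simp only [Matrix.zero_mul, add_zero, zero_add, Matrix.mul_zero, conjTranspose_zero]
  rfl

theorem bdiag_conj₂ (m₁ : Matrix (Fin p) (Fin p) ℂ) (m₂ : Matrix (Fin q) (Fin q) ℂ)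
    (Q : Matrix (Fin p ⊕ Fin q) (Fin p ⊕ Fin q) ℂ) :
    blk₂ (bdiag m₁ m₂ * Q * (bdiag m₁ m₂)ᴴ) = m₂ * blk₂ Q * m₂ᴴ := by
  conv_lhs => rw [← fromBlocks_toBlocks Q, fromBlocks_conjTranspose, fromBlocks_multiply,
    fromBlocks_multiply]
  simp only [Matrix.zero_mul, add_zero, zero_add, Matrix.mul_zero, conjTranspose_zero]
  rfl

theorem offd_bdiag_conj (m₁ : Matrix (Fin p) (Fin p) ℂ) (m₂ : Matrix (Fin q) (Fin q) ℂ)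
    (ζ : Matrix (Fin p) (Fin q) ℂ) :
    bdiag m₁ m₂ * offd ζ * (bdiag m₁ m₂)ᴴ = offd (m₁ * ζ * m₂ᴴ) := by
  rw [offd, offd, fromBlocks_conjTranspose, fromBlocks_multiply, fromBlocks_multiply]
  simp only [Matrix.zero_mul, add_zero, zero_add, Matrix.mul_zero, conjTranspose_zero,
    conjTranspose_mul, conjTranspose_conjTranspose, Matrix.mul_assoc]

theorem shift_bdiag_conj (m₁ : Matrix (Fin p) (Fin p) ℂ) (m₂ : Matrix (Fin q) (Fin q) ℂ)
    (k : Fin 3) (ζ : Matrix (Fin p) (Fin q) ℂ) (Q : Matrix (Fin p ⊕ Fin q) (Fin p ⊕ Fin q) ℂ) :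
    shift k (m₁ * ζ * m₂ᴴ) (bdiag m₁ m₂ * Q * (bdiag m₁ m₂)ᴴ) =
      bdiag m₁ m₂ * shift k ζ Q * (bdiag m₁ m₂)ᴴ := by
  have h : part k (bdiag m₁ m₂ * Q * (bdiag m₁ m₂)ᴴ) =
      bdiag m₁ m₂ * part k Q * (bdiag m₁ m₂)ᴴ := by
    by_cases hk : k = 2
    · rw [part, if_pos hk, part, if_pos hk, bdiag_conj₁, bdiag_conj₂,
        fromBlocks_conjTranspose, fromBlocks_multiply, fromBlocks_multiply]
      simp
    · rw [part, if_neg hk, part, if_neg hk]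
  rw [shift, shift, h, Matrix.mul_add, Matrix.add_mul]
  split_ifs
  · rw [offd_bdiag_conj]
  · simp

theorem bdiag_det_ne_zero {m₁ : Matrix (Fin p) (Fin p) ℂ} {m₂ : Matrix (Fin q) (Fin q) ℂ}
    (h₁ : m₁.det ≠ 0) (h₂ : m₂.det ≠ 0) : (bdiag m₁ m₂).det ≠ 0 := by
  rw [det_fromBlocks_zero₂₁]; exact mul_ne_zero h₁ h₂

theorem Dom.bdiag_conj {m₁ : Matrix (Fin p) (Fin p) ℂ} {m₂ : Matrix (Fin q) (Fin q) ℂ}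
    (h₁ : m₁.det ≠ 0) (h₂ : m₂.det ≠ 0) {ζ : Matrix (Fin p) (Fin q) ℂ}
    {Q : Matrix (Fin p ⊕ Fin q) (Fin p ⊕ Fin q) ℂ} (h : Dom ζ Q) :
    Dom (m₁ * ζ * m₂ᴴ) (bdiag m₁ m₂ * Q * (bdiag m₁ m₂)ᴴ) := by
  have h0 : (bdiag m₁ m₂)ᴴ.det ≠ 0 := by
    rw [det_conjTranspose]; exact star_ne_zero.2 (bdiag_det_ne_zero h₁ h₂)
  have h3 := posDef_conj h.1 h0
  have h4 := posDef_conj h.2 h0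
  rw [conjTranspose_conjTranspose] at h3 h4
  refine ⟨h3, ?_⟩
  rwa [Matrix.mul_add, Matrix.add_mul, offd_bdiag_conj] at h4

/-! ### The functional is bounded below -/

theorem exists_exp_spectral {m : Type*} [Fintype m] [DecidableEq m] {S : Matrix m m ℂ}
    (hS : S.PosDef) : ∃ u ∈ unitaryGroup m ℂ, ∃ l : m → ℝ,
      S⁻¹ = u * diagonal (fun i => (Real.exp (l i) : ℂ)) * uᴴ ∧
      uᴴ * S * u = diagonal (fun i => (Real.exp (-l i) : ℂ)) ∧
      Real.log S.det.re = -∑ i, l i := by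
  obtain ⟨u, l, hu, h, -, hl⟩ := exists_spectral hS.1
  have hl := hl hS
  have hu1 := unitary_mul_conjTranspose hu
  have hu2 := unitary_conjTranspose_mul hu
  have hexp : ∀ i, Real.exp (-(-Real.log (l i))) = l i := fun i => by
    rw [neg_neg, Real.exp_log (hl i)]
  have hS2 : S = u * diagonal (fun i => (Real.exp (-(-Real.log (l i))) : ℂ)) * uᴴ := by
    simp only [hexp]; exact h
  refine ⟨u, hu, fun i => -Real.log (l i), ?_, ?_, ?_⟩
  · refine inv_eq_right_inv ?_
    rw [hS2]
    calc _ = u * (diagonal (fun i => (Real.exp (-(-Real.log (l i))) : ℂ)) * (uᴴ * u) *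
          diagonal (fun i => (Real.exp (-Real.log (l i)) : ℂ))) * uᴴ := by
          simp only [Matrix.mul_assoc]
      _ = 1 := by
        rw [hu2, Matrix.mul_one, diagonal_mul_diagonal]
        have : ∀ i, (Real.exp (-(-Real.log (l i))) : ℂ) * (Real.exp (-Real.log (l i)) : ℂ) = 1 := by
          intro i
          rw [← Complex.ofReal_mul, ← Real.exp_add]; simp
        simp only [this, diagonal_one, Matrix.mul_one, hu1]
  · calc uᴴ * S * u = (uᴴ * u) * diagonal (fun i => (Real.exp (-(-Real.log (l i))) : ℂ)) *
          (uᴴ * u) := by conv_lhs => rw [hS2]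
                         simp only [Matrix.mul_assoc]
      _ = _ := by rw [hu2, Matrix.one_mul, Matrix.mul_one]
  · have h1 : S.det = ((∏ i, l i : ℝ) : ℂ) := by
      have h2 := congrArg det hu1
      rw [det_mul, det_one] at h2
      rw [h, det_mul, det_mul, det_diagonal, mul_right_comm, h2, one_mul]
      push_cast; rfl
    rw [h1, Complex.ofReal_re, Real.log_prod fun i _ => (hl i).ne']
    simp

theorem Dom.entry_bound {ζ : Matrix (Fin p) (Fin q) ℂ}
    {Q : Matrix (Fin p ⊕ Fin q) (Fin p ⊕ Fin q) ℂ} (h : Dom ζ Q) (i : Fin p) (j : Fin q) :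
    ‖ζ i j‖ ≤ 2 * Real.sqrt ((Q (.inl i) (.inl i)).re * (Q (.inr j) (.inr j)).re) := by
  have h1 := Real.le_sqrt_of_sq_le (norm_sq_le_of_posSemidef h.1.posSemidef (.inl i) (.inr j))
  have h2 := Real.le_sqrt_of_sq_le (norm_sq_le_of_posSemidef h.2.posSemidef (.inl i) (.inr j))
  have e1 : (Q + offd ζ) (.inl i) (.inl i) = Q (.inl i) (.inl i) := by simp [offd]
  have e2 : (Q + offd ζ) (.inr j) (.inr j) = Q (.inr j) (.inr j) := by simp [offd]
  have e3 : (Q + offd ζ) (.inl i) (.inr j) = Q (.inl i) (.inr j) + ζ i j := by simp [offd]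
  rw [e1, e2, e3] at h2
  have h3 : ζ i j = (Q (.inl i) (.inr j) + ζ i j) - Q (.inl i) (.inr j) := by ring
  rw [h3]
  refine (norm_sub_le _ _).trans ?_
  linarith

theorem blk_inv_sub {M : Matrix (Fin p ⊕ Fin q) (Fin p ⊕ Fin q) ℂ} (hM : M.PosDef) :
    (blk₁ M⁻¹ - (blk₁ M)⁻¹).PosSemidef ∧ (blk₂ M⁻¹ - (blk₂ M)⁻¹).PosSemidef :=
  ⟨inv_submatrix_sub_posSemidef hM Sum.inl_injective,
    inv_submatrix_sub_posSemidef hM Sum.inr_injective⟩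

theorem conj_sub_posSemidef {m n : Type*} [Fintype m] [Fintype n] {S T : Matrix m m ℂ}
    (h : (T - S).PosSemidef) (G : Matrix m n ℂ) : (Gᴴ * T * G - Gᴴ * S * G).PosSemidef := by
  have := h.conjTranspose_mul_mul_same G
  rwa [Matrix.mul_sub, Matrix.sub_mul] at this

theorem log_det_conj {m : Type*} [Fintype m] [DecidableEq m] {S G : Matrix m m ℂ}
    (hS : S.PosDef) (hG : G.det ≠ 0) :
    Real.log (Gᴴ * S * G).det.re = Real.log S.det.re + Real.log (‖G.det‖ ^ 2) := by
  rw [← Real.log_mul (posDef_det_re_pos hS).ne' (pow_ne_zero _ (norm_ne_zero_iff.2 hG))]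
  congr 1
  rw [det_mul, det_mul, det_conjTranspose, mul_right_comm, RCLike.star_def, Complex.conj_mul',
    posDef_det_eq hS, ← Complex.ofReal_pow, ← Complex.ofReal_mul, Complex.ofReal_re,
    Complex.ofReal_re]
  ring

theorem Semi.exists_psi_bound {ζ : Matrix (Fin p) (Fin q) ℂ}
    {G : Fin 3 → Matrix (Fin p) (Fin p) ℂ} {F : Fin 3 → Matrix (Fin q) (Fin q) ℂ}
    {w₁ : Fin 3 → Fin p → ℝ} {w₂ : Fin 3 → Fin q → ℝ} {Γ κ : ℝ}
    (h : Semi ζ G F w₁ w₂ Γ κ) (hw₁ : ∀ k i, 0 ≤ drop (w₁ k) i)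
    (hw₂ : ∀ k i, 0 ≤ drop (w₂ k) i) (hG : ∀ k, (G k).det ≠ 0) (hF : ∀ k, (F k).det ≠ 0)
    (hκ₁ : ∑ k, ∑ j, w₁ k j - Γ * p = κ) (hκ₂ : ∑ k, ∑ j, w₂ k j - Γ * q = κ)
    (i : Fin q) (hi : (i : ℕ) + 1 = q) :
    ∃ C : ℝ, ∀ Q, Dom ζ Q → C ≤ psi w₁ w₂ Γ ζ G (fun k => (F k).map star) Q ∧
      ∀ k, C + w₂ k i * (Real.log (blk₁ Q).det.re + Real.log (blk₂ Q).det.re -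
        Real.log (shift k ζ Q).det.re) ≤ psi w₁ w₂ Γ ζ G (fun k => (F k).map star) Q := by
  obtain ⟨C, hC⟩ := h.exists_lower_bound hw₁ hw₂ hG hF hκ₁ hκ₂
  refine ⟨C, fun Q hQ => ?_⟩
  have hb₁ : (blk₁ Q).PosDef := hQ.1.submatrix Sum.inl_injective
  have hb₂ : (blk₂ Q).PosDef := hQ.1.submatrix Sum.inr_injective
  obtain ⟨u, hu, l, hu1, hu2, hu3⟩ := exists_exp_spectral hb₁
  obtain ⟨v, hv, m, hv1, hv2, hv3⟩ := exists_exp_spectral hb₂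
  have hvs : v.map star ∈ unitaryGroup (Fin q) ℂ := by
    rw [mem_unitaryGroup_iff, star_eq_conjTranspose]
    have := congrArg (fun M => M.map star) (unitary_mul_conjTranspose hv)
    simp only [map_star_mul] at this
    have e : (1 : Matrix (Fin q) (Fin q) ℂ).map star = 1 := by
      ext a b; by_cases hab : a = b <;> simp [Matrix.one_apply, hab]
    rw [e] at this
    exact this
  have key := hC u hu (v.map star) hvs l m ?_
  swap
  · intro a b
    have hdu : uᴴ.det ≠ 0 := by
      have := congrArg det (unitary_conjTranspose_mul hu)
      rw [det_mul, det_one] at this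
      exact left_ne_zero_of_mul_eq_one this
    have hdv : vᴴ.det ≠ 0 := by
      have := congrArg det (unitary_conjTranspose_mul hv)
      rw [det_mul, det_one] at this
      exact left_ne_zero_of_mul_eq_one this
    have hD := hQ.bdiag_conj hdu hdv
    have hB := hD.entry_bound a b
    have e1 : (bdiag uᴴ vᴴ * Q * (bdiag uᴴ vᴴ)ᴴ) (.inl a) (.inl a) = (Real.exp (-l a) : ℂ) := by
      have := congrFun (congrFun (bdiag_conj₁ uᴴ vᴴ Q) a) a
      rw [conjTranspose_conjTranspose, hu2, diagonal_apply_eq] at this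
      exact this
    have e2 : (bdiag uᴴ vᴴ * Q * (bdiag uᴴ vᴴ)ᴴ) (.inr b) (.inr b) = (Real.exp (-m b) : ℂ) := by
      have := congrFun (congrFun (bdiag_conj₂ uᴴ vᴴ Q) b) b
      rw [conjTranspose_conjTranspose, hv2, diagonal_apply_eq] at this
      exact this
    rw [e1, e2, Complex.ofReal_re, Complex.ofReal_re, ← Real.exp_add] at hB
    have e3 : ((v.map star)ᴴ)ᵀ = vᴴᴴ := by ext; simp
    rw [e3]
    have e4 : Real.sqrt (Real.exp (-l a + -m b)) = Real.exp (-((l a + m b) / 2)) := by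
      rw [Real.sqrt_eq_iff_mul_self_eq (Real.exp_pos _).le (Real.exp_pos _).le, ← Real.exp_add]
      congr 1; ring
    rw [e4] at hB
    calc _ ≤ 2 * Real.exp (-((l a + m b) / 2)) * Real.exp ((l a + m b) / 2) :=
          mul_le_mul_of_nonneg_right hB (Real.exp_pos _).le
      _ = 2 := by rw [mul_assoc, ← Real.exp_add]; simp
  have hF' : ∀ k, ((F k).map star).det ≠ 0 := fun k => by
    have : ((F k).map star).det = star (F k).det := by
      rw [← det_conjTranspose, ← det_transpose]; rfl
    rw [this]; exact star_ne_zero.2 (hF k)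
  have t1 : ∀ k, lw (w₁ k) ((G k)ᴴ * (u * diagonal (fun t => (Real.exp (l t) : ℂ)) * uᴴ) * G k) ≤
      lw (w₁ k) ((G k)ᴴ * blk₁ (shift k ζ Q)⁻¹ * G k) := fun k => by
    rw [← hu1]
    refine lw_mono (hw₁ k) (posDef_conj hb₁.inv (hG k)) (conj_sub_posSemidef ?_ _)
    have := (blk_inv_sub (hQ.posDef k)).1
    rwa [blk₁_shift] at this
  have t2e : ∀ k, lw (w₂ k) ((F k)ᴴ *
      (v.map star * diagonal (fun t => (Real.exp (m t) : ℂ)) * (v.map star)ᴴ) * F k) =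
      lw (w₂ k) (((F k).map star)ᴴ * (blk₂ Q)⁻¹ * (F k).map star) := fun k => by
    rw [← lw_map_star, hv1]
    congr 1
    have e : (diagonal (fun t => (Real.exp (m t) : ℂ))).map star =
        diagonal (fun t => (Real.exp (m t) : ℂ)) := by
      ext a b
      by_cases hab : a = b
      · subst hab; simp [-Complex.ofReal_exp, Complex.conj_ofReal]
      · simp [hab]
    have e' : ∀ M : Matrix (Fin q) (Fin q) ℂ, Mᴴ.map star = (M.map star)ᴴ := fun M => rfl
    simp only [map_star_mul, e, e', map_star_map_star]
  have hps : ∀ k, (((F k).map star)ᴴ * blk₂ (shift k ζ Q)⁻¹ * (F k).map star -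
      ((F k).map star)ᴴ * (blk₂ Q)⁻¹ * (F k).map star).PosSemidef := fun k => by
    refine conj_sub_posSemidef ?_ _
    have := (blk_inv_sub (hQ.posDef k)).2
    rwa [blk₂_shift] at this
  have t2 : ∀ k, lw (w₂ k) (((F k).map star)ᴴ * (blk₂ Q)⁻¹ * (F k).map star) ≤
      lw (w₂ k) (((F k).map star)ᴴ * blk₂ (shift k ζ Q)⁻¹ * (F k).map star) := fun k =>
    lw_mono (hw₂ k) (posDef_conj hb₂.inv (hF' k)) (hps k)
  have t3 : ∀ k, lw (w₂ k) (((F k).map star)ᴴ * (blk₂ Q)⁻¹ * (F k).map star) +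
      w₂ k i * (Real.log (blk₁ Q).det.re + Real.log (blk₂ Q).det.re -
        Real.log (shift k ζ Q).det.re) ≤
      lw (w₂ k) (((F k).map star)ᴴ * blk₂ (shift k ζ Q)⁻¹ * (F k).map star) := fun k => by
    have hM := hQ.posDef k
    have hMi : (blk₂ (shift k ζ Q)⁻¹).PosDef := hM.inv.submatrix Sum.inr_injective
    have := lw_add_log_det_le (hw₂ k) i hi (posDef_conj hb₂.inv (hF' k)) (hps k)
    rw [log_det_conj hMi (hF' k), log_det_conj hb₂.inv (hF' k)] at this
    have hd : (shift k ζ Q).det * (blk₂ (shift k ζ Q)⁻¹).det = (blk₁ (shift k ζ Q)).det :=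
      det_mul_det_inv_submatrix_inr hM
    rw [blk₁_shift, posDef_det_eq hM, posDef_det_eq hMi, ← Complex.ofReal_mul] at hd
    have hd' := congrArg Complex.re hd
    rw [Complex.ofReal_re] at hd'
    have hl1 : Real.log (blk₁ Q).det.re = Real.log (shift k ζ Q).det.re +
        Real.log (blk₂ (shift k ζ Q)⁻¹).det.re := by
      rw [← hd', Real.log_mul (posDef_det_re_pos hM).ne' (posDef_det_re_pos hMi).ne']
    have hl2 : Real.log (blk₂ Q)⁻¹.det.re = -Real.log (blk₂ Q).det.re := by
      rw [det_nonsing_inv, Ring.inverse_eq_inv', posDef_det_eq hb₂, ← Complex.ofReal_inv,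
        Complex.ofReal_re, Complex.ofReal_re, Real.log_inv]
    rw [hl2] at this
    have e : Real.log (blk₁ Q).det.re + Real.log (blk₂ Q).det.re - Real.log (shift k ζ Q).det.re =
        Real.log (blk₂ (shift k ζ Q)⁻¹).det.re + Real.log (‖((F k).map star).det‖ ^ 2) -
        (-Real.log (blk₂ Q).det.re + Real.log (‖((F k).map star).det‖ ^ 2)) := by
      rw [hl1]; ring
    rwa [e]
  simp only [t2e] at key
  have s1 := Finset.sum_le_sum fun k (_ : k ∈ Finset.univ) => t1 k
  have hpsi : psi w₁ w₂ Γ ζ G (fun k => (F k).map star) Q =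
    ∑ k, lw (w₁ k) ((G k)ᴴ * blk₁ (shift k ζ Q)⁻¹ * G k) +
    ∑ k, lw (w₂ k) (((F k).map star)ᴴ * blk₂ (shift k ζ Q)⁻¹ * (F k).map star) -
    Γ * ∑ i, l i - Γ * ∑ j, m j := by
    rw [psi, hu3, hv3]; ring
  rw [hpsi]
  refine ⟨?_, fun k => ?_⟩
  · have s2 := Finset.sum_le_sum fun k (_ : k ∈ Finset.univ) => t2 k
    linarith
  · rw [← Finset.add_sum_erase _ (fun k => lw (w₂ k) (((F k).map star)ᴴ * blk₂ (shift k ζ Q)⁻¹ *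
      (F k).map star)) (Finset.mem_univ k)]
    rw [← Finset.add_sum_erase _ (fun k => lw (w₂ k) (((F k).map star)ᴴ * (blk₂ Q)⁻¹ *
      (F k).map star)) (Finset.mem_univ k)] at key
    have s2 := Finset.sum_le_sum fun j (_ : j ∈ Finset.univ.erase k) => t2 j
    have := t3 k
    linarith

/-! ### Equivariance and normalization of the functional -/

theorem bdiag_conjTranspose (m₁ : Matrix (Fin p) (Fin p) ℂ) (m₂ : Matrix (Fin q) (Fin q) ℂ) :
    (bdiag m₁ m₂)ᴴ = bdiag m₁ᴴ m₂ᴴ := by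
  simp [fromBlocks_conjTranspose]

theorem bdiag_conj_inv {m₁ : Matrix (Fin p) (Fin p) ℂ} {m₂ : Matrix (Fin q) (Fin q) ℂ}
    (h₁ : m₁.det ≠ 0) (h₂ : m₂.det ≠ 0) (M : Matrix (Fin p ⊕ Fin q) (Fin p ⊕ Fin q) ℂ) :
    m₁ᴴ * blk₁ (bdiag m₁ m₂ * M * (bdiag m₁ m₂)ᴴ)⁻¹ * m₁ = blk₁ M⁻¹ ∧
    m₂ᴴ * blk₂ (bdiag m₁ m₂ * M * (bdiag m₁ m₂)ᴴ)⁻¹ * m₂ = blk₂ M⁻¹ := by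
  have h0 := bdiag_det_ne_zero h₁ h₂
  have h0' : (bdiag m₁ m₂)ᴴ.det ≠ 0 := by
    rw [det_conjTranspose]; exact star_ne_zero.2 h0
  have h : bdiag m₁ᴴ m₂ᴴ * (bdiag m₁ m₂ * M * (bdiag m₁ m₂)ᴴ)⁻¹ * (bdiag m₁ᴴ m₂ᴴ)ᴴ = M⁻¹ := by
    rw [← bdiag_conjTranspose, conjTranspose_conjTranspose, Matrix.mul_inv_rev,
      Matrix.mul_inv_rev, mul_nonsing_inv_cancel_left _ _ (isUnit_iff_ne_zero.2 h0'),
      nonsing_inv_mul_cancel_right _ _ (isUnit_iff_ne_zero.2 h0)]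
  constructor
  · rw [← h, bdiag_conj₁, conjTranspose_conjTranspose]
  · rw [← h, bdiag_conj₂, conjTranspose_conjTranspose]

theorem log_det_conj' {m : Type*} [Fintype m] [DecidableEq m] {S G : Matrix m m ℂ}
    (hS : S.PosDef) (hG : G.det ≠ 0) :
    Real.log (G * S * Gᴴ).det.re = Real.log S.det.re + Real.log (‖G.det‖ ^ 2) := by
  have h := log_det_conj (G := Gᴴ) hS (by rw [det_conjTranspose]; exact star_ne_zero.2 hG)
  rwa [conjTranspose_conjTranspose, det_conjTranspose, norm_star] at h

theorem psi_bdiag_conj (w₁ : Fin 3 → Fin p → ℝ) (w₂ : Fin 3 → Fin q → ℝ) (Γ : ℝ)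
    {ζ : Matrix (Fin p) (Fin q) ℂ}
    {G T₁ : Fin 3 → Matrix (Fin p) (Fin p) ℂ} {V T₂ : Fin 3 → Matrix (Fin q) (Fin q) ℂ}
    (hG : ∀ k, (G k).det ≠ 0) (hV : ∀ k, (V k).det ≠ 0)
    (hT₁ : ∀ k i j, j < i → T₁ k i j = 0) (hT₁' : ∀ k, (T₁ k).det ≠ 0)
    (hT₂ : ∀ k i j, j < i → T₂ k i j = 0) (hT₂' : ∀ k, (T₂ k).det ≠ 0)
    {m₁ : Matrix (Fin p) (Fin p) ℂ} {m₂ : Matrix (Fin q) (Fin q) ℂ}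
    (h₁ : m₁.det ≠ 0) (h₂ : m₂.det ≠ 0) {Q : Matrix (Fin p ⊕ Fin q) (Fin p ⊕ Fin q) ℂ}
    (hQ : Dom ζ Q) :
    psi w₁ w₂ Γ (m₁ * ζ * m₂ᴴ) (fun k => m₁ * G k * T₁ k) (fun k => m₂ * V k * T₂ k)
      (bdiag m₁ m₂ * Q * (bdiag m₁ m₂)ᴴ) = psi w₁ w₂ Γ ζ G V Q +
      (∑ k, lw (w₁ k) ((T₁ k)ᴴ * T₁ k) + ∑ k, lw (w₂ k) ((T₂ k)ᴴ * T₂ k) +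
        Γ * Real.log (‖m₁.det‖ ^ 2) + Γ * Real.log (‖m₂.det‖ ^ 2)) := by
  have hb₁ : (blk₁ Q).PosDef := hQ.1.submatrix Sum.inl_injective
  have hb₂ : (blk₂ Q).PosDef := hQ.1.submatrix Sum.inr_injective
  have e₁ : ∀ k, lw (w₁ k) ((m₁ * G k * T₁ k)ᴴ * blk₁ (shift k (m₁ * ζ * m₂ᴴ)
      (bdiag m₁ m₂ * Q * (bdiag m₁ m₂)ᴴ))⁻¹ * (m₁ * G k * T₁ k)) =
      lw (w₁ k) ((G k)ᴴ * blk₁ (shift k ζ Q)⁻¹ * G k) + lw (w₁ k) ((T₁ k)ᴴ * T₁ k) := fun k => by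
    have hp : (blk₁ (shift k ζ Q)⁻¹).PosDef := (hQ.posDef k).inv.submatrix Sum.inl_injective
    rw [← lw_conj_of_triangular _ (hT₁ k) (hT₁' k) (posDef_conj hp (hG k)),
      shift_bdiag_conj, ← (bdiag_conj_inv h₁ h₂ (shift k ζ Q)).1]
    simp only [conjTranspose_mul, Matrix.mul_assoc]
  have e₂ : ∀ k, lw (w₂ k) ((m₂ * V k * T₂ k)ᴴ * blk₂ (shift k (m₁ * ζ * m₂ᴴ)
      (bdiag m₁ m₂ * Q * (bdiag m₁ m₂)ᴴ))⁻¹ * (m₂ * V k * T₂ k)) =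
      lw (w₂ k) ((V k)ᴴ * blk₂ (shift k ζ Q)⁻¹ * V k) + lw (w₂ k) ((T₂ k)ᴴ * T₂ k) := fun k => by
    have hp : (blk₂ (shift k ζ Q)⁻¹).PosDef := (hQ.posDef k).inv.submatrix Sum.inr_injective
    rw [← lw_conj_of_triangular _ (hT₂ k) (hT₂' k) (posDef_conj hp (hV k)),
      shift_bdiag_conj, ← (bdiag_conj_inv h₁ h₂ (shift k ζ Q)).2]
    simp only [conjTranspose_mul, Matrix.mul_assoc]
  rw [psi, psi, Finset.sum_congr rfl fun k _ => e₁ k, Finset.sum_congr rfl fun k _ => e₂ k,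
    bdiag_conj₁, bdiag_conj₂, log_det_conj' hb₁ h₁, log_det_conj' hb₂ h₂,
    Finset.sum_add_distrib, Finset.sum_add_distrib]
  ring

theorem lw_one (w : Fin p → ℝ) : lw w 1 = 0 := by
  refine Finset.sum_eq_zero fun i _ => ?_
  rw [submatrix_one _ Subtype.val_injective]
  simp

theorem psi_eq_zero {w₁ : Fin 3 → Fin p → ℝ} {w₂ : Fin 3 → Fin q → ℝ} {Γ : ℝ}
    {ζ : Matrix (Fin p) (Fin q) ℂ} {P : Matrix (Fin p ⊕ Fin q) (Fin p ⊕ Fin q) ℂ}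
    {U : Fin 3 → Matrix (Fin p) (Fin p) ℂ} {V : Fin 3 → Matrix (Fin q) (Fin q) ℂ}
    (h₁ : blk₁ P = 1) (h₂ : blk₂ P = 1)
    (hU : ∀ k, (U k)ᴴ * blk₁ (shift k ζ P)⁻¹ * U k = 1)
    (hV : ∀ k, (V k)ᴴ * blk₂ (shift k ζ P)⁻¹ * V k = 1) : psi w₁ w₂ Γ ζ U V P = 0 := by
  simp [psi, h₁, h₂, hU, hV, lw_one]

theorem exists_normalized {w₁ : Fin 3 → Fin p → ℝ} {w₂ : Fin 3 → Fin q → ℝ} {Γ : ℝ}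
    {ζ : Matrix (Fin p) (Fin q) ℂ} {G : Fin 3 → Matrix (Fin p) (Fin p) ℂ}
    {V : Fin 3 → Matrix (Fin q) (Fin q) ℂ}
    (hG : ∀ k, (G k).det ≠ 0) (hV : ∀ k, (V k).det ≠ 0)
    {Q₀ : Matrix (Fin p ⊕ Fin q) (Fin p ⊕ Fin q) ℂ} (hQ₀ : Dom ζ Q₀) :
    ∃ (ζ' : Matrix (Fin p) (Fin q) ℂ) (P : Matrix (Fin p ⊕ Fin q) (Fin p ⊕ Fin q) ℂ)
      (U₁ : Fin 3 → Matrix (Fin p) (Fin p) ℂ) (U₂ : Fin 3 → Matrix (Fin q) (Fin q) ℂ),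
      Dom ζ' P ∧ blk₁ P = 1 ∧ blk₂ P = 1 ∧
      (∀ k, (U₁ k)ᴴ * blk₁ (shift k ζ' P)⁻¹ * U₁ k = 1) ∧
      (∀ k, (U₂ k)ᴴ * blk₂ (shift k ζ' P)⁻¹ * U₂ k = 1) ∧
      (∀ k, Real.log (shift k ζ' P).det.re = Real.log (shift k ζ Q₀).det.re -
        (Real.log (blk₁ Q₀).det.re + Real.log (blk₂ Q₀).det.re)) ∧
      ∀ Q', Dom ζ' Q' → ∃ Q, Dom ζ Q ∧
        psi w₁ w₂ Γ ζ' U₁ U₂ Q' = psi w₁ w₂ Γ ζ G V Q - psi w₁ w₂ Γ ζ G V Q₀ := by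
  have hb₁ : (blk₁ Q₀).PosDef := hQ₀.1.submatrix Sum.inl_injective
  have hb₂ : (blk₂ Q₀).PosDef := hQ₀.1.submatrix Sum.inr_injective
  obtain ⟨m₁, h₁, e₁⟩ : ∃ m : Matrix (Fin p) (Fin p) ℂ, m.det ≠ 0 ∧ m * blk₁ Q₀ * mᴴ = 1 := by
    obtain ⟨T, -, hT, h⟩ := exists_triangular hb₁
    exact ⟨Tᴴ, by rw [det_conjTranspose]; exact star_ne_zero.2 hT, by
      rwa [conjTranspose_conjTranspose]⟩
  obtain ⟨m₂, h₂, e₂⟩ : ∃ m : Matrix (Fin q) (Fin q) ℂ, m.det ≠ 0 ∧ m * blk₂ Q₀ * mᴴ = 1 := by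
    obtain ⟨T, -, hT, h⟩ := exists_triangular hb₂
    exact ⟨Tᴴ, by rw [det_conjTranspose]; exact star_ne_zero.2 hT, by
      rwa [conjTranspose_conjTranspose]⟩
  have hT₁ : ∀ k, ∃ T : Matrix (Fin p) (Fin p) ℂ, (∀ i j, j < i → T i j = 0) ∧ T.det ≠ 0 ∧
      Tᴴ * ((G k)ᴴ * blk₁ (shift k ζ Q₀)⁻¹ * G k) * T = 1 := fun k =>
    exists_triangular (posDef_conj ((hQ₀.posDef k).inv.submatrix Sum.inl_injective) (hG k))
  have hT₂ : ∀ k, ∃ T : Matrix (Fin q) (Fin q) ℂ, (∀ i j, j < i → T i j = 0) ∧ T.det ≠ 0 ∧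
      Tᴴ * ((V k)ᴴ * blk₂ (shift k ζ Q₀)⁻¹ * V k) * T = 1 := fun k =>
    exists_triangular (posDef_conj ((hQ₀.posDef k).inv.submatrix Sum.inr_injective) (hV k))
  choose T₁ hT₁ hT₁' hT₁'' using hT₁
  choose T₂ hT₂ hT₂' hT₂'' using hT₂
  have hU₁ : ∀ k, (m₁ * G k * T₁ k)ᴴ * blk₁ (shift k (m₁ * ζ * m₂ᴴ)
      (bdiag m₁ m₂ * Q₀ * (bdiag m₁ m₂)ᴴ))⁻¹ * (m₁ * G k * T₁ k) = 1 := fun k => by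
    rw [← hT₁'' k, shift_bdiag_conj, ← (bdiag_conj_inv h₁ h₂ (shift k ζ Q₀)).1]
    simp only [conjTranspose_mul, Matrix.mul_assoc]
  have hU₂ : ∀ k, (m₂ * V k * T₂ k)ᴴ * blk₂ (shift k (m₁ * ζ * m₂ᴴ)
      (bdiag m₁ m₂ * Q₀ * (bdiag m₁ m₂)ᴴ))⁻¹ * (m₂ * V k * T₂ k) = 1 := fun k => by
    rw [← hT₂'' k, shift_bdiag_conj, ← (bdiag_conj_inv h₁ h₂ (shift k ζ Q₀)).2]
    simp only [conjTranspose_mul, Matrix.mul_assoc]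
  have hP₁ : blk₁ (bdiag m₁ m₂ * Q₀ * (bdiag m₁ m₂)ᴴ) = 1 := by rw [bdiag_conj₁, e₁]
  have hP₂ : blk₂ (bdiag m₁ m₂ * Q₀ * (bdiag m₁ m₂)ᴴ) = 1 := by rw [bdiag_conj₂, e₂]
  refine ⟨m₁ * ζ * m₂ᴴ, bdiag m₁ m₂ * Q₀ * (bdiag m₁ m₂)ᴴ, fun k => m₁ * G k * T₁ k,
    fun k => m₂ * V k * T₂ k, hQ₀.bdiag_conj h₁ h₂, hP₁, hP₂, hU₁, hU₂, fun k => ?_,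
    fun Q' hQ' => ?_⟩
  · have l₁ := log_det_conj' hb₁ h₁
    have l₂ := log_det_conj' hb₂ h₂
    rw [e₁, det_one, Complex.one_re, Real.log_one] at l₁
    rw [e₂, det_one, Complex.one_re, Real.log_one] at l₂
    rw [shift_bdiag_conj, log_det_conj' (hQ₀.posDef k) (bdiag_det_ne_zero h₁ h₂),
      det_fromBlocks_zero₂₁, norm_mul, mul_pow,
      Real.log_mul (pow_ne_zero _ (norm_ne_zero_iff.2 h₁)) (pow_ne_zero _ (norm_ne_zero_iff.2 h₂))]
    linarith
  · have i₁ : m₁⁻¹.det ≠ 0 := by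
      rw [det_nonsing_inv, Ring.inverse_eq_inv']; exact inv_ne_zero h₁
    have i₂ : m₂⁻¹.det ≠ 0 := by
      rw [det_nonsing_inv, Ring.inverse_eq_inv']; exact inv_ne_zero h₂
    have c₁ : m₁ * m₁⁻¹ = 1 := mul_nonsing_inv _ (isUnit_iff_ne_zero.2 h₁)
    have c₂ : m₂ * m₂⁻¹ = 1 := mul_nonsing_inv _ (isUnit_iff_ne_zero.2 h₂)
    have c₁' : m₁⁻¹ * m₁ = 1 := nonsing_inv_mul _ (isUnit_iff_ne_zero.2 h₁)
    have c₂' : m₂⁻¹ * m₂ = 1 := nonsing_inv_mul _ (isUnit_iff_ne_zero.2 h₂)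
    have hD := hQ'.bdiag_conj i₁ i₂
    have hζ : m₁⁻¹ * (m₁ * ζ * m₂ᴴ) * m₂⁻¹ᴴ = ζ := by
      calc _ = (m₁⁻¹ * m₁) * ζ * (m₂⁻¹ * m₂)ᴴ := by
            simp only [conjTranspose_mul, Matrix.mul_assoc]
        _ = ζ := by rw [c₁', c₂']; simp
    rw [hζ] at hD
    have hb : bdiag m₁ m₂ * bdiag m₁⁻¹ m₂⁻¹ = 1 := by
      rw [fromBlocks_multiply]; simp [c₁, c₂, fromBlocks_one]
    have hQe : bdiag m₁ m₂ * (bdiag m₁⁻¹ m₂⁻¹ * Q' * (bdiag m₁⁻¹ m₂⁻¹)ᴴ) * (bdiag m₁ m₂)ᴴ = Q' := by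
      calc _ = (bdiag m₁ m₂ * bdiag m₁⁻¹ m₂⁻¹) * Q' * (bdiag m₁ m₂ * bdiag m₁⁻¹ m₂⁻¹)ᴴ := by
            rw [conjTranspose_mul]; simp only [Matrix.mul_assoc]
        _ = Q' := by rw [hb]; simp
    refine ⟨_, hD, ?_⟩
    have k1 := psi_bdiag_conj w₁ w₂ Γ hG hV hT₁ hT₁' hT₂ hT₂' h₁ h₂ hD
    have k2 := psi_bdiag_conj w₁ w₂ Γ hG hV hT₁ hT₁' hT₂ hT₂' h₁ h₂ hQ₀
    rw [hQe] at k1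
    rw [psi_eq_zero hP₁ hP₂ hU₁ hU₂] at k2
    rw [k1]
    linarith

/-! ### Existence of a normalized minimizer -/

theorem exists_dom (ζ : Matrix (Fin p) (Fin q) ℂ) : ∃ Q, Dom ζ Q := by
  have hL : (fromBlocks (1 : Matrix (Fin p) (Fin p) ℂ) ζ 0
      (1 : Matrix (Fin q) (Fin q) ℂ)).det ≠ 0 := by
    rw [det_fromBlocks_zero₂₁]; simp
  have h := posDef_conj (PosDef.one (R := ℂ)) hL
  rw [Matrix.mul_one, fromBlocks_conjTranspose, fromBlocks_multiply] at h
  simp only [conjTranspose_one, conjTranspose_zero, Matrix.one_mul, Matrix.mul_one,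
    Matrix.mul_zero, add_zero] at h
  refine ⟨_, posDef_part_two h, ?_⟩
  convert h using 1
  rw [part, if_pos rfl, offd, fromBlocks_add]
  congr 1 <;> ext <;> simp

theorem tendsto_inv_of_det_ne_zero {X m : Type*} [Fintype m] [DecidableEq m] {𝓕 : Filter X}
    {f : X → Matrix m m ℂ} {M : Matrix m m ℂ} (hf : Filter.Tendsto f 𝓕 (nhds M))
    (hM : M.det ≠ 0) : Filter.Tendsto (fun x => (f x)⁻¹) 𝓕 (nhds M⁻¹) := by
  have hd : Filter.Tendsto (fun x => (f x).det) 𝓕 (nhds M.det) :=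
    ((continuous_id.matrix_det).tendsto M).comp hf
  have ha : Filter.Tendsto (fun x => (f x).adjugate) 𝓕 (nhds M.adjugate) :=
    ((continuous_id.matrix_adjugate).tendsto M).comp hf
  simp only [Matrix.inv_def, Ring.inverse_eq_inv']
  exact (hd.inv₀ hM).smul ha

theorem tendsto_lw {X : Type*} {𝓕 : Filter X} (w : Fin p → ℝ)
    {f : X → Matrix (Fin p) (Fin p) ℂ} {S : Matrix (Fin p) (Fin p) ℂ}
    (hf : Filter.Tendsto f 𝓕 (nhds S)) (hS : S.PosDef) :
    Filter.Tendsto (fun x => lw w (f x)) 𝓕 (nhds (lw w S)) := by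
  refine tendsto_finsetSum _ fun i _ => Filter.Tendsto.const_mul _ ?_
  have hc : Continuous fun M : Matrix (Fin p) (Fin p) ℂ => (lead M i).det.re :=
    Complex.continuous_re.comp ((continuous_id.matrix_submatrix _ _).matrix_det)
  have : Filter.Tendsto (fun x => (lead (f x) i).det.re) 𝓕 (nhds (lead S i).det.re) :=
    (hc.tendsto S).comp hf
  exact this.log (posDef_det_re_pos (posDef_lead hS i)).ne'

theorem posSemidef_of_tendsto {X m : Type*} [Fintype m] {𝓕 : Filter X} [𝓕.NeBot]
    {f : X → Matrix m m ℂ} {M : Matrix m m ℂ} (hf : Filter.Tendsto f 𝓕 (nhds M))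
    (h : ∀ x, (f x).PosSemidef) : M.PosSemidef := by
  refine PosSemidef.of_dotProduct_mulVec_nonneg ?_ fun x => ?_
  · have h1 : Filter.Tendsto (fun x => (f x)ᴴ) 𝓕 (nhds Mᴴ) :=
      ((continuous_id.matrix_conjTranspose).tendsto M).comp hf
    have h2 : (fun x => (f x)ᴴ) = f := funext fun x => (h x).1
    rw [h2] at h1
    exact tendsto_nhds_unique h1 hf
  · have hc : Continuous fun N : Matrix m m ℂ => star x ⬝ᵥ (N *ᵥ x) :=
      continuous_const.dotProduct (continuous_id.matrix_mulVec continuous_const)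
    have h1 : Filter.Tendsto (fun y => star x ⬝ᵥ (f y *ᵥ x)) 𝓕 (nhds (star x ⬝ᵥ (M *ᵥ x))) :=
      (hc.tendsto M).comp hf
    exact ge_of_tendsto h1 (Filter.Eventually.of_forall fun y => (h y).dotProduct_mulVec_nonneg x)

theorem continuous_offd : Continuous (offd : Matrix (Fin p) (Fin q) ℂ → _) :=
  continuous_const.matrix_fromBlocks continuous_id continuous_id.matrix_conjTranspose
    continuous_const

theorem continuous_part (k : Fin 3) :
    Continuous (part k : Matrix (Fin p ⊕ Fin q) (Fin p ⊕ Fin q) ℂ → _) := by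
  by_cases hk : k = 2
  · simp only [funext fun Q => (show part k Q = _ from if_pos hk)]
    exact (continuous_id.matrix_submatrix _ _).matrix_fromBlocks continuous_const
      continuous_const (continuous_id.matrix_submatrix _ _)
  · simp only [funext fun Q => (show part k Q = _ from if_neg hk)]
    exact continuous_id

theorem continuous_shift (k : Fin 3) :
    Continuous fun z : Matrix (Fin p) (Fin q) ℂ × Matrix (Fin p ⊕ Fin q) (Fin p ⊕ Fin q) ℂ =>
      shift k z.1 z.2 := by
  refine ((continuous_part k).comp continuous_snd).add ?_
  split_ifs
  · exact continuous_offd.comp continuous_fst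
  · exact continuous_const

theorem tendsto_of_continuous₂ {X Y Z W : Type*} [TopologicalSpace Y] [TopologicalSpace Z]
    [TopologicalSpace W] {𝓕 : Filter X} (f : Y → Z → W) (hf : Continuous fun z : Y × Z => f z.1 z.2)
    {S : X → Y} {T : X → Z} {S₀ : Y} {T₀ : Z} (hS : Filter.Tendsto S 𝓕 (nhds S₀))
    (hT : Filter.Tendsto T 𝓕 (nhds T₀)) :
    Filter.Tendsto (fun x => f (S x) (T x)) 𝓕 (nhds (f S₀ T₀)) :=
  (hf.tendsto (S₀, T₀)).comp (hS.prodMk_nhds hT)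

theorem tendsto_shift {X : Type*} {𝓕 : Filter X} (k : Fin 3)
    {ζ : X → Matrix (Fin p) (Fin q) ℂ} {Q : X → Matrix (Fin p ⊕ Fin q) (Fin p ⊕ Fin q) ℂ}
    {ζ₀ : Matrix (Fin p) (Fin q) ℂ} {Q₀ : Matrix (Fin p ⊕ Fin q) (Fin p ⊕ Fin q) ℂ}
    (hζ : Filter.Tendsto ζ 𝓕 (nhds ζ₀)) (hQ : Filter.Tendsto Q 𝓕 (nhds Q₀)) :
    Filter.Tendsto (fun x => shift k (ζ x) (Q x)) 𝓕 (nhds (shift k ζ₀ Q₀)) :=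
  tendsto_of_continuous₂ (fun z Q => shift k z Q) (continuous_shift k) hζ hQ

theorem tendsto_conj {X m n : Type*} [Fintype m] {𝓕 : Filter X}
    {S : X → Matrix m m ℂ} {U : X → Matrix m n ℂ} {S₀ : Matrix m m ℂ} {U₀ : Matrix m n ℂ}
    (hS : Filter.Tendsto S 𝓕 (nhds S₀)) (hU : Filter.Tendsto U 𝓕 (nhds U₀)) :
    Filter.Tendsto (fun x => (U x)ᴴ * S x * U x) 𝓕 (nhds (U₀ᴴ * S₀ * U₀)) :=
  tendsto_of_continuous₂ (fun (S : Matrix m m ℂ) (U : Matrix m n ℂ) => Uᴴ * S * U)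
    (((continuous_snd.matrix_conjTranspose).matrix_mul continuous_fst).matrix_mul continuous_snd)
    hS hU

theorem tendsto_blk₁ {X : Type*} {𝓕 : Filter X}
    {f : X → Matrix (Fin p ⊕ Fin q) (Fin p ⊕ Fin q) ℂ} {M}
    (hf : Filter.Tendsto f 𝓕 (nhds M)) :
    Filter.Tendsto (fun x => blk₁ (f x)) 𝓕 (nhds (blk₁ M)) :=
  ((continuous_id.matrix_submatrix Sum.inl Sum.inl).tendsto M).comp hf

theorem tendsto_blk₂ {X : Type*} {𝓕 : Filter X}
    {f : X → Matrix (Fin p ⊕ Fin q) (Fin p ⊕ Fin q) ℂ} {M}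
    (hf : Filter.Tendsto f 𝓕 (nhds M)) :
    Filter.Tendsto (fun x => blk₂ (f x)) 𝓕 (nhds (blk₂ M)) :=
  ((continuous_id.matrix_submatrix Sum.inr Sum.inr).tendsto M).comp hf

theorem tendsto_psi {X : Type*} {𝓕 : Filter X} (w₁ : Fin 3 → Fin p → ℝ) (w₂ : Fin 3 → Fin q → ℝ)
    (Γ : ℝ) {ζ : X → Matrix (Fin p) (Fin q) ℂ} {U : X → Fin 3 → Matrix (Fin p) (Fin p) ℂ}
    {V : X → Fin 3 → Matrix (Fin q) (Fin q) ℂ} {ζ₀ U₀ V₀}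
    (hζ : Filter.Tendsto ζ 𝓕 (nhds ζ₀)) (hU : ∀ k, Filter.Tendsto (fun x => U x k) 𝓕 (nhds (U₀ k)))
    (hV : ∀ k, Filter.Tendsto (fun x => V x k) 𝓕 (nhds (V₀ k)))
    (hU₀ : ∀ k, (U₀ k).det ≠ 0) (hV₀ : ∀ k, (V₀ k).det ≠ 0)
    {Q : Matrix (Fin p ⊕ Fin q) (Fin p ⊕ Fin q) ℂ} (hQ : Dom ζ₀ Q) :
    Filter.Tendsto (fun x => psi w₁ w₂ Γ (ζ x) (U x) (V x) Q) 𝓕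
      (nhds (psi w₁ w₂ Γ ζ₀ U₀ V₀ Q)) := by
  have hi : ∀ k, Filter.Tendsto (fun x => (shift k (ζ x) Q)⁻¹) 𝓕 (nhds (shift k ζ₀ Q)⁻¹) :=
    fun k => tendsto_inv_of_det_ne_zero (tendsto_shift k hζ tendsto_const_nhds)
      (hQ.posDef k).det_pos.ne'
  refine Filter.Tendsto.add (Filter.Tendsto.add (Filter.Tendsto.add
    (tendsto_finsetSum _ fun k _ => ?_) (tendsto_finsetSum _ fun k _ => ?_)) tendsto_const_nhds)
    tendsto_const_nhds
  · exact tendsto_lw _ (tendsto_conj (tendsto_blk₁ (hi k)) (hU k))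
      (posDef_conj ((hQ.posDef k).inv.submatrix Sum.inl_injective) (hU₀ k))
  · exact tendsto_lw _ (tendsto_conj (tendsto_blk₂ (hi k)) (hV k))
      (posDef_conj ((hQ.posDef k).inv.submatrix Sum.inr_injective) (hV₀ k))

theorem norm_le_one_of_conj_eq_one {m : Type*} [Fintype m] [DecidableEq m] {S U : Matrix m m ℂ}
    (hS : (S - 1).PosSemidef) (hU : Uᴴ * S * U = 1) (i j : m) : ‖U i j‖ ≤ 1 := by
  have h := (conj_sub_posSemidef hS U).diag_nonneg (i := j)
  rw [hU, Matrix.mul_one, Matrix.sub_apply, Matrix.one_apply_eq, Matrix.mul_apply] at h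
  have h1 := (Complex.le_def.1 h).1
  rw [Complex.zero_re, Complex.sub_re, Complex.one_re, Complex.re_sum] at h1
  have h2 : ∀ a, (Uᴴ j a * U a j).re = ‖U a j‖ ^ 2 := fun a => by
    rw [conjTranspose_apply, RCLike.star_def, Complex.conj_mul', ← Complex.ofReal_pow,
      Complex.ofReal_re]
  rw [Finset.sum_congr rfl fun a _ => h2 a] at h1
  have h3 := Finset.single_le_sum (f := fun a => ‖U a j‖ ^ 2) (fun a _ => sq_nonneg _)
    (Finset.mem_univ i)
  nlinarith [norm_nonneg (U i j)]

theorem Semi.exists_minimizer {ζ : Matrix (Fin p) (Fin q) ℂ}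
    {G : Fin 3 → Matrix (Fin p) (Fin p) ℂ} {F : Fin 3 → Matrix (Fin q) (Fin q) ℂ}
    {w₁ : Fin 3 → Fin p → ℝ} {w₂ : Fin 3 → Fin q → ℝ} {Γ κ : ℝ}
    (h : Semi ζ G F w₁ w₂ Γ κ) (hw₁ : ∀ k i, 0 ≤ drop (w₁ k) i)
    (hw₂ : ∀ k i, 0 ≤ drop (w₂ k) i) (hG : ∀ k, (G k).det ≠ 0) (hF : ∀ k, (F k).det ≠ 0)
    (hκ₁ : ∑ k, ∑ j, w₁ k j - Γ * p = κ) (hκ₂ : ∑ k, ∑ j, w₂ k j - Γ * q = κ)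
    (i : Fin q) (hi : (i : ℕ) + 1 = q) (hw0 : 0 < w₂ 0 i) (hw1 : 0 < w₂ 1 i) :
    ∃ (ζ' : Matrix (Fin p) (Fin q) ℂ) (P : Matrix (Fin p ⊕ Fin q) (Fin p ⊕ Fin q) ℂ)
      (U₁ : Fin 3 → Matrix (Fin p) (Fin p) ℂ) (U₂ : Fin 3 → Matrix (Fin q) (Fin q) ℂ),
      Dom ζ' P ∧ blk₁ P = 1 ∧ blk₂ P = 1 ∧
      (∀ k, (U₁ k)ᴴ * blk₁ (shift k ζ' P)⁻¹ * U₁ k = 1) ∧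
      (∀ k, (U₂ k)ᴴ * blk₂ (shift k ζ' P)⁻¹ * U₂ k = 1) ∧
      ∀ Q, Dom ζ' Q → 0 ≤ psi w₁ w₂ Γ ζ' U₁ U₂ Q := by
  obtain ⟨C, hC⟩ := h.exists_psi_bound hw₁ hw₂ hG hF hκ₁ hκ₂ i hi
  set V : Fin 3 → Matrix (Fin q) (Fin q) ℂ := fun k => (F k).map star with hV
  have hVd : ∀ k, (V k).det ≠ 0 := fun k => by
    have : (V k).det = star (F k).det := by
      rw [← det_conjTranspose, ← det_transpose]; rfl
    rw [this]; exact star_ne_zero.2 (hF k)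
  set s := sInf (psi w₁ w₂ Γ ζ G V '' {Q | Dom ζ Q}) with hs
  have hne : (psi w₁ w₂ Γ ζ G V '' {Q | Dom ζ Q}).Nonempty := by
    obtain ⟨Q, hQ⟩ := exists_dom ζ
    exact ⟨_, Q, hQ, rfl⟩
  have hbdd : BddBelow (psi w₁ w₂ Γ ζ G V '' {Q | Dom ζ Q}) :=
    ⟨C, by rintro _ ⟨Q, hQ, rfl⟩; exact (hC Q hQ).1⟩
  have hseq : ∀ n : ℕ, ∃ Q, Dom ζ Q ∧ psi w₁ w₂ Γ ζ G V Q < s + 1 / ((n : ℝ) + 1) := fun n => by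
    obtain ⟨_, ⟨Q, hQ, rfl⟩, hlt⟩ := exists_lt_of_csInf_lt hne
      (lt_add_of_pos_right s (Nat.one_div_pos_of_nat (n := n) (α := ℝ)))
    exact ⟨Q, hQ, hlt⟩
  choose Q hQ hQs using hseq
  choose ζ' P U₁ U₂ hD hP₁ hP₂ hU₁ hU₂ hdet hpsi using fun n =>
    exists_normalized (w₁ := w₁) (w₂ := w₂) (Γ := Γ) hG hVd (hQ n)
  have hmin : ∀ n Q', Dom (ζ' n) Q' →
      -(1 / ((n : ℝ) + 1)) ≤ psi w₁ w₂ Γ (ζ' n) (U₁ n) (U₂ n) Q' := fun n Q' hQ' => by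
    obtain ⟨R, hR, he⟩ := hpsi n Q' hQ'
    have h1 := csInf_le hbdd ⟨R, hR, rfl⟩
    have h2 := hQs n
    rw [he]; linarith
  have hlow : ∀ k, 0 < w₂ k i → ∃ ε > 0, ∀ n, ε ≤ (shift k (ζ' n) (P n)).det.re := fun k hk => by
    refine ⟨Real.exp (-((s + 1 - C) / w₂ k i)), Real.exp_pos _, fun n => ?_⟩
    rw [← Real.le_log_iff_exp_le (posDef_det_re_pos ((hD n).posDef k)), hdet, neg_le,
      le_div_iff₀ hk]
    have h1 := (hC _ (hQ n)).2 k
    have h2 : 1 / ((n : ℝ) + 1) ≤ 1 := by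
      rw [div_le_one (by positivity)]; linarith [(Nat.cast_nonneg n : (0 : ℝ) ≤ n)]
    have h3 := hQs n
    linarith
  have d₁ : ∀ n c, P n (.inl c) (.inl c) = 1 := fun n c =>
    (congrFun (congrFun (hP₁ n) c) c).trans (Matrix.one_apply_eq c)
  have d₂ : ∀ n c, P n (.inr c) (.inr c) = 1 := fun n c =>
    (congrFun (congrFun (hP₂ n) c) c).trans (Matrix.one_apply_eq c)
  have bP : ∀ n a b, ‖P n a b‖ ≤ 2 := fun n a b => by
    have hd : ∀ c, (P n c c).re = 1 := fun c => by
      rcases c with c | c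
      · rw [d₁, Complex.one_re]
      · rw [d₂, Complex.one_re]
    have := norm_sq_le_of_posSemidef (hD n).1.posSemidef a b
    rw [hd, hd] at this
    nlinarith [norm_nonneg (P n a b)]
  have bζ : ∀ n a b, ‖ζ' n a b‖ ≤ 2 := fun n a b => by
    have := (hD n).entry_bound a b
    rw [d₁, d₂] at this
    simpa using this
  have bU₁ : ∀ n k a b, ‖U₁ n k a b‖ ≤ 2 := fun n k a b => by
    have := (blk_inv_sub ((hD n).posDef k)).1
    rw [blk₁_shift, hP₁, inv_one] at this
    exact (norm_le_one_of_conj_eq_one this (hU₁ n k) a b).trans one_le_two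
  have bU₂ : ∀ n k a b, ‖U₂ n k a b‖ ≤ 2 := fun n k a b => by
    have := (blk_inv_sub ((hD n).posDef k)).2
    rw [blk₂_shift, hP₂, inv_one] at this
    exact (norm_le_one_of_conj_eq_one this (hU₂ n k) a b).trans one_le_two
  have hball : IsCompact (Metric.closedBall (0 : ℂ) 2) := isCompact_closedBall _ _
  have hK := (hball.matrix (m := Fin p) (n := Fin q)).prod
    ((hball.matrix (m := Fin p ⊕ Fin q) (n := Fin p ⊕ Fin q)).prod
      ((isCompact_univ_pi fun _ : Fin 3 => hball.matrix (m := Fin p) (n := Fin p)).prod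
        (isCompact_univ_pi fun _ : Fin 3 => hball.matrix (m := Fin q) (n := Fin q))))
  set 𝓤 := Ultrafilter.of (Filter.atTop : Filter ℕ) with h𝓤
  have h𝓤le : (𝓤 : Filter ℕ) ≤ Filter.atTop := Ultrafilter.of_le _
  obtain ⟨⟨ζ₀, P₀, U₀, V₀⟩, -, hlim⟩ := hK.ultrafilter_le_nhds
    (𝓤.map fun n => (ζ' n, P n, U₁ n, U₂ n)) (by
      rw [Ultrafilter.coe_map, Filter.le_principal_iff, Filter.mem_map]
      refine Filter.Eventually.of_forall fun n => ⟨?_, ?_, ?_, ?_⟩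
      · exact fun a b => mem_closedBall_zero_iff.2 (bζ n a b)
      · exact fun a b => mem_closedBall_zero_iff.2 (bP n a b)
      · exact fun k _ a b => mem_closedBall_zero_iff.2 (bU₁ n k a b)
      · exact fun k _ a b => mem_closedBall_zero_iff.2 (bU₂ n k a b))
  have hlim' : Filter.Tendsto (fun n => (ζ' n, P n, U₁ n, U₂ n)) 𝓤 (nhds (ζ₀, P₀, U₀, V₀)) := hlim
  have tζ : Filter.Tendsto ζ' 𝓤 (nhds ζ₀) := (continuous_fst.tendsto _).comp hlim'
  have tP : Filter.Tendsto P 𝓤 (nhds P₀) :=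
    ((continuous_fst.comp continuous_snd).tendsto _).comp hlim'
  have tU : ∀ k, Filter.Tendsto (fun n => U₁ n k) 𝓤 (nhds (U₀ k)) := fun k =>
    (((continuous_apply k).comp (continuous_fst.comp (continuous_snd.comp
      continuous_snd))).tendsto _).comp hlim'
  have tV : ∀ k, Filter.Tendsto (fun n => U₂ n k) 𝓤 (nhds (V₀ k)) := fun k =>
    (((continuous_apply k).comp (continuous_snd.comp (continuous_snd.comp
      continuous_snd))).tendsto _).comp hlim'
  have hpd : ∀ k, 0 < w₂ k i → (shift k ζ₀ P₀).PosDef := fun k hk => by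
    obtain ⟨ε, hε, hle⟩ := hlow k hk
    have ht := tendsto_shift k tζ tP
    have hps := posSemidef_of_tendsto ht fun n => ((hD n).posDef k).posSemidef
    have hdt : Filter.Tendsto (fun n => (shift k (ζ' n) (P n)).det.re) 𝓤
        (nhds (shift k ζ₀ P₀).det.re) :=
      ((Complex.continuous_re.comp continuous_id.matrix_det).tendsto _).comp ht
    have hge := ge_of_tendsto hdt (Filter.Eventually.of_forall hle)
    refine hps.posDef_iff_det_ne_zero.2 fun h0 => ?_
    rw [h0, Complex.zero_re] at hge
    linarith
  have hD₀ : Dom ζ₀ P₀ :=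
    ⟨by simpa [shift, part] using hpd 1 hw1, by simpa [shift, part] using hpd 0 hw0⟩
  have ti : ∀ k, Filter.Tendsto (fun n => (shift k (ζ' n) (P n))⁻¹) 𝓤
      (nhds (shift k ζ₀ P₀)⁻¹) := fun k =>
    tendsto_inv_of_det_ne_zero (tendsto_shift k tζ tP) (hD₀.posDef k).det_pos.ne'
  have eU : ∀ k, (U₀ k)ᴴ * blk₁ (shift k ζ₀ P₀)⁻¹ * U₀ k = 1 := fun k => by
    have h1 := tendsto_conj (tendsto_blk₁ (ti k)) (tU k)
    simp only [hU₁] at h1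
    exact tendsto_nhds_unique h1 tendsto_const_nhds
  have eV : ∀ k, (V₀ k)ᴴ * blk₂ (shift k ζ₀ P₀)⁻¹ * V₀ k = 1 := fun k => by
    have h1 := tendsto_conj (tendsto_blk₂ (ti k)) (tV k)
    simp only [hU₂] at h1
    exact tendsto_nhds_unique h1 tendsto_const_nhds
  refine ⟨ζ₀, P₀, U₀, V₀, hD₀, ?_, ?_, eU, eV, fun R hR => ?_⟩
  · have h1 := tendsto_blk₁ tP
    simp only [hP₁] at h1
    exact tendsto_nhds_unique h1 tendsto_const_nhds
  · have h1 := tendsto_blk₂ tP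
    simp only [hP₂] at h1
    exact tendsto_nhds_unique h1 tendsto_const_nhds
  · have dU : ∀ k, (U₀ k).det ≠ 0 := fun k => (isUnit_det_of_left_inverse (eU k)).ne_zero
    have dV : ∀ k, (V₀ k).det ≠ 0 := fun k => (isUnit_det_of_left_inverse (eV k)).ne_zero
    have ht := tendsto_psi w₁ w₂ Γ tζ tU tV dU dV hR
    have h1 : Filter.Tendsto (fun n : ℕ => -(1 / ((n : ℝ) + 1))) 𝓤 (nhds 0) := by
      have := (tendsto_one_div_add_atTop_nhds_zero_nat (𝕜 := ℝ)).neg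
      rw [neg_zero] at this
      exact this.mono_left h𝓤le
    have hH : (R : Matrix (Fin p ⊕ Fin q) (Fin p ⊕ Fin q) ℂ)ᴴ = R := hR.1.1
    have hev : ∀ᶠ n in (𝓤 : Filter ℕ), (R + offd (ζ' n)).PosDef :=
      eventually_posDef (((continuous_const.add continuous_offd).tendsto ζ₀).comp tζ)
        (fun n => by
          change (R + offd (ζ' n))ᴴ = R + offd (ζ' n)
          rw [conjTranspose_add, hH, offd_conjTranspose]) hR.2
    exact le_of_tendsto_of_tendsto h1 ht (hev.mono fun n hn => hmin n R ⟨hR.1, hn⟩)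

/-! ### First order condition at a minimizer -/

theorem log_det_le_trace_sub_card {m : Type*} [Fintype m] [DecidableEq m] {S : Matrix m m ℂ}
    (hS : S.PosDef) : Real.log S.det.re ≤ ∑ i, ((S i i).re - 1) := by
  have h1 : S.det.re = ∏ i, hS.1.eigenvalues i := by
    rw [hS.1.det_eq_prod_eigenvalues]
    have : (∏ i, ((hS.1.eigenvalues i : ℝ) : ℂ)) = ((∏ i, hS.1.eigenvalues i : ℝ) : ℂ) := by
      push_cast; rfl
    exact (congrArg Complex.re this).trans (Complex.ofReal_re _)
  have h2 : ∑ i, (S i i).re = ∑ i, hS.1.eigenvalues i := by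
    have := congrArg Complex.re hS.1.trace_eq_sum_eigenvalues
    rw [trace, Complex.re_sum, Complex.re_sum] at this
    exact this
  rw [h1, Real.log_prod fun i _ => (hS.eigenvalues_pos i).ne', Finset.sum_sub_distrib, h2,
    ← Finset.sum_sub_distrib]
  exact Finset.sum_le_sum fun i _ => Real.log_le_sub_one_of_pos (hS.eigenvalues_pos i)

theorem lw_le {w : Fin p → ℝ} (hw : ∀ i, 0 ≤ drop w i) {S : Matrix (Fin p) (Fin p) ℂ}
    (hS : S.PosDef) : lw w S ≤ ∑ j, w j * ((S j j).re - 1) := by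
  rw [← sum_drop_mul_sum]
  exact Finset.sum_le_sum fun i _ =>
    mul_le_mul_of_nonneg_left (log_det_le_trace_sub_card (posDef_lead hS i)) (hw i)

theorem dg_eq_diagonal {m n : Type*} [DecidableEq m] [DecidableEq n] (a₁ : m → ℝ) (a₂ : n → ℝ) :
    dg a₁ a₂ = diagonal (Sum.elim (fun i => (a₁ i : ℂ)) fun i => (a₂ i : ℂ)) :=
  fromBlocks_diagonal _ _

theorem trace_dg_mul_conj (w₁ : Fin p → ℝ) (w₂ : Fin q → ℝ) (U : Matrix (Fin p) (Fin p) ℂ)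
    (V : Matrix (Fin q) (Fin q) ℂ) (X : Matrix (Fin p ⊕ Fin q) (Fin p ⊕ Fin q) ℂ) :
    (dg w₁ w₂ * ((bdiag U V)ᴴ * X * bdiag U V)).trace.re =
      ∑ j, w₁ j * ((Uᴴ * blk₁ X * U) j j).re + ∑ j, w₂ j * ((Vᴴ * blk₂ X * V) j j).re := by
  have h1 := bdiag_conj₁ Uᴴ Vᴴ X
  have h2 := bdiag_conj₂ Uᴴ Vᴴ X
  rw [bdiag_conjTranspose, conjTranspose_conjTranspose, conjTranspose_conjTranspose] at h1 h2
  rw [← h1, ← h2, bdiag_conjTranspose, dg_eq_diagonal, trace, Complex.re_sum,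
    Fintype.sum_sum_type]
  congr 1 <;> refine Finset.sum_congr rfl fun j _ => ?_ <;>
    rw [diag_apply, diagonal_mul]
  · exact Complex.re_ofReal_mul _ _
  · exact Complex.re_ofReal_mul _ _

theorem inv_add_smul_sub_inv {m : Type*} [Fintype m] [DecidableEq m] {M E : Matrix m m ℂ} {t : ℝ}
    (hM : M.det ≠ 0) (hMt : (M + t • E).det ≠ 0) :
    (M + t • E)⁻¹ - M⁻¹ = -(t • ((M + t • E)⁻¹ * E * M⁻¹)) := by
  have h1 : (M + t • E)⁻¹ * (M + t • E) = 1 := nonsing_inv_mul _ hMt.isUnit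
  have h2 : M * M⁻¹ = 1 := mul_nonsing_inv _ hM.isUnit
  calc (M + t • E)⁻¹ - M⁻¹ = (M + t • E)⁻¹ * (M * M⁻¹) -
        (M + t • E)⁻¹ * (M + t • E) * M⁻¹ := by rw [h1, h2, Matrix.mul_one, Matrix.one_mul]
    _ = -(t • ((M + t • E)⁻¹ * E * M⁻¹)) := by
      rw [Matrix.mul_add, Matrix.add_mul, Matrix.mul_assoc _ M M⁻¹, Matrix.mul_smul,
        Matrix.smul_mul]
      abel

theorem lw_add_lw_le {w₁ : Fin p → ℝ} {w₂ : Fin q → ℝ} (hw₁ : ∀ i, 0 ≤ drop w₁ i)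
    (hw₂ : ∀ i, 0 ≤ drop w₂ i) {U : Matrix (Fin p) (Fin p) ℂ} {V : Matrix (Fin q) (Fin q) ℂ}
    {M E : Matrix (Fin p ⊕ Fin q) (Fin p ⊕ Fin q) ℂ} {t : ℝ} (hM : M.PosDef)
    (hMt : (M + t • E).PosDef) (hU : Uᴴ * blk₁ M⁻¹ * U = 1) (hV : Vᴴ * blk₂ M⁻¹ * V = 1) :
    lw w₁ (Uᴴ * blk₁ (M + t • E)⁻¹ * U) + lw w₂ (Vᴴ * blk₂ (M + t • E)⁻¹ * V) ≤
      -(t * (dg w₁ w₂ * ((bdiag U V)ᴴ * ((M + t • E)⁻¹ * E * M⁻¹) * bdiag U V)).trace.re) := by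
  have hUd : U.det ≠ 0 := (isUnit_det_of_left_inverse hU).ne_zero
  have hVd : V.det ≠ 0 := (isUnit_det_of_left_inverse hV).ne_zero
  have h1 := lw_le hw₁ (posDef_conj (hMt.inv.submatrix Sum.inl_injective) hUd)
  have h2 := lw_le hw₂ (posDef_conj (hMt.inv.submatrix Sum.inr_injective) hVd)
  refine (add_le_add h1 h2).trans (le_of_eq ?_)
  have h3 := trace_dg_mul_conj w₁ w₂ U V ((M + t • E)⁻¹ - M⁻¹)
  have e1 : ∀ j, ((Uᴴ * blk₁ ((M + t • E)⁻¹ - M⁻¹) * U) j j).re =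
      ((Uᴴ * blk₁ (M + t • E)⁻¹ * U) j j).re - 1 := fun j => by
    have : Uᴴ * blk₁ ((M + t • E)⁻¹ - M⁻¹) * U = Uᴴ * blk₁ (M + t • E)⁻¹ * U - 1 := by
      rw [← hU, ← Matrix.sub_mul, ← Matrix.mul_sub]; rfl
    rw [this, Matrix.sub_apply, Matrix.one_apply_eq, Complex.sub_re, Complex.one_re]
  have e2 : ∀ j, ((Vᴴ * blk₂ ((M + t • E)⁻¹ - M⁻¹) * V) j j).re =
      ((Vᴴ * blk₂ (M + t • E)⁻¹ * V) j j).re - 1 := fun j => by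
    have : Vᴴ * blk₂ ((M + t • E)⁻¹ - M⁻¹) * V = Vᴴ * blk₂ (M + t • E)⁻¹ * V - 1 := by
      rw [← hV, ← Matrix.sub_mul, ← Matrix.mul_sub]; rfl
    rw [this, Matrix.sub_apply, Matrix.one_apply_eq, Complex.sub_re, Complex.one_re]
  simp only [e1, e2] at h3
  refine h3.symm.trans ?_
  rw [inv_add_smul_sub_inv hM.det_pos.ne' hMt.det_pos.ne', Matrix.mul_neg, Matrix.neg_mul,
    Matrix.mul_neg, Matrix.mul_smul, Matrix.smul_mul, Matrix.mul_smul, trace_neg, trace_smul,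
    Complex.neg_re, Complex.smul_re, smul_eq_mul]

theorem shift_add_smul (k : Fin 3) (ζ : Matrix (Fin p) (Fin q) ℂ)
    (P D : Matrix (Fin p ⊕ Fin q) (Fin p ⊕ Fin q) ℂ) (t : ℝ) :
    shift k ζ (P + t • D) = shift k ζ P + t • part k D := by
  have h : part k (P + t • D) = part k P + t • part k D := by
    by_cases hk : k = 2
    · simp only [part, if_pos hk, fromBlocks_smul, fromBlocks_add, smul_zero, add_zero]; rfl
    · simp only [part, if_neg hk]
  rw [shift, shift, h]; abel

/-- The three matrices associated with a normalized point of the domain. -/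
noncomputable def frame (ζ : Matrix (Fin p) (Fin q) ℂ)
    (P : Matrix (Fin p ⊕ Fin q) (Fin p ⊕ Fin q) ℂ) (U : Fin 3 → Matrix (Fin p) (Fin p) ℂ)
    (V : Fin 3 → Matrix (Fin q) (Fin q) ℂ) (k : Fin 3) :
    Matrix (Fin p ⊕ Fin q) (Fin p ⊕ Fin q) ℂ :=
  (shift k ζ P)⁻¹ * bdiag (U k) (V k)

theorem log_det_blk_le {Q D : Matrix (Fin p ⊕ Fin q) (Fin p ⊕ Fin q) ℂ} {t : ℝ}
    (h : (Q + t • D).PosDef) (h₁ : blk₁ Q = 1) (h₂ : blk₂ Q = 1) :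
    Real.log (blk₁ (Q + t • D)).det.re + Real.log (blk₂ (Q + t • D)).det.re ≤ t * D.trace.re := by
  have k1 := log_det_le_trace_sub_card (h.submatrix Sum.inl_injective)
  have k2 := log_det_le_trace_sub_card (h.submatrix Sum.inr_injective)
  refine (add_le_add k1 k2).trans (le_of_eq ?_)
  have d₁ : ∀ c, Q (.inl c) (.inl c) = 1 := fun c =>
    (congrFun (congrFun h₁ c) c).trans (Matrix.one_apply_eq c)
  have d₂ : ∀ c, Q (.inr c) (.inr c) = 1 := fun c =>
    (congrFun (congrFun h₂ c) c).trans (Matrix.one_apply_eq c)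
  rw [trace, Complex.re_sum, Fintype.sum_sum_type, mul_add, Finset.mul_sum, Finset.mul_sum]
  simp [d₁, d₂]

theorem tendsto_trace_re {X m : Type*} [Fintype m] {𝓕 : Filter X} (W B E C B' : Matrix m m ℂ)
    {f : X → Matrix m m ℂ} {N : Matrix m m ℂ} (hf : Filter.Tendsto f 𝓕 (nhds N)) :
    Filter.Tendsto (fun x => (W * (B * (f x * E * C) * B')).trace.re) 𝓕
      (nhds (W * (B * (N * E * C) * B')).trace.re) := by
  have hc : Continuous fun N : Matrix m m ℂ => (W * (B * (N * E * C) * B')).trace.re :=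
    Complex.continuous_re.comp (continuous_const.matrix_mul ((continuous_const.matrix_mul
      ((continuous_id.matrix_mul continuous_const).matrix_mul continuous_const)).matrix_mul
      continuous_const)).matrix_trace
  have h : Filter.Tendsto (fun N : Matrix m m ℂ => (W * (B * (N * E * C) * B')).trace.re) (nhds N)
      (nhds (W * (B * (N * E * C) * B')).trace.re) := hc.tendsto N
  exact h.comp hf

theorem first_order {ζ : Matrix (Fin p) (Fin q) ℂ}
    {P : Matrix (Fin p ⊕ Fin q) (Fin p ⊕ Fin q) ℂ} {U : Fin 3 → Matrix (Fin p) (Fin p) ℂ}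
    {V : Fin 3 → Matrix (Fin q) (Fin q) ℂ} {w₁ : Fin 3 → Fin p → ℝ} {w₂ : Fin 3 → Fin q → ℝ}
    {Γ : ℝ} (hΓ : 0 ≤ Γ) (hw₁ : ∀ k i, 0 ≤ drop (w₁ k) i) (hw₂ : ∀ k i, 0 ≤ drop (w₂ k) i)
    (hP : Dom ζ P) (h₁ : blk₁ P = 1) (h₂ : blk₂ P = 1)
    (hU : ∀ k, (U k)ᴴ * blk₁ (shift k ζ P)⁻¹ * U k = 1)
    (hV : ∀ k, (V k)ᴴ * blk₂ (shift k ζ P)⁻¹ * V k = 1)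
    (hmin : ∀ Q, Dom ζ Q → 0 ≤ psi w₁ w₂ Γ ζ U V Q)
    {D : Matrix (Fin p ⊕ Fin q) (Fin p ⊕ Fin q) ℂ} (hD : Dᴴ = D) :
    0 ≤ Γ * D.trace.re - ∑ k, (frame ζ P U V k * dg (w₁ k) (w₂ k) * (frame ζ P U V k)ᴴ *
      part k D).trace.re := by
  have hPH : Pᴴ = P := hP.1.1
  have htP : Filter.Tendsto (fun t : ℝ => P + t • D) (nhdsWithin 0 (Set.Ioi 0)) (nhds P) := by
    have hc : Continuous fun t : ℝ => P + t • D := by fun_prop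
    exact (hc.tendsto' 0 P (by simp)).mono_left nhdsWithin_le_nhds
  have htH : ∀ t : ℝ, (P + t • D)ᴴ = P + t • D := fun t => by
    rw [conjTranspose_add, conjTranspose_smul, hPH, hD, star_trivial]
  have hev : ∀ᶠ t : ℝ in nhdsWithin 0 (Set.Ioi 0), Dom ζ (P + t • D) := by
    have e1 := eventually_posDef htP htH hP.1
    have e2 : ∀ᶠ t : ℝ in nhdsWithin 0 (Set.Ioi 0), (P + t • D + offd ζ).PosDef :=
      eventually_posDef (htP.add_const _) (fun t => by
        change (P + t • D + offd ζ)ᴴ = _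
        rw [conjTranspose_add, htH, offd_conjTranspose]) hP.2
    exact e1.and e2
  have hlim : Filter.Tendsto (fun t : ℝ => Γ * D.trace.re - ∑ k, (dg (w₁ k) (w₂ k) *
      ((bdiag (U k) (V k))ᴴ * ((shift k ζ (P + t • D))⁻¹ * part k D * (shift k ζ P)⁻¹) *
        bdiag (U k) (V k))).trace.re) (nhdsWithin 0 (Set.Ioi 0))
      (nhds (Γ * D.trace.re - ∑ k, (dg (w₁ k) (w₂ k) *
      ((bdiag (U k) (V k))ᴴ * ((shift k ζ P)⁻¹ * part k D * (shift k ζ P)⁻¹) *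
        bdiag (U k) (V k))).trace.re)) := by
    refine tendsto_const_nhds.sub (tendsto_finsetSum _ fun k _ => ?_)
    have ti : Filter.Tendsto (fun t : ℝ => (shift k ζ (P + t • D))⁻¹)
        (nhdsWithin 0 (Set.Ioi 0)) (nhds (shift k ζ P)⁻¹) :=
      tendsto_inv_of_det_ne_zero (tendsto_shift k tendsto_const_nhds htP) (hP.posDef k).det_pos.ne'
    exact tendsto_trace_re _ _ _ _ _ ti
  have hge := ge_of_tendsto (b := (0 : ℝ)) hlim (by
    filter_upwards [hev, self_mem_nhdsWithin] with t ht htpos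
    have htpos : 0 < t := htpos
    have hpsi := hmin _ ht
    have hb := mul_le_mul_of_nonneg_left (log_det_blk_le ht.1 h₁ h₂) hΓ
    have hk := Finset.sum_le_sum fun (k : Fin 3) (_ : k ∈ Finset.univ) =>
      lw_add_lw_le (hw₁ k) (hw₂ k) (hP.posDef k)
        (by rw [← shift_add_smul]; exact ht.posDef k) (hU k) (hV k)
    simp only [← shift_add_smul] at hk
    rw [Finset.sum_add_distrib, Finset.sum_neg_distrib, ← Finset.mul_sum] at hk
    rw [psi] at hpsi
    refine nonneg_of_mul_nonneg_right ?_ htpos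
    rw [mul_sub]
    linarith)
  refine hge.trans (le_of_eq ?_)
  congr 1
  refine Finset.sum_congr rfl fun k _ => congrArg Complex.re ?_
  have hNH : ((shift k ζ P)⁻¹)ᴴ = (shift k ζ P)⁻¹ := (hP.posDef k).inv.1
  rw [frame, conjTranspose_mul, hNH]
  generalize (shift k ζ P)⁻¹ = N
  simp only [Matrix.mul_assoc]
  rw [Matrix.trace_mul_comm N]
  simp only [Matrix.mul_assoc]
  rw [Matrix.trace_mul_comm (bdiag (U k) (V k))]
  simp only [Matrix.mul_assoc]

/-! ### Solutions from minimizers -/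

theorem eq_fromBlocks_of_blk {M : Matrix (Fin p ⊕ Fin q) (Fin p ⊕ Fin q) ℂ}
    (h₁ : blk₁ M = 1) (h₂ : blk₂ M = 1) :
    M = fromBlocks 1 M.toBlocks₁₂ M.toBlocks₂₁ 1 := by
  conv_lhs => rw [← fromBlocks_toBlocks M]
  have e1 : M.toBlocks₁₁ = 1 := h₁
  have e2 : M.toBlocks₂₂ = 1 := h₂
  rw [e1, e2]

theorem frame_conj_sig {M : Matrix (Fin p ⊕ Fin q) (Fin p ⊕ Fin q) ℂ}
    {U : Matrix (Fin p) (Fin p) ℂ} {V : Matrix (Fin q) (Fin q) ℂ} (hM : M.PosDef)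
    (h₁ : blk₁ M = 1) (h₂ : blk₂ M = 1)
    (hU : Uᴴ * blk₁ M⁻¹ * U = 1) (hV : Vᴴ * blk₂ M⁻¹ * V = 1) :
    (M⁻¹ * bdiag U V)ᴴ * sig (Fin p) (Fin q) * (M⁻¹ * bdiag U V) = sig (Fin p) (Fin q) := by
  have hNH : (M⁻¹)ᴴ = M⁻¹ := hM.inv.1
  have hMJ : M * sig (Fin p) (Fin q) + sig (Fin p) (Fin q) * M =
      sig (Fin p) (Fin q) + sig (Fin p) (Fin q) := by
    rw [eq_fromBlocks_of_blk h₁ h₂, fromBlocks_multiply, fromBlocks_multiply, fromBlocks_add,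
      fromBlocks_add]
    simp
  have hNM : M⁻¹ * M = 1 := nonsing_inv_mul _ hM.det_pos.ne'.isUnit
  have hMN : M * M⁻¹ = 1 := mul_nonsing_inv _ hM.det_pos.ne'.isUnit
  have h3 : M⁻¹ * sig (Fin p) (Fin q) * M⁻¹ + M⁻¹ * sig (Fin p) (Fin q) * M⁻¹ =
      sig (Fin p) (Fin q) * M⁻¹ + M⁻¹ * sig (Fin p) (Fin q) := by
    rw [← Matrix.add_mul, ← Matrix.mul_add, ← hMJ, Matrix.mul_add, Matrix.add_mul,
      ← Matrix.mul_assoc, hNM, Matrix.one_mul, Matrix.mul_assoc M⁻¹ (_ * M) M⁻¹,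
      Matrix.mul_assoc _ M M⁻¹, hMN, Matrix.mul_one]
  have h4 : sig (Fin p) (Fin q) * M⁻¹ + M⁻¹ * sig (Fin p) (Fin q) =
      bdiag (blk₁ M⁻¹ + blk₁ M⁻¹) (-(blk₂ M⁻¹ + blk₂ M⁻¹)) := by
    conv_lhs => rw [← fromBlocks_toBlocks M⁻¹, fromBlocks_multiply, fromBlocks_multiply,
      fromBlocks_add]
    simp only [Matrix.one_mul, Matrix.mul_one, Matrix.zero_mul, Matrix.mul_zero, add_zero,
      zero_add, Matrix.neg_mul, Matrix.mul_neg, add_neg_cancel, neg_add_cancel, neg_add]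
    rfl
  have h5 : (M⁻¹ * bdiag U V)ᴴ * sig (Fin p) (Fin q) * (M⁻¹ * bdiag U V) +
      (M⁻¹ * bdiag U V)ᴴ * sig (Fin p) (Fin q) * (M⁻¹ * bdiag U V) =
      sig (Fin p) (Fin q) + sig (Fin p) (Fin q) := by
    have : (M⁻¹ * bdiag U V)ᴴ * sig (Fin p) (Fin q) * (M⁻¹ * bdiag U V) +
      (M⁻¹ * bdiag U V)ᴴ * sig (Fin p) (Fin q) * (M⁻¹ * bdiag U V) =
      (bdiag U V)ᴴ * (M⁻¹ * sig (Fin p) (Fin q) * M⁻¹ + M⁻¹ * sig (Fin p) (Fin q) * M⁻¹) *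
        bdiag U V := by
      rw [conjTranspose_mul, hNH]
      simp only [Matrix.mul_add, Matrix.add_mul, Matrix.mul_assoc]
    rw [this, h3, h4, bdiag_conjTranspose, fromBlocks_multiply, fromBlocks_multiply,
      fromBlocks_add]
    simp only [Matrix.mul_zero, Matrix.zero_mul, add_zero, zero_add, Matrix.mul_add,
      Matrix.add_mul, Matrix.mul_neg, Matrix.neg_mul, hU, hV, neg_add, neg_zero]
  rw [← two_smul ℂ, ← two_smul ℂ (sig _ _)] at h5
  exact smul_right_injective _ two_ne_zero h5

theorem trace_bdiag_mul_part_two (m₁ : Matrix (Fin p) (Fin p) ℂ) (m₂ : Matrix (Fin q) (Fin q) ℂ)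
    (D : Matrix (Fin p ⊕ Fin q) (Fin p ⊕ Fin q) ℂ) :
    (bdiag m₁ m₂ * part 2 D).trace = (bdiag m₁ m₂ * D).trace := by
  conv_rhs => rw [← fromBlocks_toBlocks D, fromBlocks_multiply, trace_blocks]
  rw [part, if_pos rfl, fromBlocks_multiply, trace_blocks]
  simp only [Matrix.zero_mul, Matrix.mul_zero, add_zero, zero_add]
  rfl

theorem shift_two_eq_one {ζ : Matrix (Fin p) (Fin q) ℂ}
    {P : Matrix (Fin p ⊕ Fin q) (Fin p ⊕ Fin q) ℂ} (h₁ : blk₁ P = 1) (h₂ : blk₂ P = 1) :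
    shift 2 ζ P = 1 := by
  rw [shift, part, if_pos rfl, if_neg (by decide), h₁, h₂, fromBlocks_one, add_zero]

theorem eq_zero_of_trace_nonneg {m : Type*} [Fintype m] {T : Matrix m m ℂ}
    (hT : Tᴴ = T) (h : ∀ D : Matrix m m ℂ, Dᴴ = D → 0 ≤ (T * D).trace.re) : T = 0 := by
  have h1 := h (-T) (by rw [conjTranspose_neg, hT])
  have h2 : 0 ≤ (Tᴴ * T).trace := (posSemidef_conjTranspose_mul_self T).trace_nonneg
  refine trace_conjTranspose_mul_self_eq_zero_iff.1 (Complex.ext ?_ (Complex.le_def.1 h2).2.symm)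
  refine le_antisymm ?_ (Complex.le_def.1 h2).1
  rw [Matrix.mul_neg, trace_neg, Complex.neg_re] at h1
  rw [hT, Complex.zero_re]; linarith

theorem dg_conjTranspose {m n : Type*} [DecidableEq m] [DecidableEq n] (a₁ : m → ℝ) (a₂ : n → ℝ) :
    (dg a₁ a₂)ᴴ = dg a₁ a₂ := by
  rw [dg_eq_diagonal, diagonal_conjTranspose]
  congr 1
  ext (i | i) <;> simp

theorem sum_frame_eq {ζ : Matrix (Fin p) (Fin q) ℂ}
    {P : Matrix (Fin p ⊕ Fin q) (Fin p ⊕ Fin q) ℂ} {U : Fin 3 → Matrix (Fin p) (Fin p) ℂ}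
    {V : Fin 3 → Matrix (Fin q) (Fin q) ℂ} {w₁ : Fin 3 → Fin p → ℝ} {w₂ : Fin 3 → Fin q → ℝ}
    {Γ : ℝ} (hΓ : 0 ≤ Γ) (hw₁ : ∀ k i, 0 ≤ drop (w₁ k) i) (hw₂ : ∀ k i, 0 ≤ drop (w₂ k) i)
    (hP : Dom ζ P) (h₁ : blk₁ P = 1) (h₂ : blk₂ P = 1)
    (hU : ∀ k, (U k)ᴴ * blk₁ (shift k ζ P)⁻¹ * U k = 1)
    (hV : ∀ k, (V k)ᴴ * blk₂ (shift k ζ P)⁻¹ * V k = 1)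
    (hmin : ∀ Q, Dom ζ Q → 0 ≤ psi w₁ w₂ Γ ζ U V Q) :
    ∑ k, frame ζ P U V k * dg (w₁ k) (w₂ k) * (frame ζ P U V k)ᴴ = (Γ : ℂ) • 1 := by
  rw [eq_comm, ← sub_eq_zero]
  refine eq_zero_of_trace_nonneg ?_ fun D hD => ?_
  · rw [conjTranspose_sub, conjTranspose_smul, conjTranspose_one, conjTranspose_sum]
    have e1 : star (Γ : ℂ) = Γ := Complex.conj_ofReal Γ
    have e2 : ∀ k, (frame ζ P U V k * dg (w₁ k) (w₂ k) * (frame ζ P U V k)ᴴ)ᴴ =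
        frame ζ P U V k * dg (w₁ k) (w₂ k) * (frame ζ P U V k)ᴴ := fun k => by
      rw [conjTranspose_mul, conjTranspose_mul, conjTranspose_conjTranspose, dg_conjTranspose,
        Matrix.mul_assoc]
    rw [e1, Finset.sum_congr rfl fun k _ => e2 k]
  · refine (first_order hΓ hw₁ hw₂ hP h₁ h₂ hU hV hmin hD).trans (le_of_eq ?_)
    rw [Matrix.sub_mul, trace_sub, Complex.sub_re, Matrix.smul_mul, Matrix.one_mul, trace_smul,
      smul_eq_mul, Complex.re_ofReal_mul, Finset.sum_mul, trace_sum, Complex.re_sum]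
    congr 1
    refine Finset.sum_congr rfl fun k _ => congrArg Complex.re ?_
    by_cases hk : k = 2
    · subst hk
      have hf : frame ζ P U V 2 = bdiag (U 2) (V 2) := by
        rw [frame, shift_two_eq_one h₁ h₂, inv_one, Matrix.one_mul]
      rw [hf, bdiag_conjTranspose, fromBlocks_multiply, fromBlocks_multiply]
      simp only [Matrix.mul_zero, Matrix.zero_mul, add_zero, zero_add]
      exact trace_bdiag_mul_part_two _ _ _
    · rw [part, if_neg hk]

theorem sol_of_minimizer {ζ : Matrix (Fin p) (Fin q) ℂ}
    {P : Matrix (Fin p ⊕ Fin q) (Fin p ⊕ Fin q) ℂ} {U : Fin 3 → Matrix (Fin p) (Fin p) ℂ}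
    {V : Fin 3 → Matrix (Fin q) (Fin q) ℂ} {a₁ b₁ x₁ : Fin p → ℝ} {a₂ b₂ x₂ : Fin q → ℝ}
    {Γ : ℝ} (hΓ : 0 ≤ Γ) (hw₁ : ∀ k i, 0 ≤ drop (![a₁, b₁, coweight Γ x₁] k) i)
    (hw₂ : ∀ k i, 0 ≤ drop (![a₂, b₂, coweight Γ x₂] k) i)
    (hP : Dom ζ P) (h₁ : blk₁ P = 1) (h₂ : blk₂ P = 1)
    (hU : ∀ k, (U k)ᴴ * blk₁ (shift k ζ P)⁻¹ * U k = 1)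
    (hV : ∀ k, (V k)ᴴ * blk₂ (shift k ζ P)⁻¹ * V k = 1)
    (hmin : ∀ Q, Dom ζ Q →
      0 ≤ psi ![a₁, b₁, coweight Γ x₁] ![a₂, b₂, coweight Γ x₂] Γ ζ U V Q) :
    Sol a₁ b₁ x₁ a₂ b₂ x₂ := by
  have hsum := sum_frame_eq hΓ hw₁ hw₂ hP h₁ h₂ hU hV hmin
  rw [Fin.sum_univ_three] at hsum
  have hsig : ∀ k, (frame ζ P U V k)ᴴ * sig (Fin p) (Fin q) * frame ζ P U V k =
      sig (Fin p) (Fin q) := fun k =>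
    frame_conj_sig (hP.posDef k) (by rw [blk₁_shift, h₁]) (by rw [blk₂_shift, h₂]) (hU k) (hV k)
  have hf : frame ζ P U V 2 = bdiag (U 2) (V 2) := by
    rw [frame, shift_two_eq_one h₁ h₂, inv_one, Matrix.one_mul]
  have hU2 : (U 2)ᴴ * U 2 = 1 := by
    have := hU 2
    rw [shift_two_eq_one h₁ h₂, inv_one] at this
    have e : blk₁ (1 : Matrix (Fin p ⊕ Fin q) (Fin p ⊕ Fin q) ℂ) = 1 :=
      submatrix_one _ Sum.inl_injective
    rwa [e, Matrix.mul_one] at this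
  have hV2 : (V 2)ᴴ * V 2 = 1 := by
    have := hV 2
    rw [shift_two_eq_one h₁ h₂, inv_one] at this
    have e : blk₂ (1 : Matrix (Fin p ⊕ Fin q) (Fin p ⊕ Fin q) ℂ) = 1 :=
      submatrix_one _ Sum.inr_injective
    rwa [e, Matrix.mul_one] at this
  set k₁ := U 2 * revMat p with hk₁
  set k₂ := V 2 * revMat q with hk₂
  have hk₁' : k₁ᴴ * k₁ = 1 := by
    rw [hk₁, conjTranspose_mul, Matrix.mul_assoc, ← Matrix.mul_assoc (U 2)ᴴ, hU2, Matrix.one_mul,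
      revMat_conjTranspose_mul]
  have hk₂' : k₂ᴴ * k₂ = 1 := by
    rw [hk₂, conjTranspose_mul, Matrix.mul_assoc, ← Matrix.mul_assoc (V 2)ᴴ, hV2, Matrix.one_mul,
      revMat_conjTranspose_mul]
  have hk₁'' : k₁ * k₁ᴴ = 1 := mul_eq_one_comm.1 hk₁'
  have hk₂'' : k₂ * k₂ᴴ = 1 := mul_eq_one_comm.1 hk₂'
  have cw : ∀ {r : ℕ} (x : Fin r → ℝ) (W : Matrix (Fin r) (Fin r) ℂ), Wᴴ * W = 1 →
      W * diagonal (fun i => ((coweight Γ x i : ℝ) : ℂ)) * Wᴴ =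
      (Γ : ℂ) • 1 - W * revMat r * diagonal (fun i => (x i : ℂ)) * (W * revMat r)ᴴ := by
    intro r x W hW
    have h1 : diagonal (fun i => ((coweight Γ x i : ℝ) : ℂ)) =
        (Γ : ℂ) • 1 - revMat r * diagonal (fun i => (x i : ℂ)) * (revMat r)ᴴ := by
      rw [revMat_mul_diagonal, smul_one_eq_diagonal, diagonal_sub]
      congr 1; ext i; simp [coweight]
    rw [h1, Matrix.mul_sub, Matrix.sub_mul, Matrix.mul_smul, Matrix.mul_one, Matrix.smul_mul,
      mul_eq_one_comm.1 hW, conjTranspose_mul]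
    simp only [Matrix.mul_assoc]
  have hK : bdiag (U 2) (V 2) * dg (coweight Γ x₁) (coweight Γ x₂) * (bdiag (U 2) (V 2))ᴴ =
      (Γ : ℂ) • 1 - bdiag k₁ k₂ * dg x₁ x₂ * (bdiag k₁ k₂)ᴴ := by
    rw [bdiag_conjTranspose, bdiag_conjTranspose, fromBlocks_multiply, fromBlocks_multiply,
      fromBlocks_multiply, fromBlocks_multiply, ← fromBlocks_one, fromBlocks_smul]
    simp only [Matrix.mul_zero, Matrix.zero_mul, add_zero, zero_add, smul_zero]
    rw [cw x₁ _ hU2, cw x₂ _ hV2, sub_eq_add_neg (fromBlocks _ _ _ _), fromBlocks_neg,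
      fromBlocks_add, neg_zero, neg_zero, add_zero, add_zero, ← sub_eq_add_neg, ← sub_eq_add_neg]
  have hKK : (bdiag k₁ k₂)ᴴ * bdiag k₁ k₂ = 1 := by
    rw [bdiag_conjTranspose, fromBlocks_multiply]
    simp only [Matrix.mul_zero, Matrix.zero_mul, add_zero, zero_add, hk₁', hk₂', fromBlocks_one]
  have hKs : bdiag k₁ k₂ * sig (Fin p) (Fin q) * (bdiag k₁ k₂)ᴴ = sig (Fin p) (Fin q) := by
    rw [bdiag_conjTranspose, fromBlocks_multiply, fromBlocks_multiply]
    simp only [Matrix.mul_zero, Matrix.zero_mul, add_zero, zero_add, Matrix.mul_one,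
      Matrix.mul_neg, Matrix.neg_mul, hk₁'', hk₂'', neg_zero]
  have hmain : frame ζ P U V 0 * dg a₁ a₂ * (frame ζ P U V 0)ᴴ +
      frame ζ P U V 1 * dg b₁ b₂ * (frame ζ P U V 1)ᴴ =
      bdiag k₁ k₂ * dg x₁ x₂ * (bdiag k₁ k₂)ᴴ := by
    have h3 : frame ζ P U V 2 * dg (coweight Γ x₁) (coweight Γ x₂) * (frame ζ P U V 2)ᴴ =
        (Γ : ℂ) • 1 - bdiag k₁ k₂ * dg x₁ x₂ * (bdiag k₁ k₂)ᴴ := by rw [hf, hK]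
    have h4 : frame ζ P U V 0 * dg a₁ a₂ * (frame ζ P U V 0)ᴴ +
      frame ζ P U V 1 * dg b₁ b₂ * (frame ζ P U V 1)ᴴ +
      frame ζ P U V 2 * dg (coweight Γ x₁) (coweight Γ x₂) * (frame ζ P U V 2)ᴴ =
        (Γ : ℂ) • 1 := hsum
    rw [h3] at h4
    have := eq_sub_of_add_eq h4
    rw [this]; abel
  generalize bdiag k₁ k₂ = K at hKK hKs hmain
  have hg : ∀ k, ((Kᴴ * frame ζ P U V k))ᴴ * sig (Fin p) (Fin q) * (Kᴴ * frame ζ P U V k) =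
      sig (Fin p) (Fin q) := fun k => by
    have : ((Kᴴ * frame ζ P U V k))ᴴ * sig (Fin p) (Fin q) * (Kᴴ * frame ζ P U V k) =
        (frame ζ P U V k)ᴴ * (K * sig (Fin p) (Fin q) * Kᴴ) * frame ζ P U V k := by
      rw [conjTranspose_mul, conjTranspose_conjTranspose]
      simp only [Matrix.mul_assoc]
    rw [this, hKs, hsig]
  refine ⟨Kᴴ * frame ζ P U V 0, Kᴴ * frame ζ P U V 1, hg 0, hg 1, ?_⟩
  have h5 : dg x₁ x₂ = Kᴴ * (K * dg x₁ x₂ * Kᴴ) * K := by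
    have : Kᴴ * (K * dg x₁ x₂ * Kᴴ) * K = (Kᴴ * K) * dg x₁ x₂ * (Kᴴ * K) := by
      simp only [Matrix.mul_assoc]
    rw [this, hKK, Matrix.one_mul, Matrix.mul_one]
  rw [h5, ← hmain]
  simp only [conjTranspose_mul, conjTranspose_conjTranspose, Matrix.mul_add, Matrix.add_mul,
    Matrix.mul_assoc]

/-! ### Convexity of the block problem -/

theorem trace_sig_mul_dg (a₁ : Fin p → ℝ) (a₂ : Fin q → ℝ) :
    (sig (Fin p) (Fin q) * dg a₁ a₂).trace = ((∑ i, a₁ i - ∑ i, a₂ i : ℝ) : ℂ) := by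
  rw [fromBlocks_multiply, trace_blocks]
  simp [trace, sub_eq_add_neg]

theorem Sol.sum_eq {a₁ b₁ x₁ : Fin p → ℝ} {a₂ b₂ x₂ : Fin q → ℝ}
    (h : Sol a₁ b₁ x₁ a₂ b₂ x₂) :
    ∑ i, a₁ i + ∑ i, b₁ i - ∑ i, x₁ i = ∑ i, a₂ i + ∑ i, b₂ i - ∑ i, x₂ i := by
  obtain ⟨g, h, hg, hh, e⟩ := h
  have key : ∀ (g : Matrix (Fin p ⊕ Fin q) (Fin p ⊕ Fin q) ℂ) (c₁ : Fin p → ℝ) (c₂ : Fin q → ℝ),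
      gᴴ * sig (Fin p) (Fin q) * g = sig (Fin p) (Fin q) →
      (sig (Fin p) (Fin q) * (g * dg c₁ c₂ * gᴴ)).trace = ((∑ i, c₁ i - ∑ i, c₂ i : ℝ) : ℂ) := by
    intro g c₁ c₂ hg
    rw [← trace_sig_mul_dg, ← Matrix.mul_assoc, Matrix.trace_mul_comm, ← Matrix.mul_assoc,
      ← Matrix.mul_assoc, hg]
  have h1 := congrArg (fun M => (sig (Fin p) (Fin q) * M).trace) e
  simp only [Matrix.mul_add, trace_add] at h1
  rw [key _ _ _ hg, key _ _ _ hh, trace_sig_mul_dg] at h1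
  have h2 : (∑ i, a₁ i - ∑ i, a₂ i) + (∑ i, b₁ i - ∑ i, b₂ i) = ∑ i, x₁ i - ∑ i, x₂ i := by
    exact_mod_cast h1
  linarith

theorem coweight_add_smul (Γ : ℝ) (x y : Fin p → ℝ) {s t : ℝ} (hst : s + t = 1) :
    coweight Γ (s • x + t • y) = s • coweight Γ x + t • coweight Γ y := by
  ext j
  simp only [coweight, Pi.add_apply, Pi.smul_apply, smul_eq_mul]
  linear_combination (-Γ) * hst

theorem weights_add_smul (Γ : ℝ) (a b x y : Fin p → ℝ) {s t : ℝ} (hst : s + t = 1) :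
    s • ![a, b, coweight Γ x] + t • ![a, b, coweight Γ y] =
      ![a, b, coweight Γ (s • x + t • y)] := by
  have h : ∀ c : Fin p → ℝ, s • c + t • c = c := fun c => by rw [← _root_.add_smul, hst, one_smul]
  rw [coweight_add_smul Γ x y hst]
  funext k
  fin_cases k
  · exact h a
  · exact h b
  · rfl

theorem drop_weights_nonneg {a b x : Fin p → ℝ} {Γ : ℝ} (ha : Antitone a) (ha' : ∀ i, 0 < a i)
    (hb : Antitone b) (hb' : ∀ i, 0 < b i) (hx : Antitone x) (hx' : ∀ i, x i ≤ Γ)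
    (k : Fin 3) (i : Fin p) : 0 ≤ drop (![a, b, coweight Γ x] k) i := by
  fin_cases k
  · exact drop_nonneg ha (fun i => (ha' i).le) i
  · exact drop_nonneg hb (fun i => (hb' i).le) i
  · exact drop_nonneg (coweight_antitone hx) (fun i => sub_nonneg.2 (hx' _)) i

theorem Sol.convex (hq : 1 ≤ q) {a₁ b₁ x₁ y₁ : Fin p → ℝ} {a₂ b₂ x₂ y₂ : Fin q → ℝ}
    (ha₁ : Antitone a₁) (ha₁' : ∀ i, 0 < a₁ i) (ha₂ : Antitone a₂) (ha₂' : ∀ i, 0 < a₂ i)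
    (hb₁ : Antitone b₁) (hb₁' : ∀ i, 0 < b₁ i) (hb₂ : Antitone b₂) (hb₂' : ∀ i, 0 < b₂ i)
    (hx₁ : Antitone x₁) (hx₂ : Antitone x₂) (hy₁ : Antitone y₁) (hy₂ : Antitone y₂)
    (hx : Sol a₁ b₁ x₁ a₂ b₂ x₂) (hy : Sol a₁ b₁ y₁ a₂ b₂ y₂) {s t : ℝ} (hs : 0 ≤ s) (ht : 0 ≤ t)
    (hst : s + t = 1) : Sol a₁ b₁ (s • x₁ + t • y₁) a₂ b₂ (s • x₂ + t • y₂) := by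
  obtain ⟨Γ, hΓ, gx₁, gx₂, gy₁, gy₂⟩ : ∃ Γ : ℝ, 0 ≤ Γ ∧ (∀ i, x₁ i ≤ Γ) ∧ (∀ i, x₂ i ≤ Γ) ∧
      (∀ i, y₁ i ≤ Γ) ∧ (∀ i, y₂ i ≤ Γ) := by
    have n : ∀ {r : ℕ} (z : Fin r → ℝ), 0 ≤ ∑ i, |z i| := fun z =>
      Finset.sum_nonneg fun i _ => abs_nonneg _
    have l : ∀ {r : ℕ} (z : Fin r → ℝ) i, z i ≤ ∑ i, |z i| := fun z i =>
      (le_abs_self _).trans (Finset.single_le_sum (f := fun i => |z i|)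
        (fun i _ => abs_nonneg _) (Finset.mem_univ i))
    have n1 := n x₁
    have n2 := n x₂
    have n3 := n y₁
    have n4 := n y₂
    refine ⟨∑ i, |x₁ i| + ∑ i, |x₂ i| + ∑ i, |y₁ i| + ∑ i, |y₂ i|, by linarith, ?_, ?_, ?_, ?_⟩
    · intro i; linarith [l x₁ i]
    · intro i; linarith [l x₂ i]
    · intro i; linarith [l y₁ i]
    · intro i; linarith [l y₂ i]
  have ex := exists_semi_of_sol (Γ := Γ) ha₁ (fun i => (ha₁' i).le) ha₂ (fun i => (ha₂' i).le) hb₁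
    (fun i => (hb₁' i).le) hb₂ (fun i => (hb₂' i).le) hx₁ gx₁ hx₂ gx₂ hx
  have ey := exists_semi_of_sol (Γ := Γ) ha₁ (fun i => (ha₁' i).le) ha₂ (fun i => (ha₂' i).le) hb₁
    (fun i => (hb₁' i).le) hb₂ (fun i => (hb₂' i).le) hy₁ gy₁ hy₂ gy₂ hy
  obtain ⟨ζ, G, F, hGF, sx, sy⟩ := exists_common_semi
    (drop_weights_nonneg ha₁ ha₁' hb₁ hb₁' hx₁ gx₁) (drop_weights_nonneg ha₂ ha₂' hb₂ hb₂' hx₂ gx₂)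
    (drop_weights_nonneg ha₁ ha₁' hb₁ hb₁' hy₁ gy₁) (drop_weights_nonneg ha₂ ha₂' hb₂ hb₂' hy₂ gy₂)
    ex ey
  have sz := sx.add_smul sy hs ht hst
  rw [weights_add_smul Γ _ _ _ _ hst, weights_add_smul Γ _ _ _ _ hst] at sz
  have anti : ∀ {r : ℕ} {x y : Fin r → ℝ}, Antitone x → Antitone y → Antitone (s • x + t • y) :=
    fun hx hy i j hij => add_le_add (mul_le_mul_of_nonneg_left (hx hij) hs)
      (mul_le_mul_of_nonneg_left (hy hij) ht)
  have le : ∀ {r : ℕ} {x y : Fin r → ℝ}, (∀ i, x i ≤ Γ) → (∀ i, y i ≤ Γ) →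
      ∀ i, (s • x + t • y) i ≤ Γ := fun {r x y} hx hy i => by
    have h1 := mul_le_mul_of_nonneg_left (hx i) hs
    have h2 := mul_le_mul_of_nonneg_left (hy i) ht
    have h3 : s * Γ + t * Γ = Γ := by rw [← add_mul, hst, one_mul]
    simp only [Pi.add_apply, Pi.smul_apply, smul_eq_mul]
    linarith
  have hw₁ := drop_weights_nonneg ha₁ ha₁' hb₁ hb₁' (anti hx₁ hy₁) (le gx₁ gy₁)
  have hw₂ := drop_weights_nonneg ha₂ ha₂' hb₂ hb₂' (anti hx₂ hy₂) (le gx₂ gy₂)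
  have lin : ∀ {r : ℕ} (x y : Fin r → ℝ), ∑ i, (s • x + t • y) i = s * ∑ i, x i + t * ∑ i, y i :=
    fun x y => by
      simp only [Pi.add_apply, Pi.smul_apply, smul_eq_mul, Finset.sum_add_distrib,
        Finset.mul_sum]
  have tot : ∀ {r : ℕ} (a b x : Fin r → ℝ), ∑ k, ∑ j, (![a, b, coweight Γ x] k) j - Γ * r =
      ∑ i, a i + ∑ i, b i - ∑ i, x i := fun {r} a b x => by
    rw [Fin.sum_univ_three]
    have h1 : ∑ j, (![a, b, coweight Γ x] 2) j = r * Γ - ∑ i, x i := sum_coweight Γ x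
    rw [h1]
    change ∑ i, a i + ∑ i, b i + _ - _ = _
    ring
  have ex' := hx.sum_eq
  have ey' := hy.sum_eq
  obtain ⟨ζ', P, U, V, hD, hP₁, hP₂, hU, hV, hmin⟩ := sz.exists_minimizer hw₁ hw₂
    (fun k => (hGF k).1) (fun k => (hGF k).2)
    (by rw [tot, lin]; linear_combination s * ex' + t * ey' - (∑ i, a₁ i + ∑ i, b₁ i) * hst)
    (by rw [tot, lin]; linear_combination -(∑ i, a₂ i + ∑ i, b₂ i) * hst)
    ⟨q - 1, by omega⟩ (Nat.sub_add_cancel hq) (ha₂' _) (hb₂' _)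
  exact sol_of_minimizer hΓ hw₁ hw₂ hD hP₁ hP₂ hU hV hmin

/-! ### Reduction of the orbit problem to congruences of positive diagonal matrices -/

theorem conjTranspose_mul_mul_of_mul_mul_conjTranspose {m : Type*} [Fintype m] [DecidableEq m]
    {J g : Matrix m m ℂ} (hJ : J * J = 1) (h : g * J * gᴴ = J) : gᴴ * J * g = J := by
  have h1 : g * (J * gᴴ * J) = 1 := by
    rw [← Matrix.mul_assoc, ← Matrix.mul_assoc, h, hJ]
  have h2 := mul_eq_one_comm.1 h1
  calc gᴴ * J * g = J * (J * gᴴ * J * g) := by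
        simp only [← Matrix.mul_assoc]; rw [hJ, Matrix.one_mul]
    _ = J := by rw [h2, Matrix.mul_one]

theorem Ipq_mul_self (p q : ℕ) : Ipq p q * Ipq p q = 1 := by
  rw [Ipq, diagonal_mul_diagonal, ← diagonal_one]
  congr 1
  ext i
  split_ifs <;> simp

theorem inv_eq_of_mem_Upq {g : Matrix (Fin (p + q)) (Fin (p + q)) ℂ}
    (hg : g * Ipq p q * gᴴ = Ipq p q) : g⁻¹ = Ipq p q * gᴴ * Ipq p q :=
  inv_eq_right_inv (by rw [← Matrix.mul_assoc, ← Matrix.mul_assoc, hg, Ipq_mul_self])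

theorem mem_Upq_iff {g : Matrix (Fin (p + q)) (Fin (p + q)) ℂ} :
    g ∈ Upq p q ↔ g * Ipq p q * gᴴ = Ipq p q := by
  refine ⟨fun h => h.2, fun h => ⟨?_, h⟩⟩
  have h1 : g * (Ipq p q * gᴴ * Ipq p q) = 1 := by
    rw [← Matrix.mul_assoc, ← Matrix.mul_assoc, h, Ipq_mul_self]
  exact IsUnit.of_mul_eq_one _ h1

theorem mul_mem_Upq {g h : Matrix (Fin (p + q)) (Fin (p + q)) ℂ} (hg : g ∈ Upq p q)
    (hh : h ∈ Upq p q) : g * h ∈ Upq p q := by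
  rw [mem_Upq_iff] at *
  calc g * h * Ipq p q * (g * h)ᴴ = g * (h * Ipq p q * hᴴ) * gᴴ := by
        simp only [conjTranspose_mul, Matrix.mul_assoc]
    _ = Ipq p q := by rw [hh, hg]

theorem orbit_subset_iff {A B x : Fin (p + q) → ℝ} :
    Orbit p q x ⊆ Orbit p q A + Orbit p q B ↔
      ∃ g ∈ Upq p q, ∃ h ∈ Upq p q, g * dmat A * g⁻¹ + h * dmat B * h⁻¹ = dmat x := by
  constructor
  · intro hs
    have h1 : dmat x ∈ Orbit p q x := ⟨1, by rw [mem_Upq_iff]; simp, by simp⟩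
    obtain ⟨_, ⟨g, hg, rfl⟩, _, ⟨h, hh, rfl⟩, e⟩ := Set.mem_add.1 (hs h1)
    exact ⟨g, hg, h, hh, e⟩
  · rintro ⟨g, hg, h, hh, e⟩ _ ⟨k, hk, rfl⟩
    refine Set.mem_add.2 ⟨_, ⟨k * g, mul_mem_Upq hk hg, rfl⟩, _,
      ⟨k * h, mul_mem_Upq hk hh, rfl⟩, ?_⟩
    rw [← e, Matrix.mul_inv_rev, Matrix.mul_inv_rev]
    simp only [Matrix.mul_add, Matrix.add_mul, Matrix.mul_assoc]

/-- The signed distance of the coordinates of `x` to `c`. -/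
noncomputable def sval {p q : ℕ} (x : Fin (p + q) → ℝ) (c : ℝ) (i : Fin (p + q)) : ℝ :=
  (x i - c) * if (i : ℕ) < p then 1 else -1

/-- The diagonal matrix with entries `sval x c`. -/
noncomputable def smat {p q : ℕ} (x : Fin (p + q) → ℝ) (c : ℝ) :
    Matrix (Fin (p + q)) (Fin (p + q)) ℂ :=
  diagonal fun i => (sval x c i : ℂ)

theorem dmat_eq (x : Fin (p + q) → ℝ) (c : ℝ) :
    dmat x = (I * (c : ℂ)) • 1 + I • (smat x c * Ipq p q) := by
  rw [dmat, smat, Ipq, diagonal_mul_diagonal, smul_one_eq_diagonal, ← diagonal_smul, diagonal_add]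
  congr 1
  ext i
  simp only [sval, Pi.smul_apply, smul_eq_mul]
  split_ifs <;> push_cast <;> ring

theorem conj_dmat {g : Matrix (Fin (p + q)) (Fin (p + q)) ℂ} (hg : g ∈ Upq p q)
    (x : Fin (p + q) → ℝ) (c : ℝ) :
    g * dmat x * g⁻¹ = (I * (c : ℂ)) • 1 + I • (g * smat x c * gᴴ * Ipq p q) := by
  have h1 : g * g⁻¹ = 1 := mul_nonsing_inv _ ((isUnit_iff_isUnit_det _).1 hg.1)
  rw [dmat_eq x c, Matrix.mul_add, Matrix.add_mul, Matrix.mul_smul, Matrix.smul_mul,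
    Matrix.mul_one, h1, Matrix.mul_smul, Matrix.smul_mul, inv_eq_of_mem_Upq (mem_Upq_iff.1 hg)]
  congr 2
  have : g * (smat x c * Ipq p q) * (Ipq p q * gᴴ * Ipq p q) =
      g * smat x c * (Ipq p q * Ipq p q) * gᴴ * Ipq p q := by simp only [Matrix.mul_assoc]
  rw [this, Ipq_mul_self, Matrix.mul_one]

/-- The sum problem for congruence orbits of diagonal matrices. -/
def CongrSum {p q : ℕ} (A B : Fin (p + q) → ℝ) (c c' : ℝ) (x : Fin (p + q) → ℝ) : Prop :=
  ∃ g h : Matrix (Fin (p + q)) (Fin (p + q)) ℂ, g * Ipq p q * gᴴ = Ipq p q ∧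
    h * Ipq p q * hᴴ = Ipq p q ∧
    g * smat A c * gᴴ + h * smat B c' * hᴴ = smat x (c + c')

theorem orbit_subset_iff_congrSum {A B x : Fin (p + q) → ℝ} (c c' : ℝ) :
    Orbit p q x ⊆ Orbit p q A + Orbit p q B ↔ CongrSum A B c c' x := by
  rw [orbit_subset_iff]
  have key : ∀ g h : Matrix (Fin (p + q)) (Fin (p + q)) ℂ, g ∈ Upq p q → h ∈ Upq p q →
      (g * dmat A * g⁻¹ + h * dmat B * h⁻¹ = dmat x ↔
        g * smat A c * gᴴ + h * smat B c' * hᴴ = smat x (c + c')) := by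
    intro g h hg hh
    rw [conj_dmat hg A c, conj_dmat hh B c', dmat_eq x (c + c')]
    have e : (I * (c : ℂ)) • (1 : Matrix (Fin (p + q)) (Fin (p + q)) ℂ) +
        I • (g * smat A c * gᴴ * Ipq p q) + ((I * (c' : ℂ)) • 1 +
        I • (h * smat B c' * hᴴ * Ipq p q)) = (I * ((c + c' : ℝ) : ℂ)) • 1 +
        I • ((g * smat A c * gᴴ + h * smat B c' * hᴴ) * Ipq p q) := by
      rw [Matrix.add_mul, smul_add, Complex.ofReal_add, mul_add, _root_.add_smul]
      abel
    rw [e, add_right_inj]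
    constructor
    · intro h1
      have h2 := congrArg (· * Ipq p q) (smul_right_injective _ I_ne_zero h1)
      simpa only [Matrix.mul_assoc, Ipq_mul_self, Matrix.mul_one] using h2
    · intro h1; rw [h1]
  constructor
  · rintro ⟨g, hg, h, hh, e⟩
    exact ⟨g, h, mem_Upq_iff.1 hg, mem_Upq_iff.1 hh, (key g h hg hh).1 e⟩
  · rintro ⟨g, h, hg, hh, e⟩
    exact ⟨g, mem_Upq_iff.2 hg, h, mem_Upq_iff.2 hh,
      (key g h (mem_Upq_iff.2 hg) (mem_Upq_iff.2 hh)).2 e⟩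

theorem exists_center (hp : 1 ≤ p) (hq : 1 ≤ q) {A : Fin (p + q) → ℝ} (hA : A ∈ Chol p q) :
    ∃ c, ∀ i, 0 < sval A c i := by
  set a := A ⟨p - 1, by omega⟩ with ha
  set b := A ⟨p, by omega⟩ with hb
  have hab : b < a := hA.2 _ _ (show p - 1 < p by omega) le_rfl
  refine ⟨(a + b) / 2, fun i => ?_⟩
  rw [sval]
  split_ifs with hi
  · have : a ≤ A i := hA.1 _ _ (show (i : ℕ) ≤ p - 1 by omega) (Or.inl (show p - 1 < p by omega))
    linarith
  · have : A i ≤ b := hA.1 ⟨p, by omega⟩ i (show p ≤ (i : ℕ) by omega) (Or.inr le_rfl)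
    linarith

theorem smat_posDef_iff {x : Fin (p + q) → ℝ} {c : ℝ} :
    (smat x c).PosDef ↔ ∀ i, 0 < sval x c i := by
  rw [smat, posDef_diagonal_iff]
  simp only [Complex.zero_lt_real]

theorem CongrSum.sval_pos {A B x : Fin (p + q) → ℝ} {c c' : ℝ} (hA : ∀ i, 0 < sval A c i)
    (hB : ∀ i, 0 < sval B c' i) (h : CongrSum A B c c' x) (i : Fin (p + q)) :
    0 < sval x (c + c') i := by
  obtain ⟨g, h, hg, hh, e⟩ := h
  revert i
  rw [← smat_posDef_iff, ← e]
  have hd : ∀ g : Matrix (Fin (p + q)) (Fin (p + q)) ℂ, g * Ipq p q * gᴴ = Ipq p q →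
      gᴴ.det ≠ 0 := fun g hg => by
    rw [det_conjTranspose]
    exact star_ne_zero.2 ((isUnit_iff_isUnit_det _).1 (mem_Upq_iff.2 hg).1).ne_zero
  have h1 := posDef_conj (smat_posDef_iff.2 hA) (hd g hg)
  have h2 := posDef_conj (smat_posDef_iff.2 hB) (hd h hh)
  rw [conjTranspose_conjTranspose] at h1 h2
  exact h1.add h2

theorem lt_of_sval_pos {x : Fin (p + q) → ℝ} {c : ℝ} (h : ∀ i, 0 < sval x c i)
    {i j : Fin (p + q)} (hi : (i : ℕ) < p) (hj : p ≤ (j : ℕ)) : x j < x i := by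
  have h1 := h i
  have h2 := h j
  rw [sval, if_pos hi] at h1
  rw [sval, if_neg hj.not_gt] at h2
  linarith

/-! ### Convexity and closedness of the solution set -/

/-- The indexing of `Fin (p + q)` by blocks, with the second block reversed. -/
def blockEquiv (p q : ℕ) : Fin p ⊕ Fin q ≃ Fin (p + q) :=
  (Equiv.sumCongr (Equiv.refl _) Fin.revPerm).trans finSumFinEquiv

theorem blockEquiv_inl (i : Fin p) : ((blockEquiv p q (Sum.inl i) : Fin (p + q)) : ℕ) = i := by
  simp [blockEquiv]

theorem blockEquiv_inr (j : Fin q) :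
    ((blockEquiv p q (Sum.inr j) : Fin (p + q)) : ℕ) = p + (q - (j + 1)) := by
  simp [blockEquiv, Fin.val_rev]

theorem submatrix_mul_mul_conjTranspose {m n : Type*} [Fintype m] [Fintype n] (e : m ≃ n)
    (g M : Matrix n n ℂ) :
    (g * M * gᴴ).submatrix e e = g.submatrix e e * M.submatrix e e * (g.submatrix e e)ᴴ := by
  rw [conjTranspose_submatrix, submatrix_mul_equiv, submatrix_mul_equiv]

theorem Ipq_submatrix : (Ipq p q).submatrix (blockEquiv p q) (blockEquiv p q) =
    sig (Fin p) (Fin q) := by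
  have : sig (Fin p) (Fin q) = diagonal (Sum.elim (fun _ => (1 : ℂ)) fun _ => (-1 : ℂ)) := by
    rw [← fromBlocks_diagonal, diagonal_one]
    rw [← diagonal_one, ← diagonal_neg]
    rfl
  rw [Ipq, submatrix_diagonal_equiv, this]
  congr 1
  ext (i | j)
  · simp [blockEquiv_inl]
  · simp [blockEquiv_inr]

/-- The first block of the signed distances of `x` to `c`. -/
noncomputable def sval₁ {p q : ℕ} (x : Fin (p + q) → ℝ) (c : ℝ) (i : Fin p) : ℝ :=
  sval x c (blockEquiv p q (Sum.inl i))

/-- The reversed second block of the signed distances of `x` to `c`. -/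
noncomputable def sval₂ {p q : ℕ} (x : Fin (p + q) → ℝ) (c : ℝ) (j : Fin q) : ℝ :=
  sval x c (blockEquiv p q (Sum.inr j))

theorem smat_submatrix (x : Fin (p + q) → ℝ) (c : ℝ) :
    (smat x c).submatrix (blockEquiv p q) (blockEquiv p q) = dg (sval₁ x c) (sval₂ x c) := by
  rw [smat, submatrix_diagonal_equiv, dg_eq_diagonal]
  congr 1
  ext (i | j) <;> rfl

theorem sig_mul_self : sig (Fin p) (Fin q) * sig (Fin p) (Fin q) = 1 := by
  rw [sig, fromBlocks_multiply]
  simp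

theorem mul_mul_conjTranspose_of_conjTranspose_mul_mul {m : Type*} [Fintype m] [DecidableEq m]
    {J g : Matrix m m ℂ} (hJ : J * J = 1) (h : gᴴ * J * g = J) : g * J * gᴴ = J := by
  have := conjTranspose_mul_mul_of_mul_mul_conjTranspose (g := gᴴ) hJ
    (by rwa [conjTranspose_conjTranspose])
  rwa [conjTranspose_conjTranspose] at this

theorem congrSum_iff_sol {A B x : Fin (p + q) → ℝ} {c c' : ℝ} :
    CongrSum A B c c' x ↔ Sol (sval₁ A c) (sval₁ B c') (sval₁ x (c + c'))
      (sval₂ A c) (sval₂ B c') (sval₂ x (c + c')) := by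
  set e := blockEquiv p q with he
  have hinj : Function.Injective fun M : Matrix (Fin (p + q)) (Fin (p + q)) ℂ =>
      M.submatrix e e := (Matrix.reindex e.symm e.symm).injective
  constructor
  · rintro ⟨g, h, hg, hh, k⟩
    refine ⟨g.submatrix e e, h.submatrix e e,
      conjTranspose_mul_mul_of_mul_mul_conjTranspose sig_mul_self ?_,
      conjTranspose_mul_mul_of_mul_mul_conjTranspose sig_mul_self ?_, ?_⟩
    · rw [← Ipq_submatrix, ← submatrix_mul_mul_conjTranspose, hg]
    · rw [← Ipq_submatrix, ← submatrix_mul_mul_conjTranspose, hh]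
    · rw [← smat_submatrix, ← smat_submatrix, ← smat_submatrix,
        ← submatrix_mul_mul_conjTranspose, ← submatrix_mul_mul_conjTranspose, ← k]
      rfl
  · rintro ⟨g, h, hg, hh, k⟩
    obtain ⟨g, rfl⟩ : ∃ g' : Matrix (Fin (p + q)) (Fin (p + q)) ℂ, g'.submatrix e e = g :=
      (Matrix.reindex e.symm e.symm).surjective g
    obtain ⟨h, rfl⟩ : ∃ g' : Matrix (Fin (p + q)) (Fin (p + q)) ℂ, g'.submatrix e e = h :=
      (Matrix.reindex e.symm e.symm).surjective h
    have hg' := mul_mul_conjTranspose_of_conjTranspose_mul_mul sig_mul_self hg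
    have hh' := mul_mul_conjTranspose_of_conjTranspose_mul_mul sig_mul_self hh
    rw [← Ipq_submatrix, ← submatrix_mul_mul_conjTranspose] at hg' hh'
    rw [← smat_submatrix, ← smat_submatrix, ← smat_submatrix,
        ← submatrix_mul_mul_conjTranspose, ← submatrix_mul_mul_conjTranspose] at k
    exact ⟨g, h, hinj hg', hinj hh', hinj k⟩

/-- The tuples that decrease weakly on each of the two blocks. -/
def weakChamber (p q : ℕ) : Set (Fin (p + q) → ℝ) :=
  {x | ∀ i j : Fin (p + q), (i : ℕ) ≤ (j : ℕ) → ((j : ℕ) < p ∨ p ≤ (i : ℕ)) → x j ≤ x i}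

theorem sval₁_eq (x : Fin (p + q) → ℝ) (c : ℝ) (i : Fin p) :
    sval₁ x c i = x (blockEquiv p q (Sum.inl i)) - c := by
  rw [sval₁, sval, if_pos (by rw [blockEquiv_inl]; exact i.2), mul_one]

theorem sval₂_eq (x : Fin (p + q) → ℝ) (c : ℝ) (j : Fin q) :
    sval₂ x c j = c - x (blockEquiv p q (Sum.inr j)) := by
  rw [sval₂, sval, if_neg (by rw [blockEquiv_inr]; omega)]
  ring

theorem antitone_sval₁ {x : Fin (p + q) → ℝ} (hx : x ∈ weakChamber p q) (c : ℝ) :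
    Antitone (sval₁ x c) := fun i j hij => by
  rw [sval₁_eq, sval₁_eq]
  refine sub_le_sub_right (hx _ _ ?_ (Or.inl ?_)) _
  · rw [blockEquiv_inl, blockEquiv_inl]; exact hij
  · rw [blockEquiv_inl]; exact j.2

theorem antitone_sval₂ {x : Fin (p + q) → ℝ} (hx : x ∈ weakChamber p q) (c : ℝ) :
    Antitone (sval₂ x c) := fun i j hij => by
  rw [sval₂_eq, sval₂_eq]
  have hij' : (i : ℕ) ≤ j := hij
  refine sub_le_sub_left (hx _ _ ?_ (Or.inr ?_)) _
  · rw [blockEquiv_inr, blockEquiv_inr]; omega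
  · rw [blockEquiv_inr]; omega

theorem setOf_orbit_subset_eq {A B : Fin (p + q) → ℝ} {c c' : ℝ} (hA : ∀ i, 0 < sval A c i)
    (hB : ∀ i, 0 < sval B c' i) :
    {x | x ∈ Chol p q ∧ Orbit p q x ⊆ Orbit p q A + Orbit p q B} =
      weakChamber p q ∩ {x | CongrSum A B c c' x} := by
  ext x
  rw [Set.mem_ofPred_eq, orbit_subset_iff_congrSum c c']
  exact ⟨fun h => ⟨h.1.1, h.2⟩, fun h => ⟨⟨h.1, fun i j hi hj =>
    lt_of_sval_pos (CongrSum.sval_pos hA hB h.2) hi hj⟩, h.2⟩⟩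

theorem convex_weakChamber_inter (hq : 1 ≤ q) {A B : Fin (p + q) → ℝ} {c c' : ℝ}
    (hA' : A ∈ weakChamber p q) (hB' : B ∈ weakChamber p q) (hA : ∀ i, 0 < sval A c i)
    (hB : ∀ i, 0 < sval B c' i) :
    Convex ℝ (weakChamber p q ∩ {x | CongrSum A B c c' x}) := by
  rintro x ⟨hx, hxs⟩ y ⟨hy, hys⟩ s t hs ht hst
  refine ⟨fun i j hij h => ?_, ?_⟩
  · have h1 := mul_le_mul_of_nonneg_left (hx i j hij h) hs
    have h2 := mul_le_mul_of_nonneg_left (hy i j hij h) ht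
    exact add_le_add h1 h2
  · rw [Set.mem_ofPred_eq, congrSum_iff_sol] at *
    have h := Sol.convex hq (antitone_sval₁ hA' c) (fun i => hA _) (antitone_sval₂ hA' c)
      (fun i => hA _) (antitone_sval₁ hB' c') (fun i => hB _) (antitone_sval₂ hB' c')
      (fun i => hB _) (antitone_sval₁ hx _) (antitone_sval₂ hx _) (antitone_sval₁ hy _)
      (antitone_sval₂ hy _) hxs hys hs ht hst
    convert h using 1 <;> ext i <;>
      simp only [sval₁_eq, sval₂_eq, Pi.add_apply, Pi.smul_apply, smul_eq_mul]
    · linear_combination (c + c') * hst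
    · linear_combination -(c + c') * hst

theorem isClosed_weakChamber : IsClosed (weakChamber p q) := by
  simp only [weakChamber, Set.ofPred_forall]
  exact isClosed_iInter fun i => isClosed_iInter fun j => isClosed_iInter fun _ =>
    isClosed_iInter fun _ => isClosed_le (continuous_apply j) (continuous_apply i)

theorem norm_sq_mul_le_of_add_eq_diagonal {m : Type*} [Fintype m] [DecidableEq m]
    {a b d : m → ℝ} (ha : ∀ i, 0 < a i) (hb : ∀ i, 0 < b i) {g h : Matrix m m ℂ}
    (e : g * diagonal (fun i => (a i : ℂ)) * gᴴ + h * diagonal (fun i => (b i : ℂ)) * hᴴ =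
      diagonal fun i => (d i : ℂ)) (i j : m) : ‖g i j‖ ^ 2 * a j ≤ d i := by
  have key : ∀ (g : Matrix m m ℂ) (a : m → ℝ),
      (g * diagonal (fun i => (a i : ℂ)) * gᴴ) i i = ((∑ k, ‖g i k‖ ^ 2 * a k : ℝ) : ℂ) := by
    intro g a
    rw [Matrix.mul_apply, Complex.ofReal_sum]
    refine Finset.sum_congr rfl fun k _ => ?_
    rw [mul_diagonal, conjTranspose_apply, RCLike.star_def, mul_right_comm, Complex.mul_conj']
    push_cast
    rfl
  have h1 := congrFun (congrFun e i) i
  rw [Matrix.add_apply, key, key, diagonal_apply_eq, ← Complex.ofReal_add,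
    Complex.ofReal_inj] at h1
  have h2 := Finset.single_le_sum (f := fun k => ‖g i k‖ ^ 2 * a k)
    (fun k _ => mul_nonneg (sq_nonneg _) (ha k).le) (Finset.mem_univ j)
  have h3 : 0 ≤ ∑ k, ‖h i k‖ ^ 2 * b k :=
    Finset.sum_nonneg fun k _ => mul_nonneg (sq_nonneg _) (hb k).le
  linarith

theorem exists_norm_bound {m : Type*} [Finite m] {a : m → ℝ} (ha : ∀ i, 0 < a i)
    {d : ℕ → m → ℝ} {d₀ : m → ℝ} (hd : Filter.Tendsto d Filter.atTop (nhds d₀)) :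
    ∃ R, ∀ (g : ℕ → Matrix m m ℂ), (∀ k i j, ‖g k i j‖ ^ 2 * a j ≤ d k i) →
      ∀ k i j, ‖g k i j‖ ≤ R := by
  have h1 : ∀ i, ∃ C, ∀ k, d k i ≤ C := fun i => by
    obtain ⟨C, hC⟩ := (((continuous_apply i).tendsto d₀).comp hd).bddAbove_range
    exact ⟨C, fun k => hC ⟨k, rfl⟩⟩
  choose C hC using h1
  obtain ⟨R, hR⟩ := Set.Finite.bddAbove (Set.finite_range fun z : m × m => C z.1 / a z.2)
  refine ⟨R + 1, fun g hg k i j => ?_⟩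
  have h2 : ‖g k i j‖ ^ 2 ≤ C i / a j := (le_div_iff₀ (ha j)).2 ((hg k i j).trans (hC i k))
  have h3 : C i / a j ≤ R := hR ⟨(i, j), rfl⟩
  nlinarith [norm_nonneg (g k i j), sq_nonneg (‖g k i j‖ - 1)]

theorem exists_tendsto_of_norm_le {m : Type*} [Finite m] {𝓤 : Ultrafilter ℕ} {R : ℝ}
    {g : ℕ → Matrix m m ℂ} (hg : ∀ k i j, ‖g k i j‖ ≤ R) :
    ∃ g₀, Filter.Tendsto g 𝓤 (nhds g₀) := by
  have hc : IsCompact (Metric.closedBall (0 : ℂ) R) := isCompact_closedBall _ _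
  have h1 : ∀ i j, ∃ z, Filter.Tendsto (fun k => g k i j) 𝓤 (nhds z) := fun i j => by
    obtain ⟨z, _, hz⟩ := hc.ultrafilter_le_nhds (𝓤.map fun k => g k i j)
      (Filter.le_principal_iff.2 (Filter.mem_map.2 (Filter.univ_mem' fun k => by
        simpa using hg k i j)))
    exact ⟨z, hz⟩
  choose g₀ hg₀ using h1
  exact ⟨g₀, tendsto_pi_nhds.2 fun i => tendsto_pi_nhds.2 fun j => hg₀ i j⟩

theorem continuous_sval (c : ℝ) :
    Continuous fun x : Fin (p + q) → ℝ => sval x c :=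
  continuous_pi fun i => ((continuous_apply i).sub continuous_const).mul continuous_const

theorem tendsto_mul_mul_conjTranspose {X m : Type*} [Fintype m] {𝓕 : Filter X}
    (S : Matrix m m ℂ) {U : X → Matrix m m ℂ} {U₀ : Matrix m m ℂ}
    (hU : Filter.Tendsto U 𝓕 (nhds U₀)) :
    Filter.Tendsto (fun x => U x * S * (U x)ᴴ) 𝓕 (nhds (U₀ * S * U₀ᴴ)) :=
  (((continuous_id.matrix_mul continuous_const).matrix_mul
    continuous_id.matrix_conjTranspose).tendsto U₀).comp hU

theorem isClosed_congrSum {A B : Fin (p + q) → ℝ} {c c' : ℝ} (hA : ∀ i, 0 < sval A c i)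
    (hB : ∀ i, 0 < sval B c' i) : IsClosed {x | CongrSum A B c c' x} := by
  refine IsSeqClosed.isClosed fun x x₀ hx hlim => ?_
  choose g h hg hh e using hx
  have hd : Filter.Tendsto (fun k => sval (x k) (c + c')) Filter.atTop
      (nhds (sval x₀ (c + c'))) := ((continuous_sval (c + c')).tendsto x₀).comp hlim
  obtain ⟨R, hR⟩ := exists_norm_bound hA hd
  obtain ⟨R', hR'⟩ := exists_norm_bound hB hd
  have bg := hR g fun k i j => norm_sq_mul_le_of_add_eq_diagonal hA hB (e k) i j
  have bh := hR' h fun k i j => norm_sq_mul_le_of_add_eq_diagonal hB hA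
    ((add_comm _ _).trans (e k)) i j
  obtain ⟨g₀, hg₀⟩ := exists_tendsto_of_norm_le (𝓤 := Ultrafilter.of Filter.atTop) bg
  obtain ⟨h₀, hh₀⟩ := exists_tendsto_of_norm_le (𝓤 := Ultrafilter.of Filter.atTop) bh
  have hs : Filter.Tendsto (fun k => smat (x k) (c + c'))
      (Ultrafilter.of (Filter.atTop : Filter ℕ)) (nhds (smat x₀ (c + c'))) := by
    have hc : Continuous fun x : Fin (p + q) → ℝ => smat x (c + c') :=
      Continuous.matrix_diagonal (continuous_pi fun i =>
        Complex.continuous_ofReal.comp ((continuous_apply i).comp (continuous_sval _)))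
    exact ((hc.tendsto x₀).comp hlim).mono_left (Ultrafilter.of_le _)
  have l1 := tendsto_mul_mul_conjTranspose (Ipq p q) hg₀
  have l2 := tendsto_mul_mul_conjTranspose (Ipq p q) hh₀
  have l3 := (tendsto_mul_mul_conjTranspose (smat A c) hg₀).add
    (tendsto_mul_mul_conjTranspose (smat B c') hh₀)
  simp only [hg] at l1
  simp only [hh] at l2
  simp only [e] at l3
  exact ⟨g₀, h₀, tendsto_nhds_unique l1 tendsto_const_nhds |>.symm ▸ rfl,
    tendsto_nhds_unique l2 tendsto_const_nhds |>.symm ▸ rfl, tendsto_nhds_unique l3 hs⟩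

end PseudoUnitary

theorem statement1 (p q : ℕ) (hq : 1 ≤ q) (hpq : q ≤ p)
    (A B : Fin (p + q) → ℝ) (hA : A ∈ Chol p q) (hB : B ∈ Chol p q) :
    Convex ℝ {x | x ∈ Chol p q ∧ Orbit p q x ⊆ Orbit p q A + Orbit p q B} ∧
    IsClosed {x | x ∈ Chol p q ∧ Orbit p q x ⊆ Orbit p q A + Orbit p q B} := by
  obtain ⟨c, hc⟩ := PseudoUnitary.exists_center (hq.trans hpq) hq hA
  obtain ⟨c', hc'⟩ := PseudoUnitary.exists_center (hq.trans hpq) hq hB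
  rw [PseudoUnitary.setOf_orbit_subset_eq hc hc']
  exact ⟨PseudoUnitary.convex_weakChamber_inter hq hA.1 hB.1 hc hc',
    PseudoUnitary.isClosed_weakChamber.inter (PseudoUnitary.isClosed_congrSum hc hc')⟩
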